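/- Given an interpretation Θ of the language in a linear category for duplication C, and a valid typing judgment Δ ⊢ M : A with two typing derivations π and π', the computational interpretations coincide: ⟦π⟧^c_Θ = ⟦π'⟧^c_Θ; and if M is a value, also ⟦π⟧^v_Θ = ⟦π'⟧^v_Θ. Hence the denotation of a valid typing judgment is well defined independently of the choice of typing derivation. -/

import Mathlib

/- The call-by-value linear lambda calculus of Selinger-Valiron, with Type-valued
   subtyping and typing derivations (used to define the categorical semantics). -/

namespace QLamSem

/-- Types: A,B ::= α | A ⊸ B | A ⊗ B | ⊤ | !A -/
inductive Ty : Type where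
  | tconst : ℕ → Ty
  | arrow : Ty → Ty → Ty
  | tensor : Ty → Ty → Ty
  | unit : Ty
  | bang : Ty → Ty
deriving DecidableEq

/-- `bangN n A` is `!ⁿA`. -/
def bangN : ℕ → Ty → Ty
  | 0, A => A
  | n + 1, A => Ty.bang (bangN n A)

/-- Derivations of the subtyping relation `A <: B`. -/
inductive SubD : Ty → Ty → Type where
  | tconst (n m a : ℕ) : (m = 0 ∨ 1 ≤ n) →
      SubD (bangN n (Ty.tconst a)) (bangN m (Ty.tconst a))
  | unit (n m : ℕ) : (m = 0 ∨ 1 ≤ n) →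
      SubD (bangN n Ty.unit) (bangN m Ty.unit)
  | arrow (n m : ℕ) (A A' B B' : Ty) : (m = 0 ∨ 1 ≤ n) → SubD A A' → SubD B B' →
      SubD (bangN n (Ty.arrow A' B)) (bangN m (Ty.arrow A B'))
  | tensor (n m : ℕ) (A A' B B' : Ty) : (m = 0 ∨ 1 ≤ n) → SubD A A' → SubD B B' →
      SubD (bangN n (Ty.tensor A B)) (bangN m (Ty.tensor A' B'))

/-- The subtyping relation `A <: B`. -/
def Sub (A B : Ty) : Prop := Nonempty (SubD A B)

/-- Indexed terms (with the `let` forms as primitive constructs). -/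
inductive Tm : Type where
  | var : ℕ → Ty → Tm
  | cst : ℕ → Ty → Tm
  | star : ℕ → Tm
  | lam : ℕ → ℕ → Ty → Tm → Tm
  | app : Tm → Tm → Tm
  | pair : ℕ → Tm → Tm → Tm
  | letv : ℕ → Ty → Tm → Tm → Tm
  | letPair : ℕ → ℕ → Ty → ℕ → Ty → Tm → Tm → Tm
  | letUnit : Tm → Tm → Tm
deriving DecidableEq

/-- The values among the terms. -/
def isValue : Tm → Bool
  | .var _ _ => true
  | .cst _ _ => true
  | .star _ => true
  | .lam _ _ _ _ => true
  | .app _ _ => false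
  | .pair _ V W => isValue V && isValue W
  | .letv _ _ V W => isValue V && isValue W
  | .letPair _ _ _ _ _ V W => isValue V && isValue W
  | .letUnit V W => isValue V && isValue W

/-- Untyped (pure) terms. -/
inductive PTm : Type where
  | var : ℕ → PTm
  | cst : ℕ → PTm
  | star : PTm
  | lam : ℕ → PTm → PTm
  | app : PTm → PTm → PTm
  | pair : PTm → PTm → PTm
  | letv : ℕ → PTm → PTm → PTm
  | letPair : ℕ → ℕ → PTm → PTm → PTm
  | letUnit : PTm → PTm → PTm
deriving DecidableEq

/-- The erasure operation, deleting all type and integer annotations. -/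
def erase : Tm → PTm
  | .var x _ => .var x
  | .cst c _ => .cst c
  | .star _ => .star
  | .lam _ x _ M => .lam x (erase M)
  | .app M N => .app (erase M) (erase N)
  | .pair _ M N => .pair (erase M) (erase N)
  | .letv x _ M N => .letv x (erase M) (erase N)
  | .letPair _ x _ y _ M N => .letPair x y (erase M) (erase N)
  | .letUnit M N => .letUnit (erase M) (erase N)

/-- `FreeAt x A M` : the term `M` has a free instance `x^A` of the variable `x`. -/
inductive FreeAt (x : ℕ) : Ty → Tm → Prop where
  | var (A : Ty) : FreeAt x A (.var x A)
  | lam {A : Ty} {M : Tm} (n y : ℕ) (B : Ty) : y ≠ x → FreeAt x A M →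
      FreeAt x A (.lam n y B M)
  | appL {A : Ty} {M : Tm} (N : Tm) : FreeAt x A M → FreeAt x A (.app M N)
  | appR {A : Ty} {N : Tm} (M : Tm) : FreeAt x A N → FreeAt x A (.app M N)
  | pairL {A : Ty} {M : Tm} (n : ℕ) (N : Tm) : FreeAt x A M → FreeAt x A (.pair n M N)
  | pairR {A : Ty} {N : Tm} (n : ℕ) (M : Tm) : FreeAt x A N → FreeAt x A (.pair n M N)
  | letvL {A : Ty} {M : Tm} (y : ℕ) (B : Ty) (N : Tm) : FreeAt x A M →
      FreeAt x A (.letv y B M N)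
  | letvR {A : Ty} {N : Tm} (y : ℕ) (B : Ty) (M : Tm) : y ≠ x → FreeAt x A N →
      FreeAt x A (.letv y B M N)
  | letPairL {A : Ty} {M : Tm} (n y : ℕ) (B : Ty) (z : ℕ) (C : Ty) (N : Tm) :
      FreeAt x A M → FreeAt x A (.letPair n y B z C M N)
  | letPairR {A : Ty} {N : Tm} (n y : ℕ) (B : Ty) (z : ℕ) (C : Ty) (M : Tm) :
      y ≠ x → z ≠ x → FreeAt x A N → FreeAt x A (.letPair n y B z C M N)
  | letUnitL {A : Ty} {M : Tm} (N : Tm) : FreeAt x A M → FreeAt x A (.letUnit M N)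
  | letUnitR {A : Ty} {N : Tm} (M : Tm) : FreeAt x A N → FreeAt x A (.letUnit M N)

/-- `x` occurs free in `M`. -/
def Free (x : ℕ) (M : Tm) : Prop := ∃ A, FreeAt x A M

/-- Substitution on untyped terms. -/
def psubst (x : ℕ) (V : PTm) : PTm → PTm
  | .var y => if y = x then V else .var y
  | .cst c => .cst c
  | .star => .star
  | .lam y M => if y = x then .lam y M else .lam y (psubst x V M)
  | .app M N => .app (psubst x V M) (psubst x V N)
  | .pair M N => .pair (psubst x V M) (psubst x V N)
  | .letv y M N => .letv y (psubst x V M) (if y = x then N else psubst x V N)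
  | .letPair y z M N =>
      .letPair y z (psubst x V M) (if y = x ∨ z = x then N else psubst x V N)
  | .letUnit M N => .letUnit (psubst x V M) (psubst x V N)

/-- Typing contexts as (ordered) lists of typed variables. -/
abbrev CtxL : Type := List (ℕ × Ty)

/-- The names of the variables of a context. -/
def names (Γ : CtxL) : List ℕ := Γ.map Prod.fst

/-- `!Δ`: the context obtained from `Δ` by prefixing every type with `!`. -/
def bangify (Δ : CtxL) : CtxL := Δ.map (fun p => (p.1, Ty.bang p.2))

/-- Typing derivations for the rules of Table 1.  Contexts are treated as lists with
an explicit exchange rule `swap`.  The parameter `cty` assigns to each constant `c`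
the type `A_c` (the type assigned to `c` being `!A_c`). -/
inductive TypingD (cty : ℕ → Ty) : CtxL → Tm → Ty → Type where
  | swap {Γ₁ Γ₂ : CtxL} {p q : ℕ × Ty} {M : Tm} {A : Ty} :
      TypingD cty (Γ₁ ++ p :: q :: Γ₂) M A →
      TypingD cty (Γ₁ ++ q :: p :: Γ₂) M A
  | var {Δ : CtxL} {x : ℕ} {A B : Ty} :
      x ∉ names Δ → SubD A B →
      TypingD cty (bangify Δ ++ [(x, A)]) (.var x B) B
  | cst {Δ : CtxL} {c : ℕ} {B : Ty} :
      SubD (.bang (cty c)) B →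
      TypingD cty (bangify Δ) (.cst c B) B
  | star {Δ : CtxL} {n : ℕ} :
      TypingD cty (bangify Δ) (.star n) (bangN n .unit)
  | lam0 {Δ : CtxL} {x : ℕ} {A : Ty} {M : Tm} {B : Ty} :
      x ∉ names Δ → TypingD cty (Δ ++ [(x, A)]) M B →
      TypingD cty Δ (.lam 0 x A M) (.arrow A B)
  | lamS {Δ : CtxL} {n x : ℕ} {A : Ty} {M : Tm} {B : Ty} :
      x ∉ names Δ → TypingD cty (bangify Δ ++ [(x, A)]) M B →
      TypingD cty (bangify Δ) (.lam (n + 1) x A M) (bangN (n + 1) (.arrow A B))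
  | app {Δ Γ₁ Γ₂ : CtxL} {M N : Tm} {A B : Ty} :
      (names (bangify Δ ++ Γ₁ ++ Γ₂)).Nodup →
      TypingD cty (bangify Δ ++ Γ₁) M (.arrow A B) →
      TypingD cty (bangify Δ ++ Γ₂) N A →
      TypingD cty (bangify Δ ++ Γ₁ ++ Γ₂) (.app M N) B
  | pair {Δ Γ₁ Γ₂ : CtxL} {n : ℕ} {M₁ M₂ : Tm} {A₁ A₂ : Ty} :
      (names (bangify Δ ++ Γ₁ ++ Γ₂)).Nodup →
      TypingD cty (bangify Δ ++ Γ₁) M₁ (bangN n A₁) →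
      TypingD cty (bangify Δ ++ Γ₂) M₂ (bangN n A₂) →
      TypingD cty (bangify Δ ++ Γ₁ ++ Γ₂) (.pair n M₁ M₂) (bangN n (.tensor A₁ A₂))
  | letv {Δ Γ₁ Γ₂ : CtxL} {x : ℕ} {A : Ty} {M N : Tm} {B : Ty} :
      (names (bangify Δ ++ Γ₁ ++ Γ₂)).Nodup →
      x ∉ names (bangify Δ ++ Γ₁ ++ Γ₂) →
      TypingD cty (bangify Δ ++ Γ₁) M A →
      TypingD cty ((bangify Δ ++ Γ₂) ++ [(x, A)]) N B →
      TypingD cty (bangify Δ ++ Γ₁ ++ Γ₂) (.letv x A M N) B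
  | letUnit {Δ Γ₁ Γ₂ : CtxL} {M N : Tm} {A : Ty} :
      (names (bangify Δ ++ Γ₁ ++ Γ₂)).Nodup →
      TypingD cty (bangify Δ ++ Γ₁) M .unit →
      TypingD cty (bangify Δ ++ Γ₂) N A →
      TypingD cty (bangify Δ ++ Γ₁ ++ Γ₂) (.letUnit M N) A
  | letPair {Δ Γ₁ Γ₂ : CtxL} {n x₁ : ℕ} {A₁ : Ty} {x₂ : ℕ} {A₂ : Ty} {M N : Tm} {A : Ty} :
      (names (bangify Δ ++ Γ₁ ++ Γ₂)).Nodup →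
      x₁ ≠ x₂ →
      x₁ ∉ names (bangify Δ ++ Γ₁ ++ Γ₂) →
      x₂ ∉ names (bangify Δ ++ Γ₁ ++ Γ₂) →
      TypingD cty (bangify Δ ++ Γ₁) M (bangN n (.tensor A₁ A₂)) →
      TypingD cty ((bangify Δ ++ Γ₂) ++ [(x₁, bangN n A₁), (x₂, bangN n A₂)]) N A →
      TypingD cty (bangify Δ ++ Γ₁ ++ Γ₂) (.letPair n x₁ A₁ x₂ A₂ M N) A

/-- Validity of a typing judgment. -/
def Typ (cty : ℕ → Ty) (Γ : CtxL) (M : Tm) (A : Ty) : Prop :=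
  Nonempty (TypingD cty Γ M A)

end QLamSem

namespace QLamSem

/-- The data of a linear category for duplication: a symmetric monoidal category,
an idempotent strongly monoidal linear exponential comonad `(L,δ,ε,m₂,m₀,△,◇)`,
a strong monad `(T,η,μ,t)`, and Kleisli exponentials `⊸` with `Φ`. -/
structure LCDData : Type 1 where
  Obj : Type
  Hom : Obj → Obj → Type
  id : ∀ A, Hom A A
  comp : ∀ {A B C}, Hom A B → Hom B C → Hom A C
  tens : Obj → Obj → Obj
  unit : Obj
  tmap : ∀ {A B X Y}, Hom A B → Hom X Y → Hom (tens A X) (tens B Y)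
  assoc : ∀ A B X, Hom (tens (tens A B) X) (tens A (tens B X))
  assocInv : ∀ A B X, Hom (tens A (tens B X)) (tens (tens A B) X)
  lunit : ∀ A, Hom (tens unit A) A
  lunitInv : ∀ A, Hom A (tens unit A)
  runit : ∀ A, Hom (tens A unit) A
  runitInv : ∀ A, Hom A (tens A unit)
  symm : ∀ A B, Hom (tens A B) (tens B A)
  L : Obj → Obj
  Lmap : ∀ {A B}, Hom A B → Hom (L A) (L B)
  eps : ∀ A, Hom (L A) A
  delta : ∀ A, Hom (L A) (L (L A))
  deltaInv : ∀ A, Hom (L (L A)) (L A)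
  m2 : ∀ A B, Hom (tens (L A) (L B)) (L (tens A B))
  m2Inv : ∀ A B, Hom (L (tens A B)) (tens (L A) (L B))
  m0 : Hom unit (L unit)
  m0Inv : Hom (L unit) unit
  dup : ∀ A, Hom (L A) (tens (L A) (L A))
  disc : ∀ A, Hom (L A) unit
  T : Obj → Obj
  Tmap : ∀ {A B}, Hom A B → Hom (T A) (T B)
  eta : ∀ A, Hom A (T A)
  mu : ∀ A, Hom (T (T A)) (T A)
  str : ∀ A B, Hom (tens A (T B)) (T (tens A B))
  lolli : Obj → Obj → Obj
  lolliL : ∀ {A' A} (_ : Hom A' A) (B : Obj), Hom (lolli A B) (lolli A' B)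
  lolliR : ∀ (A : Obj) {B B'} (_ : Hom B B'), Hom (lolli A B) (lolli A B')
  Phi : ∀ {X A B}, Hom X (lolli A B) → Hom (tens X A) (T B)
  PhiInv : ∀ {X A B}, Hom (tens X A) (T B) → Hom X (lolli A B)

namespace LCDData

variable (D : LCDData)

/-- Kleisli lifting `f* = T f ; μ`. -/
def klift {A B : D.Obj} (f : D.Hom A (D.T B)) : D.Hom (D.T A) (D.T B) :=
  D.comp (D.Tmap f) (D.mu B)

/-- `Ψ₁ : TA ⊗ TB → T(A ⊗ B)` (first component first). -/
def Psi1 (A B : D.Obj) : D.Hom (D.tens (D.T A) (D.T B)) (D.T (D.tens A B)) :=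
  D.comp (D.symm (D.T A) (D.T B))
    (D.comp (D.str (D.T B) A)
      (D.klift (D.comp (D.symm (D.T B) A) (D.str A B))))

/-- The evaluation map `(A ⊸ B) ⊗ A → T B` induced by `Φ`. -/
def appnt (A B : D.Obj) : D.Hom (D.tens (D.lolli A B) A) (D.T B) :=
  D.Phi (D.id (D.lolli A B))

/-- Transport of homs along equalities of objects. -/
def castHom {A A' B B' : D.Obj} (h₁ : A = A') (h₂ : B = B') (f : D.Hom A B) :
    D.Hom A' B' := h₁ ▸ h₂ ▸ f

end LCDData

/-- The laws of a linear category for duplication (Definition of linear category for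
duplication: symmetric monoidal category, idempotent strongly monoidal linear
exponential comonad, strong monad, Kleisli exponentials). -/
structure LCDLaws (D : LCDData) : Prop where
  /- category -/
  id_comp : ∀ {A B} (f : D.Hom A B), D.comp (D.id A) f = f
  comp_id : ∀ {A B} (f : D.Hom A B), D.comp f (D.id B) = f
  comp_assoc : ∀ {A B C E} (f : D.Hom A B) (g : D.Hom B C) (h : D.Hom C E),
    D.comp (D.comp f g) h = D.comp f (D.comp g h)
  /- monoidal structure -/
  tmap_id : ∀ A B, D.tmap (D.id A) (D.id B) = D.id (D.tens A B)
  tmap_comp : ∀ {A B C X Y Z} (f : D.Hom A B) (g : D.Hom B C)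
    (h : D.Hom X Y) (k : D.Hom Y Z),
    D.tmap (D.comp f g) (D.comp h k) = D.comp (D.tmap f h) (D.tmap g k)
  assoc_iso₁ : ∀ A B X, D.comp (D.assoc A B X) (D.assocInv A B X) = D.id _
  assoc_iso₂ : ∀ A B X, D.comp (D.assocInv A B X) (D.assoc A B X) = D.id _
  assoc_natural : ∀ {A A' B B' X X'} (f : D.Hom A A') (g : D.Hom B B') (h : D.Hom X X'),
    D.comp (D.tmap (D.tmap f g) h) (D.assoc A' B' X')
      = D.comp (D.assoc A B X) (D.tmap f (D.tmap g h))
  lunit_iso₁ : ∀ A, D.comp (D.lunit A) (D.lunitInv A) = D.id _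
  lunit_iso₂ : ∀ A, D.comp (D.lunitInv A) (D.lunit A) = D.id _
  lunit_natural : ∀ {A A'} (f : D.Hom A A'),
    D.comp (D.tmap (D.id D.unit) f) (D.lunit A') = D.comp (D.lunit A) f
  runit_iso₁ : ∀ A, D.comp (D.runit A) (D.runitInv A) = D.id _
  runit_iso₂ : ∀ A, D.comp (D.runitInv A) (D.runit A) = D.id _
  runit_natural : ∀ {A A'} (f : D.Hom A A'),
    D.comp (D.tmap f (D.id D.unit)) (D.runit A') = D.comp (D.runit A) f
  pentagon : ∀ A B X Y,
    D.comp (D.assoc (D.tens A B) X Y) (D.assoc A B (D.tens X Y))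
      = D.comp (D.tmap (D.assoc A B X) (D.id Y))
          (D.comp (D.assoc A (D.tens B X) Y) (D.tmap (D.id A) (D.assoc B X Y)))
  triangle : ∀ A B,
    D.comp (D.assoc A D.unit B) (D.tmap (D.id A) (D.lunit B))
      = D.tmap (D.runit A) (D.id B)
  symm_natural : ∀ {A A' B B'} (f : D.Hom A A') (g : D.Hom B B'),
    D.comp (D.tmap f g) (D.symm A' B') = D.comp (D.symm A B) (D.tmap g f)
  symm_symm : ∀ A B, D.comp (D.symm A B) (D.symm B A) = D.id _
  hexagon : ∀ A B X,
    D.comp (D.assoc A B X) (D.comp (D.symm A (D.tens B X)) (D.assoc B X A))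
      = D.comp (D.tmap (D.symm A B) (D.id X))
          (D.comp (D.assoc B A X) (D.tmap (D.id B) (D.symm A X)))
  /- the comonad L -/
  Lmap_id : ∀ A, D.Lmap (D.id A) = D.id (D.L A)
  Lmap_comp : ∀ {A B C} (f : D.Hom A B) (g : D.Hom B C),
    D.Lmap (D.comp f g) = D.comp (D.Lmap f) (D.Lmap g)
  eps_natural : ∀ {A B} (f : D.Hom A B),
    D.comp (D.Lmap f) (D.eps B) = D.comp (D.eps A) f
  delta_natural : ∀ {A B} (f : D.Hom A B),
    D.comp (D.Lmap f) (D.delta B) = D.comp (D.delta A) (D.Lmap (D.Lmap f))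
  delta_assoc : ∀ A, D.comp (D.delta A) (D.delta (D.L A))
    = D.comp (D.delta A) (D.Lmap (D.delta A))
  delta_counit_left : ∀ A, D.comp (D.delta A) (D.eps (D.L A)) = D.id (D.L A)
  delta_counit_right : ∀ A, D.comp (D.delta A) (D.Lmap (D.eps A)) = D.id (D.L A)
  /- idempotency -/
  delta_iso₁ : ∀ A, D.comp (D.delta A) (D.deltaInv A) = D.id _
  delta_iso₂ : ∀ A, D.comp (D.deltaInv A) (D.delta A) = D.id _
  /- monoidality of L (strong monoidal comonad) -/
  m2_natural : ∀ {A A' B B'} (f : D.Hom A A') (g : D.Hom B B'),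
    D.comp (D.tmap (D.Lmap f) (D.Lmap g)) (D.m2 A' B')
      = D.comp (D.m2 A B) (D.Lmap (D.tmap f g))
  m2_iso₁ : ∀ A B, D.comp (D.m2 A B) (D.m2Inv A B) = D.id _
  m2_iso₂ : ∀ A B, D.comp (D.m2Inv A B) (D.m2 A B) = D.id _
  m0_iso₁ : D.comp D.m0 D.m0Inv = D.id _
  m0_iso₂ : D.comp D.m0Inv D.m0 = D.id _
  m2_assoc : ∀ A B X,
    D.comp (D.tmap (D.m2 A B) (D.id (D.L X)))
      (D.comp (D.m2 (D.tens A B) X) (D.Lmap (D.assoc A B X)))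
    = D.comp (D.assoc (D.L A) (D.L B) (D.L X))
        (D.comp (D.tmap (D.id (D.L A)) (D.m2 B X)) (D.m2 A (D.tens B X)))
  m2_left_unit : ∀ B,
    D.comp (D.tmap D.m0 (D.id (D.L B))) (D.comp (D.m2 D.unit B) (D.Lmap (D.lunit B)))
      = D.lunit (D.L B)
  m2_right_unit : ∀ A,
    D.comp (D.tmap (D.id (D.L A)) D.m0) (D.comp (D.m2 A D.unit) (D.Lmap (D.runit A)))
      = D.runit (D.L A)
  eps_monoidal : ∀ A B,
    D.comp (D.m2 A B) (D.eps (D.tens A B)) = D.tmap (D.eps A) (D.eps B)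
  eps_monoidal_unit : D.comp D.m0 (D.eps D.unit) = D.id D.unit
  delta_monoidal : ∀ A B,
    D.comp (D.m2 A B) (D.delta (D.tens A B))
      = D.comp (D.tmap (D.delta A) (D.delta B))
          (D.comp (D.m2 (D.L A) (D.L B)) (D.Lmap (D.m2 A B)))
  delta_monoidal_unit : D.comp D.m0 (D.delta D.unit) = D.comp D.m0 (D.Lmap D.m0)
  /- each LA is a commutative comonoid (LA, △, ◇) -/
  dup_natural : ∀ {A B} (f : D.Hom A B),
    D.comp (D.Lmap f) (D.dup B) = D.comp (D.dup A) (D.tmap (D.Lmap f) (D.Lmap f))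
  disc_natural : ∀ {A B} (f : D.Hom A B),
    D.comp (D.Lmap f) (D.disc B) = D.disc A
  dup_comm : ∀ A, D.comp (D.dup A) (D.symm (D.L A) (D.L A)) = D.dup A
  dup_assoc : ∀ A,
    D.comp (D.dup A) (D.comp (D.tmap (D.dup A) (D.id (D.L A)))
      (D.assoc (D.L A) (D.L A) (D.L A)))
    = D.comp (D.dup A) (D.tmap (D.id (D.L A)) (D.dup A))
  dup_counit_left : ∀ A,
    D.comp (D.dup A) (D.comp (D.tmap (D.disc A) (D.id (D.L A))) (D.lunit (D.L A)))
      = D.id (D.L A)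
  dup_counit_right : ∀ A,
    D.comp (D.dup A) (D.comp (D.tmap (D.id (D.L A)) (D.disc A)) (D.runit (D.L A)))
      = D.id (D.L A)
  /- △ and ◇ are monoidal natural transformations (Table 3, first group) -/
  dup_monoidal : ∀ A B,
    D.comp (D.m2 A B) (D.dup (D.tens A B))
      = D.comp (D.tmap (D.dup A) (D.dup B))
          (D.comp (D.comp (D.assoc (D.L A) (D.L A) (D.tens (D.L B) (D.L B)))
              (D.comp (D.tmap (D.id (D.L A)) (D.comp
                  (D.assocInv (D.L A) (D.L B) (D.L B))
                  (D.comp (D.tmap (D.symm (D.L A) (D.L B)) (D.id (D.L B)))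
                    (D.assoc (D.L B) (D.L A) (D.L B)))))
                (D.assocInv (D.L A) (D.L B) (D.tens (D.L A) (D.L B)))))
            (D.tmap (D.m2 A B) (D.m2 A B)))
  dup_monoidal_unit :
    D.comp D.m0 (D.dup D.unit) = D.comp (D.lunitInv D.unit) (D.tmap D.m0 D.m0)
  disc_monoidal : ∀ A B,
    D.comp (D.m2 A B) (D.disc (D.tens A B))
      = D.comp (D.tmap (D.disc A) (D.disc B)) (D.lunit D.unit)
  disc_monoidal_unit : D.comp D.m0 (D.disc D.unit) = D.id D.unit
  /- △ and ◇ are L-coalgebra morphisms (Table 3, second group) -/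
  dup_coalgebra : ∀ A,
    D.comp (D.delta A) (D.Lmap (D.dup A))
      = D.comp (D.dup A) (D.comp (D.tmap (D.delta A) (D.delta A)) (D.m2 (D.L A) (D.L A)))
  disc_coalgebra : ∀ A,
    D.comp (D.delta A) (D.Lmap (D.disc A)) = D.comp (D.disc A) D.m0
  /- δ is a comonoid morphism (Table 3, third group) -/
  delta_comonoid_dup : ∀ A,
    D.comp (D.delta A) (D.dup (D.L A)) = D.comp (D.dup A) (D.tmap (D.delta A) (D.delta A))
  delta_comonoid_disc : ∀ A,
    D.comp (D.delta A) (D.disc (D.L A)) = D.disc A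
  /- the monad T -/
  Tmap_id : ∀ A, D.Tmap (D.id A) = D.id (D.T A)
  Tmap_comp : ∀ {A B C} (f : D.Hom A B) (g : D.Hom B C),
    D.Tmap (D.comp f g) = D.comp (D.Tmap f) (D.Tmap g)
  eta_natural : ∀ {A B} (f : D.Hom A B),
    D.comp f (D.eta B) = D.comp (D.eta A) (D.Tmap f)
  mu_natural : ∀ {A B} (f : D.Hom A B),
    D.comp (D.Tmap (D.Tmap f)) (D.mu B) = D.comp (D.mu A) (D.Tmap f)
  mu_assoc : ∀ A, D.comp (D.Tmap (D.mu A)) (D.mu A) = D.comp (D.mu (D.T A)) (D.mu A)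
  mu_unit_left : ∀ A, D.comp (D.eta (D.T A)) (D.mu A) = D.id (D.T A)
  mu_unit_right : ∀ A, D.comp (D.Tmap (D.eta A)) (D.mu A) = D.id (D.T A)
  /- tensorial strength -/
  str_natural : ∀ {A A' B B'} (f : D.Hom A A') (g : D.Hom B B'),
    D.comp (D.tmap f (D.Tmap g)) (D.str A' B') = D.comp (D.str A B) (D.Tmap (D.tmap f g))
  str_lunit : ∀ B,
    D.comp (D.str D.unit B) (D.Tmap (D.lunit B)) = D.lunit (D.T B)
  str_assoc : ∀ A B X,
    D.comp (D.assoc A B (D.T X)) (D.comp (D.tmap (D.id A) (D.str B X)) (D.str A (D.tens B X)))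
      = D.comp (D.str (D.tens A B) X) (D.Tmap (D.assoc A B X))
  str_eta : ∀ A B, D.comp (D.tmap (D.id A) (D.eta B)) (D.str A B) = D.eta (D.tens A B)
  str_mu : ∀ A B,
    D.comp (D.tmap (D.id A) (D.mu B)) (D.str A B)
      = D.comp (D.str A (D.T B)) (D.comp (D.Tmap (D.str A B)) (D.mu (D.tens A B)))
  /- Kleisli exponentials -/
  lolliL_id : ∀ A B, D.lolliL (D.id A) B = D.id (D.lolli A B)
  lolliR_id : ∀ A B, D.lolliR A (D.id B) = D.id (D.lolli A B)
  lolliL_comp : ∀ {A'' A' A} (f : D.Hom A'' A') (g : D.Hom A' A) (B : D.Obj),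
    D.lolliL (D.comp f g) B = D.comp (D.lolliL g B) (D.lolliL f B)
  lolliR_comp : ∀ (A : D.Obj) {B B' B''} (f : D.Hom B B') (g : D.Hom B' B''),
    D.lolliR A (D.comp f g) = D.comp (D.lolliR A f) (D.lolliR A g)
  Phi_iso₁ : ∀ {X A B} (f : D.Hom X (D.lolli A B)), D.PhiInv (D.Phi f) = f
  Phi_iso₂ : ∀ {X A B} (g : D.Hom (D.tens X A) (D.T B)), D.Phi (D.PhiInv g) = g
  Phi_natural_left : ∀ {X' X A B} (f : D.Hom X' X) (g : D.Hom X (D.lolli A B)),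
    D.Phi (D.comp f g) = D.comp (D.tmap f (D.id A)) (D.Phi g)
  Phi_natural_right : ∀ {X A B B'} (g : D.Hom X (D.lolli A B)) (h : D.Hom B B'),
    D.Phi (D.comp g (D.lolliR A h)) = D.comp (D.Phi g) (D.Tmap h)
  Phi_natural_arg : ∀ {X A' A B} (f : D.Hom A' A) (g : D.Hom X (D.lolli A B)),
    D.Phi (D.comp g (D.lolliL f B)) = D.comp (D.tmap (D.id X) f) (D.Phi g)

end QLamSem

namespace QLamSem

variable (D : LCDData)

/-- `Ln n X = Lⁿ X`. -/
def Ln : ℕ → D.Obj → D.Obj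
  | 0, X => X
  | n + 1, X => D.L (Ln n X)

/-- `Lⁿ` on morphisms. -/
def LnMap : ∀ (n : ℕ) {X Y : D.Obj}, D.Hom X Y → D.Hom (Ln D n X) (Ln D n Y)
  | 0, _, _, f => f
  | n + 1, _, _, f => D.Lmap (LnMap n f)

/-- Iterated counit `Lⁿ X → X`. -/
def collapseL : ∀ (n : ℕ) (X : D.Obj), D.Hom (Ln D n X) X
  | 0, X => D.id X
  | n + 1, X => D.comp (D.eps (Ln D n X)) (collapseL n X)

/-- Iterated comultiplication `L X → Lᵐ⁺¹ X`. -/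
def padL : ∀ (m : ℕ) (X : D.Obj), D.Hom (D.L X) (Ln D (m + 1) X)
  | 0, X => D.id (D.L X)
  | m + 1, X => D.comp (padL m X) (D.delta (Ln D m X))

/-- The canonical morphism `Lⁿ X → Lᵐ X` for `m = 0 ∨ 1 ≤ n`. -/
def bangAdj : ∀ (n m : ℕ) (X : D.Obj), (m = 0 ∨ 1 ≤ n) → D.Hom (Ln D n X) (Ln D m X)
  | n, 0, X, _ => collapseL D n X
  | 0, m + 1, _, h => False.elim (by omega)
  | n + 1, m + 1, X, _ =>
      D.comp (D.Lmap (collapseL D n X)) (padL D m X)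

/-- Iterated monoidality map `Lⁿ a ⊗ Lⁿ b → Lⁿ (a ⊗ b)`. -/
def m2n : ∀ (n : ℕ) (a b : D.Obj), D.Hom (D.tens (Ln D n a) (Ln D n b)) (Ln D n (D.tens a b))
  | 0, a, b => D.id (D.tens a b)
  | n + 1, a, b => D.comp (D.m2 (Ln D n a) (Ln D n b)) (D.Lmap (m2n n a b))

/-- Inverse of `m2n`. -/
def m2nInv : ∀ (n : ℕ) (a b : D.Obj), D.Hom (Ln D n (D.tens a b)) (D.tens (Ln D n a) (Ln D n b))
  | 0, a, b => D.id (D.tens a b)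
  | n + 1, a, b => D.comp (D.Lmap (m2nInv n a b)) (D.m2Inv (Ln D n a) (Ln D n b))

variable (Θ : ℕ → D.Obj)

/-- Interpretation of types. -/
def denTy : Ty → D.Obj
  | .tconst a => Θ a
  | .arrow A B => D.lolli (denTy A) (denTy B)
  | .tensor A B => D.tens (denTy A) (denTy B)
  | .unit => D.unit
  | .bang A => D.L (denTy A)

theorem denTy_bangN (n : ℕ) (A : Ty) : denTy D Θ (bangN n A) = Ln D n (denTy D Θ A) := by
  induction n with
  | zero => rfl
  | succ n ih => simp [bangN, denTy, Ln, ih]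


/-- The identity viewed along an equality of objects. -/
def eqHom {A B : D.Obj} (h : A = B) : D.Hom A B := h ▸ D.id A

/-- Interpretation of contexts: `⟦x₁:A₁,…,xₙ:Aₙ⟧ = ⟦A₁⟧ ⊗ (… ⊗ (⟦Aₙ⟧ ⊗ ⊤))`. -/
def denCtx : CtxL → D.Obj
  | [] => D.unit
  | p :: Γ => D.tens (denTy D Θ p.2) (denCtx Γ)

/-- Splitting `⟦Γ₁ ++ Γ₂⟧ → ⟦Γ₁⟧ ⊗ ⟦Γ₂⟧`. -/
def splitCtx : ∀ (Γ₁ Γ₂ : CtxL), D.Hom (denCtx D Θ (Γ₁ ++ Γ₂)) (D.tens (denCtx D Θ Γ₁) (denCtx D Θ Γ₂))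
  | [], Γ₂ => D.lunitInv (denCtx D Θ Γ₂)
  | p :: Γ₁, Γ₂ =>
      D.comp (D.tmap (D.id (denTy D Θ p.2)) (splitCtx Γ₁ Γ₂))
        (D.assocInv (denTy D Θ p.2) (denCtx D Θ Γ₁) (denCtx D Θ Γ₂))

/-- Joining `⟦Γ₁⟧ ⊗ ⟦Γ₂⟧ → ⟦Γ₁ ++ Γ₂⟧`. -/
def joinCtx : ∀ (Γ₁ Γ₂ : CtxL), D.Hom (D.tens (denCtx D Θ Γ₁) (denCtx D Θ Γ₂)) (denCtx D Θ (Γ₁ ++ Γ₂))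
  | [], Γ₂ => D.lunit (denCtx D Θ Γ₂)
  | p :: Γ₁, Γ₂ =>
      D.comp (D.assoc (denTy D Θ p.2) (denCtx D Θ Γ₁) (denCtx D Θ Γ₂))
        (D.tmap (D.id (denTy D Θ p.2)) (joinCtx Γ₁ Γ₂))

/-- The middle-four interchange `(a⊗b)⊗(c⊗d) → (a⊗c)⊗(b⊗d)`. -/
def mid4 (a b c d : D.Obj) :
    D.Hom (D.tens (D.tens a b) (D.tens c d)) (D.tens (D.tens a c) (D.tens b d)) :=
  D.comp (D.assoc a b (D.tens c d))
    (D.comp (D.tmap (D.id a)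
        (D.comp (D.assocInv b c d)
          (D.comp (D.tmap (D.symm b c) (D.id d)) (D.assoc c b d))))
      (D.assocInv a c (D.tens b d)))

/-- Duplication of a `!`-context, built from the comonoid comultiplications `△`. -/
def dupCtx : ∀ (Δ : CtxL), D.Hom (denCtx D Θ (bangify Δ)) (D.tens (denCtx D Θ (bangify Δ)) (denCtx D Θ (bangify Δ)))
  | [] => D.lunitInv D.unit
  | p :: Δ =>
      D.comp (D.tmap (D.dup (denTy D Θ p.2)) (dupCtx Δ))
        (mid4 D (D.L (denTy D Θ p.2)) (D.L (denTy D Θ p.2))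
          (denCtx D Θ (bangify Δ)) (denCtx D Θ (bangify Δ)))

/-- Discarding of a `!`-context, built from the comonoid counits `◇`. -/
def discCtx : ∀ (Δ : CtxL), D.Hom (denCtx D Θ (bangify Δ)) D.unit
  | [] => D.id D.unit
  | p :: Δ => D.comp (D.tmap (D.disc (denTy D Θ p.2)) (discCtx Δ)) (D.lunit D.unit)

/-- Promotion of a `!`-context: `⟦!Δ⟧ → L ⟦!Δ⟧`, built from `δ` and `m₂`. -/
def promCtx : ∀ (Δ : CtxL), D.Hom (denCtx D Θ (bangify Δ)) (D.L (denCtx D Θ (bangify Δ)))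
  | [] => D.m0
  | p :: Δ =>
      D.comp (D.tmap (D.delta (denTy D Θ p.2)) (promCtx Δ))
        (D.m2 (D.L (denTy D Θ p.2)) (denCtx D Θ (bangify Δ)))

/-- `Split_{!Δ,Γ₁,Γ₂} : ⟦!Δ,Γ₁,Γ₂⟧ → ⟦!Δ,Γ₁⟧ ⊗ ⟦!Δ,Γ₂⟧`, duplicating the `!Δ` part. -/
def splitDup (Δ Γ₁ Γ₂ : CtxL) :
    D.Hom (denCtx D Θ (bangify Δ ++ Γ₁ ++ Γ₂))
      (D.tens (denCtx D Θ (bangify Δ ++ Γ₁)) (denCtx D Θ (bangify Δ ++ Γ₂))) :=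
  D.comp (eqHom D (congrArg (denCtx D Θ) (List.append_assoc (bangify Δ) Γ₁ Γ₂)))
  <| D.comp (splitCtx D Θ (bangify Δ) (Γ₁ ++ Γ₂))
    (D.comp (D.tmap (dupCtx D Θ Δ) (splitCtx D Θ Γ₁ Γ₂))
      (D.comp (mid4 D (denCtx D Θ (bangify Δ)) (denCtx D Θ (bangify Δ))
          (denCtx D Θ Γ₁) (denCtx D Θ Γ₂))
        (D.tmap (joinCtx D Θ (bangify Δ) Γ₁) (joinCtx D Θ (bangify Δ) Γ₂))))

/-- `⟦Γ⟧ ⊗ ⟦A⟧ → ⟦Γ, x:A⟧`. -/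
def extHom (Γ : CtxL) (x : ℕ) (A : Ty) :
    D.Hom (D.tens (denCtx D Θ Γ) (denTy D Θ A)) (denCtx D Θ (Γ ++ [(x, A)])) :=
  D.comp (D.tmap (D.id (denCtx D Θ Γ)) (D.runitInv (denTy D Θ A)))
    (joinCtx D Θ Γ [(x, A)])

/-- `⟦Γ⟧ ⊗ (⟦A₁⟧ ⊗ ⟦A₂⟧) → ⟦Γ, x₁:A₁, x₂:A₂⟧`. -/
def ext2Hom (Γ : CtxL) (x₁ : ℕ) (A₁ : Ty) (x₂ : ℕ) (A₂ : Ty) :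
    D.Hom (D.tens (denCtx D Θ Γ) (D.tens (denTy D Θ A₁) (denTy D Θ A₂)))
      (denCtx D Θ (Γ ++ [(x₁, A₁), (x₂, A₂)])) :=
  D.comp (D.tmap (D.id (denCtx D Θ Γ))
      (D.tmap (D.id (denTy D Θ A₁)) (D.runitInv (denTy D Θ A₂))))
    (joinCtx D Θ Γ [(x₁, A₁), (x₂, A₂)])

/-- The exchange morphism interpreting the `swap` rule. -/
def swapMor (Γ₁ : CtxL) (p q : ℕ × Ty) (Γ₂ : CtxL) :
    D.Hom (denCtx D Θ (Γ₁ ++ q :: p :: Γ₂)) (denCtx D Θ (Γ₁ ++ p :: q :: Γ₂)) :=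
  D.comp (splitCtx D Θ Γ₁ (q :: p :: Γ₂))
    (D.comp (D.tmap (D.id (denCtx D Θ Γ₁))
        (D.comp (D.assocInv (denTy D Θ q.2) (denTy D Θ p.2) (denCtx D Θ Γ₂))
          (D.comp (D.tmap (D.symm (denTy D Θ q.2) (denTy D Θ p.2)) (D.id (denCtx D Θ Γ₂)))
            (D.assoc (denTy D Θ p.2) (denTy D Θ q.2) (denCtx D Θ Γ₂)))))
      (joinCtx D Θ Γ₁ (p :: q :: Γ₂)))

/-- The canonical arrow `I_{A,B} : ⟦A⟧ → ⟦B⟧` interpreting a subtyping `A <: B`. -/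
def Isub : ∀ {A B : Ty}, SubD A B → D.Hom (denTy D Θ A) (denTy D Θ B)
  | _, _, .tconst n m a h =>
      D.castHom (denTy_bangN D Θ n (Ty.tconst a)).symm (denTy_bangN D Θ m (Ty.tconst a)).symm
        (bangAdj D n m (denTy D Θ (Ty.tconst a)) h)
  | _, _, .unit n m h =>
      D.castHom (denTy_bangN D Θ n Ty.unit).symm (denTy_bangN D Θ m Ty.unit).symm
        (bangAdj D n m (denTy D Θ Ty.unit) h)
  | _, _, .arrow n m A A' B B' h sA sB =>
      D.castHom (denTy_bangN D Θ n (Ty.arrow A' B)).symm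
        (denTy_bangN D Θ m (Ty.arrow A B')).symm
        (D.comp (bangAdj D n m (denTy D Θ (Ty.arrow A' B)) h)
          (LnMap D m (D.comp (D.lolliL (Isub sA) (denTy D Θ B)) (D.lolliR (denTy D Θ A) (Isub sB)))))
  | _, _, .tensor n m A A' B B' h sA sB =>
      D.castHom (denTy_bangN D Θ n (Ty.tensor A B)).symm
        (denTy_bangN D Θ m (Ty.tensor A' B')).symm
        (D.comp (bangAdj D n m (denTy D Θ (Ty.tensor A B)) h)
          (LnMap D m (D.tmap (Isub sA) (Isub sB))))

/-- `m2n` expressed on interpretations of types. -/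
def m2nD (n : ℕ) (A B : Ty) :
    D.Hom (D.tens (denTy D Θ (bangN n A)) (denTy D Θ (bangN n B)))
      (denTy D Θ (bangN n (Ty.tensor A B))) :=
  D.castHom
    (show D.tens (Ln D n (denTy D Θ A)) (Ln D n (denTy D Θ B))
        = D.tens (denTy D Θ (bangN n A)) (denTy D Θ (bangN n B)) by
      rw [denTy_bangN, denTy_bangN])
    (denTy_bangN D Θ n (Ty.tensor A B)).symm
    (m2n D n (denTy D Θ A) (denTy D Θ B))

/-- Inverse of `m2nD`. -/
def m2nDInv (n : ℕ) (A B : Ty) :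
    D.Hom (denTy D Θ (bangN n (Ty.tensor A B)))
      (D.tens (denTy D Θ (bangN n A)) (denTy D Θ (bangN n B))) :=
  D.castHom (denTy_bangN D Θ n (Ty.tensor A B)).symm
    (show D.tens (Ln D n (denTy D Θ A)) (Ln D n (denTy D Θ B))
        = D.tens (denTy D Θ (bangN n A)) (denTy D Θ (bangN n B)) by
      rw [denTy_bangN, denTy_bangN])
    (m2nInv D n (denTy D Θ A) (denTy D Θ B))

/-- `⊤ → ⟦!ⁿ⊤⟧`. -/
def starMap : ∀ n : ℕ, D.Hom D.unit (denTy D Θ (bangN n Ty.unit))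
  | 0 => D.id D.unit
  | n + 1 =>
      D.comp D.m0 (D.castHom rfl (denTy_bangN D Θ (n + 1) Ty.unit).symm (padL D n D.unit))

/-- An interpretation `Θ` of the language: an object for each type constant and an
arrow `⊤ → ⟦!A_c⟧` for each constant `c` (whose assigned type is `!A_c`). -/
structure Interp (cty : ℕ → Ty) : Type where
  obj : ℕ → D.Obj
  cst : ∀ c : ℕ, D.Hom D.unit (denTy D obj (Ty.bang (cty c)))

variable {D}
variable {cty : ℕ → Ty} (I : Interp D cty)

/-- The computational interpretation `⟦π⟧^c : ⟦Γ⟧ → T ⟦A⟧` of a typing derivation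
`π` of `Γ ⊢ M : A` (Table 5). -/
def denC : ∀ {Γ : CtxL} {M : Tm} {A : Ty}, TypingD cty Γ M A →
    D.Hom (denCtx D I.obj Γ) (D.T (denTy D I.obj A))
  | _, _, _, .swap (Γ₁ := Γ₁) (Γ₂ := Γ₂) (p := p) (q := q) d =>
      D.comp (swapMor D I.obj Γ₁ p q Γ₂) (denC d)
  | _, _, _, .var (Δ := Δ) (x := x) (A := A) _ s =>
      D.comp (splitCtx D I.obj (bangify Δ) [(x, A)])
        (D.comp (D.tmap (discCtx D I.obj Δ) (D.runit (denTy D I.obj A)))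
          (D.comp (D.lunit (denTy D I.obj A))
            (D.comp (Isub D I.obj s) (D.eta _))))
  | _, _, _, .cst (Δ := Δ) (c := c) s =>
      D.comp (discCtx D I.obj Δ)
        (D.comp (I.cst c) (D.comp (Isub D I.obj s) (D.eta _)))
  | _, _, _, .star (Δ := Δ) (n := n) =>
      D.comp (discCtx D I.obj Δ) (D.comp (starMap D I.obj n) (D.eta _))
  | _, _, _, .lam0 (Δ := Δ) (x := x) (A := A) _ d =>
      D.comp (D.PhiInv (D.comp (extHom D I.obj Δ x A) (denC d))) (D.eta _)
  | _, _, _, .lamS (Δ := Δ) (n := n) (x := x) (A := A) (B := B) _ d =>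
      D.comp (promCtx D I.obj Δ)
        (D.comp (D.Lmap (D.PhiInv (D.comp (extHom D I.obj (bangify Δ) x A) (denC d))))
          (D.comp (D.castHom rfl (denTy_bangN D I.obj (n + 1) (Ty.arrow A B)).symm
              (padL D n (denTy D I.obj (Ty.arrow A B))))
            (D.eta _)))
  | _, _, _, .app (Δ := Δ) (Γ₁ := Γ₁) (Γ₂ := Γ₂) (A := A) (B := B) _ d₁ d₂ =>
      D.comp (splitDup D I.obj Δ Γ₁ Γ₂)
        (D.comp (D.tmap (denC d₁) (denC d₂))
          (D.comp (D.Psi1 (denTy D I.obj (Ty.arrow A B)) (denTy D I.obj A))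
            (D.klift (D.appnt (denTy D I.obj A) (denTy D I.obj B)))))
  | _, _, _, .pair (Δ := Δ) (Γ₁ := Γ₁) (Γ₂ := Γ₂) (n := n) (A₁ := A₁) (A₂ := A₂) _ d₁ d₂ =>
      D.comp (splitDup D I.obj Δ Γ₁ Γ₂)
        (D.comp (D.tmap (denC d₁) (denC d₂))
          (D.comp (D.Psi1 (denTy D I.obj (bangN n A₁)) (denTy D I.obj (bangN n A₂)))
            (D.Tmap (m2nD D I.obj n A₁ A₂))))
  | _, _, _, .letv (Δ := Δ) (Γ₁ := Γ₁) (Γ₂ := Γ₂) (x := x) (A := A) _ _ d₁ d₂ =>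
      D.comp (splitDup D I.obj Δ Γ₁ Γ₂)
        (D.comp (D.tmap (denC d₁) (D.id _))
          (D.comp (D.symm _ _)
            (D.comp (D.str (denCtx D I.obj (bangify Δ ++ Γ₂)) (denTy D I.obj A))
              (D.comp (D.Tmap (extHom D I.obj (bangify Δ ++ Γ₂) x A))
                (D.klift (denC d₂))))))
  | _, _, _, .letUnit (Δ := Δ) (Γ₁ := Γ₁) (Γ₂ := Γ₂) _ d₁ d₂ =>
      D.comp (splitDup D I.obj Δ Γ₁ Γ₂)
        (D.comp (D.tmap (denC d₁) (D.id _))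
          (D.comp (D.symm _ _)
            (D.comp (D.str (denCtx D I.obj (bangify Δ ++ Γ₂)) D.unit)
              (D.comp (D.Tmap (D.runit _)) (D.klift (denC d₂))))))
  | _, _, _, .letPair (Δ := Δ) (Γ₁ := Γ₁) (Γ₂ := Γ₂) (n := n) (x₁ := x₁) (A₁ := A₁)
      (x₂ := x₂) (A₂ := A₂) _ _ _ _ d₁ d₂ =>
      D.comp (splitDup D I.obj Δ Γ₁ Γ₂)
        (D.comp (D.tmap (denC d₁) (D.id _))
          (D.comp (D.symm _ _)
            (D.comp (D.str (denCtx D I.obj (bangify Δ ++ Γ₂))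
                (denTy D I.obj (bangN n (Ty.tensor A₁ A₂))))
              (D.comp (D.Tmap (D.comp (D.tmap (D.id _) (m2nDInv D I.obj n A₁ A₂))
                  (ext2Hom D I.obj (bangify Δ ++ Γ₂) x₁ (bangN n A₁) x₂ (bangN n A₂))))
                (D.klift (denC d₂))))))

/-- The value interpretation `⟦π⟧^v : ⟦Γ⟧ → ⟦A⟧` of a typing derivation `π` of
`Γ ⊢ V : A` with `V` a value (Table 5). -/
def denV : ∀ {Γ : CtxL} {M : Tm} {A : Ty}, TypingD cty Γ M A → isValue M = true →
    D.Hom (denCtx D I.obj Γ) (denTy D I.obj A)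
  | _, _, _, .swap (Γ₁ := Γ₁) (Γ₂ := Γ₂) (p := p) (q := q) d, h =>
      D.comp (swapMor D I.obj Γ₁ p q Γ₂) (denV d h)
  | _, _, _, .var (Δ := Δ) (x := x) (A := A) _ s, _ =>
      D.comp (splitCtx D I.obj (bangify Δ) [(x, A)])
        (D.comp (D.tmap (discCtx D I.obj Δ) (D.runit (denTy D I.obj A)))
          (D.comp (D.lunit (denTy D I.obj A)) (Isub D I.obj s)))
  | _, _, _, .cst (Δ := Δ) (c := c) s, _ =>
      D.comp (discCtx D I.obj Δ) (D.comp (I.cst c) (Isub D I.obj s))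
  | _, _, _, .star (Δ := Δ) (n := n), _ =>
      D.comp (discCtx D I.obj Δ) (starMap D I.obj n)
  | _, _, _, .lam0 (Δ := Δ) (x := x) (A := A) _ d, _ =>
      D.PhiInv (D.comp (extHom D I.obj Δ x A) (denC I d))
  | _, _, _, .lamS (Δ := Δ) (n := n) (x := x) (A := A) (B := B) _ d, _ =>
      D.comp (promCtx D I.obj Δ)
        (D.comp (D.Lmap (D.PhiInv (D.comp (extHom D I.obj (bangify Δ) x A) (denC I d))))
          (D.castHom rfl (denTy_bangN D I.obj (n + 1) (Ty.arrow A B)).symm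
            (padL D n (denTy D I.obj (Ty.arrow A B)))))
  | _, _, _, .app _ _ _, h => nomatch h
  | _, _, _, .pair (Δ := Δ) (Γ₁ := Γ₁) (Γ₂ := Γ₂) (n := n) (A₁ := A₁) (A₂ := A₂) _ d₁ d₂, h =>
      D.comp (splitDup D I.obj Δ Γ₁ Γ₂)
        (D.comp (D.tmap (denV d₁ (by simp [isValue] at h; exact h.1))
            (denV d₂ (by simp [isValue] at h; exact h.2)))
          (m2nD D I.obj n A₁ A₂))
  | _, _, _, .letv (Δ := Δ) (Γ₁ := Γ₁) (Γ₂ := Γ₂) (x := x) (A := A) _ _ d₁ d₂, h =>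
      D.comp (splitDup D I.obj Δ Γ₁ Γ₂)
        (D.comp (D.tmap (denV d₁ (by simp [isValue] at h; exact h.1)) (D.id _))
          (D.comp (D.symm _ _)
            (D.comp (extHom D I.obj (bangify Δ ++ Γ₂) x A)
              (denV d₂ (by simp [isValue] at h; exact h.2)))))
  | _, _, _, .letUnit (Δ := Δ) (Γ₁ := Γ₁) (Γ₂ := Γ₂) _ d₁ d₂, h =>
      D.comp (splitDup D I.obj Δ Γ₁ Γ₂)
        (D.comp (D.tmap (denV d₁ (by simp [isValue] at h; exact h.1)) (D.id _))
          (D.comp (D.symm _ _)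
            (D.comp (D.runit _) (denV d₂ (by simp [isValue] at h; exact h.2)))))
  | _, _, _, .letPair (Δ := Δ) (Γ₁ := Γ₁) (Γ₂ := Γ₂) (n := n) (x₁ := x₁) (A₁ := A₁)
      (x₂ := x₂) (A₂ := A₂) _ _ _ _ d₁ d₂, h =>
      D.comp (splitDup D I.obj Δ Γ₁ Γ₂)
        (D.comp (D.tmap (denV d₁ (by simp [isValue] at h; exact h.1)) (D.id _))
          (D.comp (D.symm _ _)
            (D.comp (D.tmap (D.id _) (m2nDInv D I.obj n A₁ A₂))
              (D.comp (ext2Hom D I.obj (bangify Δ ++ Γ₂) x₁ (bangN n A₁) x₂ (bangN n A₂))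
                (denV d₂ (by simp [isValue] at h; exact h.2))))))

end QLamSem

namespace QLamSem

open CategoryTheory MonoidalCategory

section Monoidal

variable {C : Type*} [Category C] [MonoidalCategory C]

/-- Application of a comultiplication to the first factor. -/
def dupHead {a : C} (d : a ⟶ a ⊗ a) (w : C) : a ⊗ w ⟶ a ⊗ (a ⊗ w) :=
  d ▷ w ≫ (α_ a a w).hom

/-- Application of a counit to the first factor. -/
def discHead {a : C} (e : a ⟶ 𝟙_ C) (w : C) : a ⊗ w ⟶ w :=
  e ▷ w ≫ (λ_ w).hom

theorem dupHead_natural {a : C} (d : a ⟶ a ⊗ a) {w w' : C} (h : w ⟶ w') :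
    a ◁ h ≫ dupHead d w' = dupHead d w ≫ a ◁ a ◁ h := by
  simp only [dupHead, Category.assoc]
  rw [whisker_exchange_assoc, tensor_whiskerLeft]
  simp

theorem discHead_natural {a : C} (e : a ⟶ 𝟙_ C) {w w' : C} (h : w ⟶ w') :
    a ◁ h ≫ discHead e w' = discHead e w ≫ h := by
  simp only [discHead, Category.assoc]
  rw [whisker_exchange_assoc, leftUnitor_naturality]

theorem dupHead_coassoc {a : C} (d : a ⟶ a ⊗ a)
    (hd : d ≫ d ▷ a ≫ (α_ a a a).hom = d ≫ a ◁ d) (w : C) :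
    dupHead d w ≫ dupHead d (a ⊗ w) = dupHead d w ≫ a ◁ dupHead d w := by
  have h := congrArg (fun t => t ▷ w ≫ (α_ a (a ⊗ a) w).hom ≫ a ◁ (α_ a a w).hom) hd
  simp only [comp_whiskerRight, Category.assoc] at h
  simp only [dupHead, Category.assoc, whiskerLeft_comp]
  rw [← associator_naturality_middle_assoc, ← h]
  monoidal

theorem dupHead_discHead {a : C} (d : a ⟶ a ⊗ a) (e : a ⟶ 𝟙_ C)
    (hd : d ≫ e ▷ a ≫ (λ_ a).hom = 𝟙 a) (w : C) :
    dupHead d w ≫ discHead e (a ⊗ w) = 𝟙 _ := by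
  have h := congrArg (fun t => t ▷ w) hd
  simp only [comp_whiskerRight, id_whiskerRight] at h
  rw [← h]
  simp [dupHead, discHead]

end Monoidal

section SymmetricMonoidal

variable {C : Type*} [Category C] [MonoidalCategory C] [SymmetricCategory C]

/-- Exchange of the first two factors: `a ⊗ (b ⊗ w) ⟶ b ⊗ (a ⊗ w)`. -/
def leftComm (a b w : C) : a ⊗ (b ⊗ w) ⟶ b ⊗ (a ⊗ w) :=
  (α_ a b w).inv ≫ (β_ a b).hom ▷ w ≫ (α_ b a w).hom

theorem leftComm_natural (a b : C) {w w' : C} (h : w ⟶ w') :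
    a ◁ b ◁ h ≫ leftComm a b w' = leftComm a b w ≫ b ◁ a ◁ h := by
  simp only [leftComm, Category.assoc]
  rw [← associator_naturality_right, associator_inv_naturality_right_assoc,
    ← whisker_exchange_assoc]

theorem leftComm_natural_first {a a' : C} (h : a ⟶ a') (b w : C) :
    h ▷ (b ⊗ w) ≫ leftComm a' b w = leftComm a b w ≫ b ◁ h ▷ w := by
  simp only [leftComm, Category.assoc]
  rw [associator_inv_naturality_left_assoc, ← associator_naturality_middle,
    ← comp_whiskerRight_assoc, ← comp_whiskerRight_assoc,
    BraidedCategory.braiding_naturality_left]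

theorem leftComm_natural_second {b b' : C} (a : C) (h : b ⟶ b') (w : C) :
    a ◁ h ▷ w ≫ leftComm a b' w = leftComm a b w ≫ h ▷ (a ⊗ w) := by
  simp only [leftComm, Category.assoc]
  rw [associator_inv_naturality_middle_assoc, ← associator_naturality_left,
    ← comp_whiskerRight_assoc, ← comp_whiskerRight_assoc,
    BraidedCategory.braiding_naturality_right]

theorem leftComm_leftComm (a b w : C) : leftComm a b w ≫ leftComm b a w = 𝟙 _ := by
  simp [leftComm, ← comp_whiskerRight_assoc]

theorem leftComm_yangBaxter (a b c w : C) :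
    leftComm a b (c ⊗ w) ≫ b ◁ leftComm a c w ≫ leftComm b c (a ⊗ w) =
      a ◁ leftComm b c w ≫ leftComm a c (b ⊗ w) ≫ c ◁ leftComm a b w := by
  have h := congrArg (fun t => a ◁ (α_ b c w).inv ≫ (α_ a (b ⊗ c) w).inv ≫ t ▷ w ≫
    (α_ c (b ⊗ a) w).hom ≫ c ◁ (α_ b a w).hom) (BraidedCategory.yang_baxter a b c)
  simp only [leftComm]
  refine Eq.trans ?_ (h.trans ?_) <;> monoidal

/-- Moving a factor past a product. -/
theorem leftComm_tensor (p y a b : C) :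
    p ◁ (α_ y a b).inv ≫ leftComm p (y ⊗ a) b ≫ (α_ y a (p ⊗ b)).hom =
      leftComm p y (a ⊗ b) ≫ y ◁ leftComm p a b := by
  simp only [leftComm, BraidedCategory.braiding_tensor_right_hom]
  monoidal

theorem leftComm_tensor_left (a p y b : C) :
    (α_ a p (y ⊗ b)).inv ≫ leftComm (a ⊗ p) y b ≫ y ◁ (α_ a p b).hom =
      a ◁ leftComm p y b ≫ leftComm a y (p ⊗ b) := by
  simp only [leftComm, BraidedCategory.braiding_tensor_left_hom]
  monoidal

theorem leftComm_dupHead {a : C} (d : a ⟶ a ⊗ a) (q w : C) :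
    leftComm q a w ≫ dupHead d (q ⊗ w) =
      q ◁ dupHead d w ≫ leftComm q a (a ⊗ w) ≫ a ◁ leftComm q a w := by
  rw [← leftComm_tensor]
  simp only [dupHead, ← Category.assoc, cancel_mono]
  rw [← leftComm_natural_second]
  simp

theorem dupHead_leftComm {a : C} (d : a ⟶ a ⊗ a) (b w : C) :
    dupHead d (b ⊗ w) ≫ a ◁ leftComm a b w ≫ leftComm a b (a ⊗ w) =
      leftComm a b w ≫ b ◁ dupHead d w := by
  rw [← leftComm_tensor_left]
  simp only [dupHead, whiskerLeft_comp]
  rw [Category.assoc, Iso.hom_inv_id_assoc, ← Category.assoc, leftComm_natural_first,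
    Category.assoc]

theorem dupHead_comm {a : C} (d : a ⟶ a ⊗ a) (hd : d ≫ (β_ a a).hom = d) (w : C) :
    dupHead d w ≫ leftComm a a w = dupHead d w := by
  simp [dupHead, leftComm, ← comp_whiskerRight_assoc, hd]

theorem leftComm_discHead {a : C} (e : a ⟶ 𝟙_ C) (q w : C) :
    leftComm q a w ≫ discHead e (q ⊗ w) = q ◁ discHead e w := by
  rw [discHead, ← Category.assoc, ← leftComm_natural_second]
  simp only [leftComm, discHead, whiskerLeft_comp, Category.assoc, braiding_tensorUnit_right]
  monoidal

end SymmetricMonoidal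

end QLamSem

namespace QLamSem

open CategoryTheory MonoidalCategory

section LawfulCategory

variable {D : LCDData} [Fact (LCDLaws D)]

theorem laws (D : LCDData) [h : Fact (LCDLaws D)] : LCDLaws D := h.out

instance : Category D.Obj where
  Hom := D.Hom
  id := D.id
  comp := D.comp
  id_comp := (laws D).id_comp
  comp_id := (laws D).comp_id
  assoc := (laws D).comp_assoc

instance : MonoidalCategoryStruct D.Obj where
  tensorObj := D.tens
  whiskerLeft A _ _ f := D.tmap (D.id A) f
  whiskerRight f B := D.tmap f (D.id B)
  tensorHom := D.tmap
  tensorUnit := D.unit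
  associator A B X := ⟨D.assoc A B X, D.assocInv A B X, (laws D).assoc_iso₁ A B X,
    (laws D).assoc_iso₂ A B X⟩
  leftUnitor A := ⟨D.lunit A, D.lunitInv A, (laws D).lunit_iso₁ A, (laws D).lunit_iso₂ A⟩
  rightUnitor A := ⟨D.runit A, D.runitInv A, (laws D).runit_iso₁ A, (laws D).runit_iso₂ A⟩

instance : MonoidalCategory D.Obj := MonoidalCategory.ofTensorHom
  (id_tensorHom_id := (laws D).tmap_id)
  (tensorHom_comp_tensorHom := fun f₁ f₂ g₁ g₂ => ((laws D).tmap_comp f₁ g₁ f₂ g₂).symm)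
  (id_tensorHom := fun _ _ _ _ => rfl)
  (tensorHom_id := fun _ _ => rfl)
  (associator_naturality := (laws D).assoc_natural)
  (leftUnitor_naturality := (laws D).lunit_natural)
  (rightUnitor_naturality := (laws D).runit_natural)
  (pentagon := fun A B X Y => ((laws D).pentagon A B X Y).symm)
  (triangle := (laws D).triangle)

/-- The symmetry as an isomorphism. -/
def symmIso (A B : D.Obj) : A ⊗ B ≅ B ⊗ A where
  hom := D.symm A B
  inv := D.symm B A
  hom_inv_id := (laws D).symm_symm A B
  inv_hom_id := (laws D).symm_symm B A

theorem symmIso_hexagon (X Y Z : D.Obj) :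
    α_ X Y Z ≪≫ symmIso X (Y ⊗ Z) ≪≫ α_ Y Z X =
      whiskerRightIso (symmIso X Y) Z ≪≫ α_ Y X Z ≪≫ whiskerLeftIso Y (symmIso X Z) :=
  Iso.ext ((laws D).hexagon X Y Z)

instance : SymmetricCategory D.Obj where
  braiding := symmIso
  braiding_naturality_left f Z := (laws D).symm_natural f (D.id Z)
  braiding_naturality_right X _ _ f := (laws D).symm_natural (D.id X) f
  hexagon_forward := (laws D).hexagon
  hexagon_reverse X Y Z :=
    (Category.assoc _ _ _).symm.trans
      ((congrArg Iso.inv (symmIso_hexagon Z X Y)).trans (Category.assoc _ _ _))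
  symmetry := (laws D).symm_symm

theorem mid4_eq (a b c d : D.Obj) : mid4 D a b c d = tensorμ a b c d := by
  have h : mid4 D a b c d = (α_ a b (c ⊗ d)).hom ≫
    (a ◁ ((α_ b c d).inv ≫ (β_ b c).hom ▷ d ≫ (α_ c b d).hom)) ≫ (α_ a c (b ⊗ d)).inv := rfl
  rw [h]
  simp only [tensorμ, whiskerLeft_comp, Category.assoc]

end LawfulCategory

end QLamSem

namespace QLamSem

open CategoryTheory MonoidalCategory

section ExtractionIdentities

variable {C : Type*} [Category C] [MonoidalCategory C] [SymmetricCategory C]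

theorem leftComm_natural_assoc (a b : C) {w w' z : C} (h : w ⟶ w') (g : b ⊗ (a ⊗ w') ⟶ z) :
    a ◁ b ◁ h ≫ leftComm a b w' ≫ g = leftComm a b w ≫ b ◁ a ◁ h ≫ g := by
  rw [← Category.assoc, leftComm_natural, Category.assoc]

theorem skip_dupHead {b q X : C} (d : b ⟶ b ⊗ b) (k : X ⟶ b ⊗ X)
    (h : k ≫ dupHead d X = k ≫ b ◁ k) :
    (q ◁ k ≫ leftComm q b X) ≫ dupHead d (q ⊗ X) =
      (q ◁ k ≫ leftComm q b X) ≫ b ◁ (q ◁ k ≫ leftComm q b X) := by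
  rw [Category.assoc, leftComm_dupHead, ← whiskerLeft_comp_assoc, h, Category.assoc,
    whiskerLeft_comp, whiskerLeft_comp, Category.assoc, leftComm_natural_assoc]

theorem skip_discHead {b q X : C} (e : b ⟶ 𝟙_ C) (k : X ⟶ b ⊗ X)
    (h : k ≫ discHead e X = 𝟙 X) :
    (q ◁ k ≫ leftComm q b X) ≫ discHead e (q ⊗ X) = 𝟙 (q ⊗ X) := by
  rw [Category.assoc, leftComm_discHead, ← whiskerLeft_comp, h, whiskerLeft_id]

theorem lin_exchange {y z X X' : C} (k : X ⟶ z ⊗ X') :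
    𝟙 (y ⊗ X) ≫ y ◁ k =
      (y ◁ k ≫ leftComm y z X') ≫ z ◁ 𝟙 (y ⊗ X') ≫ leftComm z y X' := by
  simp [leftComm_leftComm]

theorem dup_exchange {y z X X' : C} (d : y ⟶ y ⊗ y) (k : X ⟶ z ⊗ X') :
    dupHead d X ≫ y ◁ (y ◁ k ≫ leftComm y z X') =
      (y ◁ k ≫ leftComm y z X') ≫ z ◁ dupHead d X' ≫ leftComm z y (y ⊗ X') := by
  rw [Category.assoc, ← Category.assoc (leftComm y z X'), ← dupHead_leftComm]
  simp only [Category.assoc, leftComm_leftComm, Category.comp_id, whiskerLeft_comp]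
  rw [← Category.assoc, ← dupHead_natural, Category.assoc]

theorem exchange_dup {y q X X' : C} (d : q ⟶ q ⊗ q) (k : X ⟶ y ⊗ X') :
    (q ◁ k ≫ leftComm q y X') ≫ y ◁ dupHead d X' =
      dupHead d X ≫ q ◁ (q ◁ k ≫ leftComm q y X') ≫ leftComm q y (q ⊗ X') := by
  rw [Category.assoc, ← dupHead_leftComm, whiskerLeft_comp, ← Category.assoc,
    dupHead_natural]
  simp only [Category.assoc]

theorem skip_exchange {y z q X X₁ X₂ X' : C} {k : X ⟶ y ⊗ X₁} {k₁ : X₁ ⟶ z ⊗ X'}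
    {k₂ : X ⟶ z ⊗ X₂} {k₃ : X₂ ⟶ y ⊗ X'}
    (h : k ≫ y ◁ k₁ = k₂ ≫ z ◁ k₃ ≫ leftComm z y X') :
    (q ◁ k ≫ leftComm q y X₁) ≫ y ◁ (q ◁ k₁ ≫ leftComm q z X') =
      (q ◁ k₂ ≫ leftComm q z X₂) ≫ z ◁ (q ◁ k₃ ≫ leftComm q y X') ≫
        leftComm z y (q ⊗ X') := by
  simp only [whiskerLeft_comp, Category.assoc]
  rw [← leftComm_natural_assoc, ← leftComm_natural_assoc, ← whiskerLeft_comp_assoc, h,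
    leftComm_yangBaxter]
  simp only [whiskerLeft_comp, Category.assoc]

theorem extract_skip {y z X X₁ X₂ X' Y Y' : C} {k : X ⟶ y ⊗ X₁} {f : X₁ ⟶ Y}
    {h : Y ⟶ z ⊗ Y'} {k₁ : X₁ ⟶ z ⊗ X'} {f' : X' ⟶ Y'} {k₂ : X ⟶ z ⊗ X₂} {k₃ : X₂ ⟶ y ⊗ X'}
    (hf : f ≫ h = k₁ ≫ z ◁ f') (hk : k ≫ y ◁ k₁ = k₂ ≫ z ◁ k₃ ≫ leftComm z y X') :
    (k ≫ y ◁ f) ≫ y ◁ h ≫ leftComm y z Y' = k₂ ≫ z ◁ (k₃ ≫ y ◁ f') := by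
  rw [Category.assoc, ← whiskerLeft_comp_assoc, hf, whiskerLeft_comp, Category.assoc,
    reassoc_of% hk, ← Category.assoc (leftComm z y X'), ← leftComm_natural]
  simp [leftComm_leftComm]

end ExtractionIdentities

section ComonoidExtraction

variable {C : Type*} [Category C] [MonoidalCategory C]

theorem extract_dup {z X Y : C} (d : z ⟶ z ⊗ z) (k : X ⟶ z ⊗ X) (f : X ⟶ Y)
    (h : k ≫ dupHead d X = k ≫ z ◁ k) :
    (k ≫ z ◁ f) ≫ dupHead d Y = k ≫ z ◁ (k ≫ z ◁ f) := by
  rw [Category.assoc, dupHead_natural, reassoc_of% h, whiskerLeft_comp]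

theorem dup_disc_extract {z X Y : C} (e : z ⟶ 𝟙_ C) (k : X ⟶ z ⊗ X) (f : X ⟶ Y)
    (h : k ≫ discHead e X = 𝟙 X) : (k ≫ z ◁ f) ≫ discHead e Y = f := by
  rw [Category.assoc, discHead_natural, reassoc_of% h]

end ComonoidExtraction

end QLamSem

namespace QLamSem

open CategoryTheory MonoidalCategory

section StructuralMaps

variable {D : LCDData} [Fact (LCDLaws D)] {Θ : ℕ → D.Obj}

/-- A type which is not of the form `!A`. -/
def Linear (A : Ty) : Prop := ∀ B, A ≠ .bang B

variable (D Θ) in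
/-- Comultiplication of the interpretation of `!A`. -/
def dupTy (A : Ty) : denTy D Θ (.bang A) ⟶ denTy D Θ (.bang A) ⊗ denTy D Θ (.bang A) :=
  D.dup (denTy D Θ A)

variable (D Θ) in
/-- Counit of the interpretation of `!A`. -/
def discTy (A : Ty) : denTy D Θ (.bang A) ⟶ 𝟙_ D.Obj := D.disc (denTy D Θ A)

theorem dupTy_coassoc (A : Ty) :
    dupTy D Θ A ≫ dupTy D Θ A ▷ _ ≫ (α_ _ _ _).hom = dupTy D Θ A ≫ _ ◁ dupTy D Θ A :=
  (laws D).dup_assoc _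

theorem dupTy_comm (A : Ty) : dupTy D Θ A ≫ (β_ _ _).hom = dupTy D Θ A :=
  (laws D).dup_comm _

theorem dupTy_counit (A : Ty) : dupTy D Θ A ≫ discTy D Θ A ▷ _ ≫ (λ_ _).hom = 𝟙 _ :=
  (laws D).dup_counit_left _

/-- `Pick t p σ X σ' X' h`: the map `h` extracts from the context `X`, whose entries carry the
labels `σ`, the first entry with label `t`, which is `p`; the entry remains in the context `X'`
precisely when its type is of the form `!A`. -/
inductive Pick : ∀ (_ : ℕ) (p : ℕ × Ty) (_ : List ℕ) (X : CtxL) (_ : List ℕ) (X' : CtxL),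
    (denCtx D Θ X ⟶ denTy D Θ p.2 ⊗ denCtx D Θ X') → Prop
  | lin (t : ℕ) (p : ℕ × Ty) (σ : List ℕ) (X : CtxL) : Linear p.2 →
      Pick t p (t :: σ) (p :: X) σ X (𝟙 (denTy D Θ p.2 ⊗ denCtx D Θ X))
  | dup (t x : ℕ) (A : Ty) (σ : List ℕ) (X : CtxL) :
      Pick t (x, .bang A) (t :: σ) ((x, .bang A) :: X) (t :: σ) ((x, .bang A) :: X)
        (dupHead (dupTy D Θ A) (denCtx D Θ X))
  | there {t : ℕ} {p : ℕ × Ty} {σ : List ℕ} {X : CtxL} {σ' : List ℕ} {X' : CtxL}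
      {h : denCtx D Θ X ⟶ denTy D Θ p.2 ⊗ denCtx D Θ X'} (s : ℕ) (q : ℕ × Ty) : s ≠ t →
      Pick t p σ X σ' X' h →
      Pick t p (s :: σ) (q :: X) (s :: σ') (q :: X')
        (denTy D Θ q.2 ◁ h ≫ leftComm (denTy D Θ q.2) (denTy D Θ p.2) (denCtx D Θ X'))

/-- `Disc σ X d`: the map `d` discards the context `X`, all of whose types are of the form `!A`. -/
inductive Disc : ∀ (_ : List ℕ) (X : CtxL), (denCtx D Θ X ⟶ 𝟙_ D.Obj) → Prop
  | nil : Disc [] [] (𝟙 (𝟙_ D.Obj))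
  | cons {σ : List ℕ} {X : CtxL} {d : denCtx D Θ X ⟶ 𝟙_ D.Obj} (t x : ℕ) (A : Ty) :
      Disc σ X d →
      Disc (t :: σ) ((x, .bang A) :: X) (discHead (discTy D Θ A) (denCtx D Θ X) ≫ d)

/-- `Can σ X τ Y f`: the map `f` is the canonical structural map from the context `X` with labels
`σ` to the context `Y` with labels `τ`, matching entries according to their labels. -/
inductive Can : ∀ (_ : List ℕ) (X : CtxL) (_ : List ℕ) (Y : CtxL),
    (denCtx D Θ X ⟶ denCtx D Θ Y) → Prop
  | nil {σ : List ℕ} {X : CtxL} {d : denCtx D Θ X ⟶ 𝟙_ D.Obj} : Disc σ X d → Can σ X [] [] d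
  | cons {t : ℕ} {p : ℕ × Ty} {σ : List ℕ} {X : CtxL} {σ' : List ℕ} {X' : CtxL} {τ : List ℕ}
      {Y : CtxL} {k : denCtx D Θ X ⟶ denTy D Θ p.2 ⊗ denCtx D Θ X'}
      {f : denCtx D Θ X' ⟶ denCtx D Θ Y} :
      Pick t p σ X σ' X' k → Can σ' X' τ Y f →
      Can σ X (t :: τ) (p :: Y) (k ≫ denTy D Θ p.2 ◁ f)

theorem Pick.length_eq {t : ℕ} {p : ℕ × Ty} {σ σ' : List ℕ} {X X' : CtxL}
    {k : denCtx D Θ X ⟶ denTy D Θ p.2 ⊗ denCtx D Θ X'} (h : Pick t p σ X σ' X' k) :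
    (σ.length = X.length ↔ σ'.length = X'.length) := by
  induction h <;> simp_all

theorem Disc.length_eq {σ : List ℕ} {X : CtxL} {d : denCtx D Θ X ⟶ 𝟙_ D.Obj}
    (h : Disc σ X d) : σ.length = X.length := by
  induction h <;> simp_all

theorem Can.length_eq {σ τ : List ℕ} {X Y : CtxL} {f : denCtx D Θ X ⟶ denCtx D Θ Y}
    (h : Can σ X τ Y f) : σ.length = X.length ∧ τ.length = Y.length := by
  induction h with
  | nil h => exact ⟨h.length_eq, rfl⟩
  | cons hp _ ih => exact ⟨hp.length_eq.2 ih.1, by simp [ih.2]⟩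

theorem Pick.unique {t : ℕ} {p : ℕ × Ty} {σ σ' σ'' : List ℕ} {X X' X'' : CtxL}
    {k : denCtx D Θ X ⟶ denTy D Θ p.2 ⊗ denCtx D Θ X'}
    {k' : denCtx D Θ X ⟶ denTy D Θ p.2 ⊗ denCtx D Θ X''}
    (h : Pick t p σ X σ' X' k) (h' : Pick t p σ X σ'' X'' k') :
    σ' = σ'' ∧ X' = X'' ∧ k ≍ k' := by
  induction h generalizing σ'' X'' with
  | lin p σ X hl =>
    cases h' with
    | lin => exact ⟨rfl, rfl, HEq.rfl⟩
    | dup x A => exact absurd rfl (hl A)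
    | there s q hs _ => exact absurd rfl hs
  | dup x A σ X =>
    cases h' with
    | lin _ _ _ hl => exact absurd rfl (hl A)
    | dup x A => exact ⟨rfl, rfl, HEq.rfl⟩
    | there s q hs _ => exact absurd rfl hs
  | there s q hs _ ih =>
    cases h' with
    | lin _ _ _ hl => exact absurd rfl hs
    | dup x A => exact absurd rfl hs
    | there _ _ _ h' =>
      obtain ⟨rfl, rfl, h⟩ := ih h'
      cases h
      exact ⟨rfl, rfl, HEq.rfl⟩

theorem Disc.unique {σ : List ℕ} {X : CtxL} {d d' : denCtx D Θ X ⟶ 𝟙_ D.Obj}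
    (h : Disc σ X d) (h' : Disc σ X d') : d = d' := by
  induction h with
  | nil => cases h'; rfl
  | cons t x A _ ih =>
    cases h' with
    | cons _ _ _ h' => rw [ih h']

theorem Can.unique {σ τ : List ℕ} {X Y : CtxL} {f f' : denCtx D Θ X ⟶ denCtx D Θ Y}
    (h : Can σ X τ Y f) (h' : Can σ X τ Y f') : f = f' := by
  induction h with
  | nil h => cases h' with | nil h' => exact h.unique h'
  | cons hp _ ih =>
    cases h' with
    | cons hp' h' =>
      obtain ⟨rfl, rfl, h⟩ := hp.unique hp'
      cases h
      rw [ih h']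

/-- Extracting the same entry twice, or extracting it and discarding it. -/
theorem Pick.dupHead {t x : ℕ} {A : Ty} {σ σ' : List ℕ} {X X' : CtxL}
    {k : denCtx D Θ X ⟶ denTy D Θ (.bang A) ⊗ denCtx D Θ X'}
    (h : Pick t (x, .bang A) σ X σ' X' k) :
    ∃ k' : denCtx D Θ X ⟶ denTy D Θ (.bang A) ⊗ denCtx D Θ X, σ' = σ ∧ X' = X ∧ k ≍ k' ∧
      Pick t (x, .bang A) σ X σ X k' ∧
      k' ≫ QLamSem.dupHead (dupTy D Θ A) _ = k' ≫ _ ◁ k' ∧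
      k' ≫ discHead (discTy D Θ A) _ = 𝟙 _ := by
  induction X generalizing σ σ' X' with
  | nil => cases h
  | cons q X ih =>
    cases h with
    | lin _ _ _ hl => exact absurd rfl (hl A)
    | dup =>
      exact ⟨_, rfl, rfl, HEq.rfl, .dup .., dupHead_coassoc _ (dupTy_coassoc A) _,
        dupHead_discHead _ _ (dupTy_counit A) _⟩
    | there s q hs h =>
      obtain ⟨k', rfl, rfl, hk, hp, h1, h2⟩ := ih h
      cases hk
      exact ⟨_, rfl, rfl, HEq.rfl, .there s q hs hp, skip_dupHead _ _ h1, skip_discHead _ _ h2⟩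

/-- Extractions of entries with different labels commute. -/
theorem Pick.exchange {t u : ℕ} {y z : ℕ × Ty} {σ σ₁ σ' : List ℕ} {X X₁ X' : CtxL}
    {k : denCtx D Θ X ⟶ denTy D Θ y.2 ⊗ denCtx D Θ X₁}
    {k₁ : denCtx D Θ X₁ ⟶ denTy D Θ z.2 ⊗ denCtx D Θ X'} (htu : t ≠ u)
    (h : Pick t y σ X σ₁ X₁ k) (h₁ : Pick u z σ₁ X₁ σ' X' k₁) :
    ∃ (σ₂ : List ℕ) (X₂ : CtxL) (k₂ : denCtx D Θ X ⟶ denTy D Θ z.2 ⊗ denCtx D Θ X₂)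
      (k₃ : denCtx D Θ X₂ ⟶ denTy D Θ y.2 ⊗ denCtx D Θ X'),
      Pick u z σ X σ₂ X₂ k₂ ∧ Pick t y σ₂ X₂ σ' X' k₃ ∧
      k ≫ denTy D Θ y.2 ◁ k₁ = k₂ ≫ denTy D Θ z.2 ◁ k₃ ≫ leftComm _ _ _ := by
  induction h generalizing u z σ' X' with
  | lin y σ X hl =>
    exact ⟨_, _, _, _, .there _ _ htu h₁, .lin _ _ _ _ hl, lin_exchange _⟩
  | dup x A σ X =>
    cases h₁ with
    | lin => exact absurd rfl htu
    | dup => exact absurd rfl htu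
    | there _ _ _ h₁ =>
      exact ⟨_, _, _, _, .there _ _ htu h₁, .dup .., dup_exchange _ _⟩
  | there s q hs h ih =>
    cases h₁ with
    | lin _ _ _ hl =>
      exact ⟨_, _, _, _, .lin _ _ _ _ hl, h,
        (congrArg _ (whiskerLeft_id _ _)).trans ((Category.comp_id _).trans
          (Category.id_comp _).symm)⟩
    | dup x B =>
      exact ⟨_, _, _, _, .dup .., .there _ _ hs h, exchange_dup _ _⟩
    | there _ _ hs₁ h₁ =>
      obtain ⟨σ₂, X₂, k₂, k₃, h₂, h₃, e⟩ := ih htu h₁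
      exact ⟨_, _, _, _, .there _ _ hs₁ h₂, .there _ _ hs h₃, skip_exchange e⟩

/-- Extraction after a structural map is extraction followed by a structural map. -/
theorem Can.pick {u : ℕ} {z : ℕ × Ty} {σ τ τ' : List ℕ} {X Y Y' : CtxL}
    {f : denCtx D Θ X ⟶ denCtx D Θ Y} {h : denCtx D Θ Y ⟶ denTy D Θ z.2 ⊗ denCtx D Θ Y'}
    (hf : Can σ X τ Y f) (hh : Pick u z τ Y τ' Y' h) :
    ∃ (σ' : List ℕ) (X' : CtxL) (k : denCtx D Θ X ⟶ denTy D Θ z.2 ⊗ denCtx D Θ X')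
      (f' : denCtx D Θ X' ⟶ denCtx D Θ Y'),
      Pick u z σ X σ' X' k ∧ Can σ' X' τ' Y' f' ∧ f ≫ h = k ≫ denTy D Θ z.2 ◁ f' := by
  induction hf generalizing u z τ' Y' with
  | nil => cases hh
  | cons hp hf ih =>
    cases hh with
    | lin => exact ⟨_, _, _, _, hp, hf, Category.comp_id _⟩
    | dup x A =>
      obtain ⟨k', rfl, rfl, hk, hp', h1, -⟩ := hp.dupHead
      cases hk
      exact ⟨_, _, _, _, hp', .cons hp' hf, extract_dup _ _ _ h1⟩
    | there _ _ hs hh =>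
      obtain ⟨σ₁, X₁, k₁, f₁, h₁, hf₁, e₁⟩ := ih hh
      obtain ⟨σ₂, X₂, k₂, k₃, h₂, h₃, e⟩ := hp.exchange hs h₁
      exact ⟨_, _, _, _, h₂, .cons h₃ hf₁, extract_skip e₁ e⟩

end StructuralMaps

end QLamSem

namespace QLamSem

open CategoryTheory MonoidalCategory

section ConcatenationIdentities

variable {C : Type*} [Category C] [MonoidalCategory C]

theorem discHead_natural_assoc {a : C} (e : a ⟶ 𝟙_ C) {w w' z : C} (h : w ⟶ w') (g : w' ⟶ z) :
    a ◁ h ≫ discHead e w' ≫ g = discHead e w ≫ h ≫ g := by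
  rw [← Category.assoc, discHead_natural, Category.assoc]

theorem discHead_split {y Y W YW : C} (e : y ⟶ 𝟙_ C) (d : Y ⟶ 𝟙_ C) (s : YW ⟶ Y ⊗ W) :
    (y ◁ s ≫ (α_ y Y W).inv) ≫ (discHead e Y ≫ d) ▷ W ≫ (λ_ W).hom =
      discHead e YW ≫ s ≫ d ▷ W ≫ (λ_ W).hom := by
  rw [← discHead_natural_assoc]
  simp [discHead]

theorem lin_append {y X W XW : C} {s : XW ⟶ X ⊗ W} {j : X ⊗ W ⟶ XW} (h : s ≫ j = 𝟙 XW) :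
    (y ◁ s ≫ (α_ y X W).inv) ≫ 𝟙 (y ⊗ X) ▷ W ≫ (α_ y X W).hom ≫ y ◁ j = 𝟙 (y ⊗ XW) := by
  simp [← whiskerLeft_comp, h]

theorem dup_append {y X W XW : C} (d : y ⟶ y ⊗ y) {s : XW ⟶ X ⊗ W} {j : X ⊗ W ⟶ XW}
    (h : s ≫ j = 𝟙 XW) :
    (y ◁ s ≫ (α_ y X W).inv) ≫ dupHead d X ▷ W ≫ (α_ y (y ⊗ X) W).hom ≫
      y ◁ ((α_ y X W).hom ≫ y ◁ j) = dupHead d XW := by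
  have hd : (α_ y X W).inv ≫ dupHead d X ▷ W ≫ (α_ y (y ⊗ X) W).hom ≫ y ◁ (α_ y X W).hom =
      dupHead d (X ⊗ W) := by simp [dupHead]
  rw [whiskerLeft_comp, Category.assoc, reassoc_of% hd, ← dupHead_natural,
    ← whiskerLeft_comp_assoc, h, whiskerLeft_id, Category.id_comp]

theorem whisker_right_append {X y X' Y W W' YW YW' : C} (k : X ⟶ y ⊗ X') (f : X' ⟶ YW)
    (s : YW ⟶ Y ⊗ W) (g : W ⟶ W') (j : Y ⊗ W' ⟶ YW') :
    (k ≫ y ◁ f) ≫ (y ◁ s ≫ (α_ y Y W).inv) ≫ (y ⊗ Y) ◁ g ≫ (α_ y Y W').hom ≫ y ◁ j =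
      k ≫ y ◁ (f ≫ s ≫ Y ◁ g ≫ j) := by
  simp

theorem whisker_left_append {X z X' Y Y' Z W YW Y'W ZW : C} {f : X ⟶ YW} {s : YW ⟶ Y ⊗ W}
    {k : Y ⟶ z ⊗ Y'} {k' : X ⟶ z ⊗ X'} {f' : X' ⟶ Y'W} {g : Y' ⟶ Z} {j : Z ⊗ W ⟶ ZW}
    {s' : Y'W ⟶ Y' ⊗ W} {j' : Y' ⊗ W ⟶ Y'W} (h : j' ≫ s' = 𝟙 _)
    (e : f ≫ s ≫ k ▷ W ≫ (α_ z Y' W).hom ≫ z ◁ j' = k' ≫ z ◁ f') :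
    f ≫ s ≫ (k ≫ z ◁ g) ▷ W ≫ (α_ z Z W).hom ≫ z ◁ j =
      k' ≫ z ◁ (f' ≫ s' ≫ g ▷ W ≫ j) := by
  rw [whiskerLeft_comp, ← reassoc_of% e, ← whiskerLeft_comp, reassoc_of% h]
  simp

theorem append_tensor {X Y₁ Y₂ Z₁ Z₂ Y YZ Z : C} {f : X ⟶ Y} {s : Y ⟶ Y₁ ⊗ Y₂}
    {g₁ : Y₁ ⟶ Z₁} {g₂ : Y₂ ⟶ Z₂} {j : Y₁ ⊗ Z₂ ⟶ YZ} {s' : YZ ⟶ Y₁ ⊗ Z₂}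
    {j' : Z₁ ⊗ Z₂ ⟶ Z} (h : j ≫ s' = 𝟙 _) :
    (f ≫ s ≫ Y₁ ◁ g₂ ≫ j) ≫ s' ≫ g₁ ▷ Z₂ ≫ j' = f ≫ s ≫ (g₁ ⊗ₘ g₂) ≫ j' := by
  simp only [Category.assoc, reassoc_of% h, tensorHom_def']

theorem split_join_cons {y X W XW : C} {s : XW ⟶ X ⊗ W} {j : X ⊗ W ⟶ XW} (h : s ≫ j = 𝟙 XW) :
    (y ◁ s ≫ (α_ y X W).inv) ≫ (α_ y X W).hom ≫ y ◁ j = 𝟙 (y ⊗ XW) := by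
  simp [← whiskerLeft_comp, h]

theorem join_split_cons {y X W XW : C} {s : XW ⟶ X ⊗ W} {j : X ⊗ W ⟶ XW} (h : j ≫ s = 𝟙 _) :
    ((α_ y X W).hom ≫ y ◁ j) ≫ y ◁ s ≫ (α_ y X W).inv = 𝟙 ((y ⊗ X) ⊗ W) := by
  rw [Category.assoc, ← whiskerLeft_comp_assoc, h]
  simp

theorem extract_comp {z X X' Y Y' Z : C} {f : X ⟶ Y} {h : Y ⟶ z ⊗ Y'} {k : X ⟶ z ⊗ X'}
    {f' : X' ⟶ Y'} (e : f ≫ h = k ≫ z ◁ f') (g : Y' ⟶ Z) :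
    f ≫ h ≫ z ◁ g = k ≫ z ◁ (f' ≫ g) := by
  rw [whiskerLeft_comp, reassoc_of% e]

theorem comp_unit_discard {X W : C} (f : X ⟶ W) :
    f ≫ (λ_ W).inv ≫ 𝟙 (𝟙_ C) ▷ W ≫ (λ_ W).hom = f := by
  simp

end ConcatenationIdentities

section SymmetricConcatenation

variable {C : Type*} [Category C] [MonoidalCategory C] [SymmetricCategory C]

theorem there_append {q z X X' W XW X'W : C} (s : XW ⟶ X ⊗ W) (h : X ⟶ z ⊗ X')
    (j : X' ⊗ W ⟶ X'W) :
    (q ◁ s ≫ (α_ q X W).inv) ≫ (q ◁ h ≫ leftComm q z X') ▷ W ≫ (α_ z (q ⊗ X') W).hom ≫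
        z ◁ ((α_ q X' W).hom ≫ q ◁ j) =
      q ◁ (s ≫ h ▷ W ≫ (α_ z X' W).hom ≫ z ◁ j) ≫ leftComm q z X'W := by
  simp only [whiskerLeft_comp, Category.assoc, leftComm_natural]
  simp [leftComm]

end SymmetricConcatenation

end QLamSem

namespace QLamSem

open CategoryTheory MonoidalCategory

section Concatenation

variable {D : LCDData} [Fact (LCDLaws D)] {Θ : ℕ → D.Obj}

variable (D Θ) in
/-- Splitting of a concatenated context. -/
def splitHom (X Y : CtxL) : denCtx D Θ (X ++ Y) ⟶ denCtx D Θ X ⊗ denCtx D Θ Y :=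
  splitCtx D Θ X Y

variable (D Θ) in
/-- Joining of two contexts. -/
def joinHom (X Y : CtxL) : denCtx D Θ X ⊗ denCtx D Θ Y ⟶ denCtx D Θ (X ++ Y) :=
  joinCtx D Θ X Y

theorem splitHom_joinHom (X Y : CtxL) : splitHom D Θ X Y ≫ joinHom D Θ X Y = 𝟙 _ := by
  induction X with
  | nil => exact (λ_ (denCtx D Θ Y)).inv_hom_id
  | cons p X ih => exact split_join_cons ih

theorem joinHom_splitHom (X Y : CtxL) : joinHom D Θ X Y ≫ splitHom D Θ X Y = 𝟙 _ := by
  induction X with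
  | nil => exact (λ_ (denCtx D Θ Y)).hom_inv_id
  | cons p X ih => exact join_split_cons ih

/-- Discarding the first entry of the target of a structural map. -/
theorem Can.discHead {t x : ℕ} {A : Ty} {σ τ : List ℕ} {X Y : CtxL}
    {f : denCtx D Θ X ⟶ denCtx D Θ ((x, Ty.bang A) :: Y)}
    (hf : Can σ X (t :: τ) ((x, .bang A) :: Y) f) :
    Can σ X τ Y (f ≫ QLamSem.discHead (discTy D Θ A) (denCtx D Θ Y)) := by
  cases hf with
  | cons hp hf =>
    obtain ⟨k', rfl, rfl, hk, hp', -, h2⟩ := hp.dupHead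
    cases hk
    exact (congrArg (Can _ _ _ _) (dup_disc_extract (discTy D Θ A) _ _ h2)).mpr hf

theorem Can.comp_disc {σ τ : List ℕ} {X Y : CtxL} {f : denCtx D Θ X ⟶ denCtx D Θ Y}
    {d : denCtx D Θ Y ⟶ 𝟙_ D.Obj} (hf : Can σ X τ Y f) (hd : Disc τ Y d) :
    Can σ X [] [] (f ≫ d) := by
  induction hd with
  | nil => exact (congrArg (Can _ _ _ _) (Category.comp_id f)).mpr hf
  | cons t x A _ ih =>
    exact (congrArg (Can _ _ _ _) (Category.assoc f _ _).symm).mpr (ih hf.discHead)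

theorem Can.comp {σ τ υ : List ℕ} {X Y Z : CtxL} {f : denCtx D Θ X ⟶ denCtx D Θ Y}
    {g : denCtx D Θ Y ⟶ denCtx D Θ Z} (hf : Can σ X τ Y f) (hg : Can τ Y υ Z g) :
    Can σ X υ Z (f ≫ g) := by
  induction hg generalizing σ X with
  | nil hd => exact hf.comp_disc hd
  | cons hp _ ih =>
    obtain ⟨σ', X', k, f', hk, hf', e⟩ := hf.pick hp
    refine (congrArg (Can _ _ _ _) ?_).mpr (.cons hk (ih hf'))
    exact extract_comp e _

theorem Can.disc_left {σ τ₁ τ₂ : List ℕ} {X Y₁ Y₂ : CtxL}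
    {f : denCtx D Θ X ⟶ denCtx D Θ (Y₁ ++ Y₂)} {d : denCtx D Θ Y₁ ⟶ 𝟙_ D.Obj}
    (hd : Disc τ₁ Y₁ d) (hf : Can σ X (τ₁ ++ τ₂) (Y₁ ++ Y₂) f) :
    Can σ X τ₂ Y₂ (f ≫ splitHom D Θ Y₁ Y₂ ≫ d ▷ denCtx D Θ Y₂ ≫ (λ_ _).hom) := by
  induction hd with
  | nil =>
    exact (congrArg (Can _ _ _ _) (comp_unit_discard f)).mpr hf
  | cons t x A _ ih =>
    refine (congrArg (Can _ _ _ _) ?_).mpr (ih hf.discHead)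
    exact (congrArg (f ≫ ·) (discHead_split _ _ _)).trans (Category.assoc _ _ _).symm

theorem Pick.append {u : ℕ} {z : ℕ × Ty} {σ σ' : List ℕ} {X X' : CtxL}
    {h : denCtx D Θ X ⟶ denTy D Θ z.2 ⊗ denCtx D Θ X'} (hh : Pick u z σ X σ' X' h)
    (τ : List ℕ) (Y : CtxL) :
    Pick u z (σ ++ τ) (X ++ Y) (σ' ++ τ) (X' ++ Y)
      (splitHom D Θ X Y ≫ h ▷ denCtx D Θ Y ≫ (α_ _ _ _).hom ≫
        denTy D Θ z.2 ◁ joinHom D Θ X' Y) := by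
  induction hh with
  | lin p σ X hl =>
    refine (congrArg (Pick _ _ _ _ _ _) ?_).mpr (.lin u p (σ ++ τ) (X ++ Y) hl)
    exact lin_append (splitHom_joinHom X Y)
  | dup x A σ X =>
    refine (congrArg (Pick _ _ _ _ _ _) ?_).mpr (.dup u x A (σ ++ τ) (X ++ Y))
    exact dup_append _ (splitHom_joinHom X Y)
  | there s q hs _ ih =>
    refine (congrArg (Pick _ _ _ _ _ _) ?_).mpr (.there s q hs ih)
    exact there_append _ _ _

theorem Can.comp_right {σ τ₁ τ₂ υ : List ℕ} {X Y₁ Y₂ Z : CtxL}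
    {f : denCtx D Θ X ⟶ denCtx D Θ (Y₁ ++ Y₂)} {g : denCtx D Θ Y₂ ⟶ denCtx D Θ Z}
    (hl : τ₁.length = Y₁.length)
    (hf : Can σ X (τ₁ ++ τ₂) (Y₁ ++ Y₂) f) (hg : Can τ₂ Y₂ υ Z g) :
    Can σ X (τ₁ ++ υ) (Y₁ ++ Z)
      (f ≫ splitHom D Θ Y₁ Y₂ ≫ denCtx D Θ Y₁ ◁ g ≫ joinHom D Θ Y₁ Z) := by
  induction Y₁ generalizing σ X τ₁ with
  | nil =>
    obtain rfl : τ₁ = [] := by simpa using hl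
    refine (congrArg (Can _ _ _ _) ?_).mpr (hf.comp hg)
    refine congrArg (f ≫ ·) ?_
    exact (congrArg ((λ_ _).inv ≫ ·) (leftUnitor_naturality g)).trans
      (Iso.inv_hom_id_assoc _ _)
  | cons p Y₁ ih =>
    cases τ₁ with
    | nil => simp at hl
    | cons t τ₁ =>
      cases hf with
      | cons hp hf =>
        refine (congrArg (Can _ _ _ _) ?_).mpr (.cons hp (ih (by simpa using hl) hf))
        exact whisker_right_append _ _ _ _ _

theorem Can.comp_left {σ τ₁ τ₂ υ : List ℕ} {X Y₁ Y₂ Z : CtxL}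
    {f : denCtx D Θ X ⟶ denCtx D Θ (Y₁ ++ Y₂)} {g : denCtx D Θ Y₁ ⟶ denCtx D Θ Z}
    (hf : Can σ X (τ₁ ++ τ₂) (Y₁ ++ Y₂) f) (hg : Can τ₁ Y₁ υ Z g) :
    Can σ X (υ ++ τ₂) (Z ++ Y₂)
      (f ≫ splitHom D Θ Y₁ Y₂ ≫ g ▷ denCtx D Θ Y₂ ≫ joinHom D Θ Z Y₂) := by
  induction hg generalizing σ X with
  | nil hd => exact hf.disc_left hd
  | cons hp _ ih =>
    obtain ⟨σ', X', k, f', hk, hf', e⟩ := hf.pick (hp.append τ₂ Y₂)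
    refine (congrArg (Can _ _ _ _) ?_).mpr (.cons hk (ih hf'))
    exact whisker_left_append (joinHom_splitHom _ _) e

theorem Can.comp_append {σ τ₁ τ₂ υ₁ υ₂ : List ℕ} {X Y₁ Y₂ Z₁ Z₂ : CtxL}
    {f : denCtx D Θ X ⟶ denCtx D Θ (Y₁ ++ Y₂)} {g₁ : denCtx D Θ Y₁ ⟶ denCtx D Θ Z₁}
    {g₂ : denCtx D Θ Y₂ ⟶ denCtx D Θ Z₂}
    (hf : Can σ X (τ₁ ++ τ₂) (Y₁ ++ Y₂) f) (hg₁ : Can τ₁ Y₁ υ₁ Z₁ g₁)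
    (hg₂ : Can τ₂ Y₂ υ₂ Z₂ g₂) :
    Can σ X (υ₁ ++ υ₂) (Z₁ ++ Z₂)
      (f ≫ splitHom D Θ Y₁ Y₂ ≫ (g₁ ⊗ₘ g₂) ≫ joinHom D Θ Z₁ Z₂) :=
  (congrArg (Can _ _ _ _) (append_tensor (joinHom_splitHom _ _)).symm).mpr
    ((hf.comp_right hg₁.length_eq.1 hg₂).comp_left hg₁)

end Concatenation

end QLamSem

namespace QLamSem

open CategoryTheory MonoidalCategory

section StructuralIdentities

variable {C : Type*} [Category C] [MonoidalCategory C] [SymmetricCategory C]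

theorem leftComm_whisker_discHead {p : C} (e : p ⟶ 𝟙_ C) (y X : C) :
    leftComm p y X ≫ y ◁ discHead e X = discHead e (y ⊗ X) := by
  rw [← leftComm_discHead, ← Category.assoc, leftComm_leftComm, Category.id_comp]

theorem weaken_cons {p y X X' Y : C} (e : p ⟶ 𝟙_ C) (k : X ⟶ y ⊗ X') (f : X' ⟶ Y) :
    (p ◁ k ≫ leftComm p y X') ≫ y ◁ (discHead e X' ≫ f) = discHead e X ≫ k ≫ y ◁ f := by
  rw [whiskerLeft_comp, Category.assoc, ← Category.assoc (leftComm p y X'),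
    leftComm_whisker_discHead, discHead_natural_assoc]

theorem dupHead_whisker_discHead {p X Y : C} (d : p ⟶ p ⊗ p) (e : p ⟶ 𝟙_ C)
    (hc : d ≫ (β_ p p).hom = d) (hd : d ≫ e ▷ p ≫ (λ_ p).hom = 𝟙 p) (f : X ⟶ Y) :
    dupHead d X ≫ p ◁ (discHead e X ≫ f) = p ◁ f := by
  have h : dupHead d X ≫ p ◁ discHead e X = 𝟙 _ := by
    rw [← leftComm_discHead, ← Category.assoc, dupHead_comm d hc, dupHead_discHead d e hd]
  rw [whiskerLeft_comp, reassoc_of% h]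

theorem swap_lin (p q X : C) :
    (p ◁ 𝟙 (q ⊗ X) ≫ leftComm p q X) ≫ q ◁ 𝟙 (p ⊗ X) = leftComm p q X := by
  simp

theorem swap_dup {p q X : C} (d : q ⟶ q ⊗ q) (e : q ⟶ 𝟙_ C)
    (hc : d ≫ (β_ q q).hom = d) (hd : d ≫ e ▷ q ≫ (λ_ q).hom = 𝟙 q) :
    (p ◁ dupHead d X ≫ leftComm p q (q ⊗ X)) ≫ q ◁ p ◁ (discHead e X ≫ 𝟙 X) =
      leftComm p q X := by
  rw [Category.assoc, ← leftComm_natural, ← whiskerLeft_comp_assoc,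
    dupHead_whisker_discHead d e hc hd]
  simp

theorem leftComm_unit (p X : C) :
    p ◁ (λ_ X).inv ≫ leftComm p (𝟙_ C) X ≫ (λ_ (p ⊗ X)).hom = 𝟙 _ := by
  have h : (β_ p (𝟙_ C)).hom = (ρ_ p).hom ≫ (λ_ p).inv := by simp
  simp [leftComm, h]

theorem insert_unit {p X Y : C} (f : X ⟶ Y) :
    p ◁ (f ≫ (λ_ Y).inv) ≫ leftComm p (𝟙_ C) Y ≫ (λ_ (p ⊗ Y)).hom = p ◁ f := by
  rw [whiskerLeft_comp, Category.assoc, leftComm_unit, Category.comp_id]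

theorem insert_cons {p y X X' Y W YW YW' : C} (k : X ⟶ y ⊗ X') (f : X' ⟶ YW)
    (s : YW ⟶ Y ⊗ W) (j : Y ⊗ (p ⊗ W) ⟶ YW') :
    (p ◁ k ≫ leftComm p y X') ≫ y ◁ (p ◁ (f ≫ s) ≫ leftComm p Y W ≫ j) =
      p ◁ ((k ≫ y ◁ f) ≫ y ◁ s ≫ (α_ y Y W).inv) ≫ leftComm p (y ⊗ Y) W ≫
        (α_ y Y (p ⊗ W)).hom ≫ y ◁ j := by
  have h := leftComm_tensor p y Y W
  simp only [whiskerLeft_comp, Category.assoc, reassoc_of% h]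
  rw [← leftComm_natural_assoc, ← leftComm_natural_assoc]

theorem split_dup_cons {p X Y Z YZ W : C} (d : p ⟶ p ⊗ p) (g : X ⟶ Y ⊗ Z) {j : Y ⊗ Z ⟶ YZ}
    {s : YZ ⟶ Y ⊗ Z} (h : j ≫ s = 𝟙 _) (j' : Y ⊗ (p ⊗ Z) ⟶ W) :
    (p ◁ g ≫ d ▷ (Y ⊗ Z) ≫ tensorμ p p Y Z) ≫ (α_ p Y (p ⊗ Z)).hom ≫ p ◁ j' =
      dupHead d X ≫ p ◁ (p ◁ ((g ≫ j) ≫ s) ≫ leftComm p Y Z ≫ j') := by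
  rw [Category.assoc g, h, Category.comp_id, whiskerLeft_comp, ← Category.assoc (dupHead d X),
    ← dupHead_natural]
  simp [tensorμ, dupHead, leftComm]

theorem split_dup_nil {Y Z W : C} (s : W ⟶ Y ⊗ Z) :
    (λ_ W).inv ≫ ((λ_ (𝟙_ C)).inv ⊗ₘ s) ≫ tensorμ (𝟙_ C) (𝟙_ C) Y Z ≫
      ((λ_ Y).hom ⊗ₘ (λ_ Z).hom) = s := by
  rw [tensorHom_def', Category.assoc, ← tensor_left_unitality]
  simp

theorem split_dup_assoc {p Δ Γ₁ Γ₂ Γ X Y₁ Y₂ : C} (d : p ⟶ p ⊗ p) (s : X ⟶ Δ ⊗ Γ)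
    (dc : Δ ⟶ Δ ⊗ Δ) (s' : Γ ⟶ Γ₁ ⊗ Γ₂) (j₁ : Δ ⊗ Γ₁ ⟶ Y₁) (j₂ : Δ ⊗ Γ₂ ⟶ Y₂) :
    (p ◁ s ≫ (α_ p Δ Γ).inv) ≫ (((d ⊗ₘ dc) ≫ tensorμ p p Δ Δ) ⊗ₘ s') ≫
        tensorμ (p ⊗ Δ) (p ⊗ Δ) Γ₁ Γ₂ ≫
        (((α_ p Δ Γ₁).hom ≫ p ◁ j₁) ⊗ₘ ((α_ p Δ Γ₂).hom ≫ p ◁ j₂)) =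
      p ◁ (s ≫ (dc ⊗ₘ s') ≫ tensorμ Δ Δ Γ₁ Γ₂ ≫ (j₁ ⊗ₘ j₂)) ≫
        d ▷ (Y₁ ⊗ Y₂) ≫ tensorμ p p Y₁ Y₂ := by
  have h := tensor_associativity p p Δ Δ Γ₁ Γ₂
  have hn := tensorμ_natural (𝟙 p) (𝟙 p) j₁ j₂
  have ha : (α_ p Δ Γ).inv ≫ ((d ⊗ₘ dc) ⊗ₘ s') ≫ (α_ (p ⊗ p) (Δ ⊗ Δ) (Γ₁ ⊗ Γ₂)).hom =
      d ⊗ₘ (dc ⊗ₘ s') := by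
    rw [associator_naturality, Iso.inv_hom_id_assoc]
  have e : (((d ⊗ₘ dc) ≫ tensorμ p p Δ Δ) ⊗ₘ s') =
      ((d ⊗ₘ dc) ⊗ₘ s') ≫ tensorμ p p Δ Δ ▷ (Γ₁ ⊗ Γ₂) := by
    rw [← tensorHom_id, tensorHom_comp_tensorHom, Category.comp_id]
  rw [e, ← tensorHom_comp_tensorHom (α_ p Δ Γ₁).hom, ← id_tensorHom p j₁, ← id_tensorHom p j₂]
  simp only [Category.assoc]
  rw [reassoc_of% h, ← hn, reassoc_of% ha]
  simp only [← id_tensorHom, ← tensorHom_id, tensorHom_comp_tensorHom_assoc, Category.id_comp,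
    Category.comp_id]
  rw [id_tensorHom_id, Category.comp_id]

end StructuralIdentities

section DiscardIdentities

variable {C : Type*} [Category C] [MonoidalCategory C]

theorem discard_cons {p X : C} (e : p ⟶ 𝟙_ C) (d : X ⟶ 𝟙_ C) :
    (e ⊗ₘ d) ≫ (λ_ (𝟙_ C)).hom = discHead e X ≫ d := by
  simp [discHead, MonoidalCategory.tensorHom_def]

theorem extend_natural {X Y A XA YA A' : C} (f : X ⟶ Y) (r : A ⟶ A') {jX : X ⊗ A' ⟶ XA}
    {sX : XA ⟶ X ⊗ A'} (h : jX ≫ sX = 𝟙 _) (jY : Y ⊗ A' ⟶ YA) :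
    f ▷ A ≫ (Y ◁ r ≫ jY) = (X ◁ r ≫ jX) ≫ 𝟙 XA ≫ sX ≫ (f ⊗ₘ 𝟙 A') ≫ jY := by
  rw [Category.id_comp, Category.assoc, reassoc_of% h]
  simp [whisker_exchange_assoc]

end DiscardIdentities

end QLamSem

namespace QLamSem

open CategoryTheory MonoidalCategory

section StructuralConstructions

variable {D : LCDData} [Fact (LCDLaws D)] {Θ : ℕ → D.Obj}

theorem linear_or_bang (A : Ty) : Linear A ∨ ∃ B, A = .bang B := by
  cases A with
  | bang B => exact .inr ⟨B, rfl⟩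
  | _ => exact .inl fun _ h => by cases h

theorem Can.weaken {s x : ℕ} {A : Ty} {σ τ : List ℕ} {X Y : CtxL}
    {f : denCtx D Θ X ⟶ denCtx D Θ Y} (hf : Can σ X τ Y f) (hs : s ∉ τ) :
    Can (s :: σ) ((x, .bang A) :: X) τ Y
      (QLamSem.discHead (discTy D Θ A) (denCtx D Θ X) ≫ f) := by
  induction hf with
  | nil hd => exact .nil (.cons s x A hd)
  | cons hp _ ih =>
    rw [List.mem_cons, not_or] at hs
    refine (congrArg (Can _ _ _ _) ?_).mpr (.cons (.there s _ hs.1 hp) (ih hs.2))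
    exact (weaken_cons _ _ _).symm

theorem Can.cons_cons {s : ℕ} {p : ℕ × Ty} {σ τ : List ℕ} {X Y : CtxL}
    {f : denCtx D Θ X ⟶ denCtx D Θ Y} (hf : Can σ X τ Y f) (hs : s ∉ τ) :
    Can (s :: σ) (p :: X) (s :: τ) (p :: Y) (denTy D Θ p.2 ◁ f) := by
  obtain ⟨x, A⟩ := p
  rcases linear_or_bang A with hA | ⟨B, rfl⟩
  · exact (congrArg (Can _ _ _ _) (Category.id_comp _)).mp (.cons (.lin s (x, A) σ X hA) hf)
  · refine (congrArg (Can _ _ _ _) ?_).mpr (.cons (.dup s x B σ X) (hf.weaken hs))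
    exact (dupHead_whisker_discHead _ _ (dupTy_comm B) (dupTy_counit B) f).symm

theorem Can.id {σ : List ℕ} {X : CtxL} (hl : σ.length = X.length) (hσ : σ.Nodup) :
    Can σ X σ X (𝟙 (denCtx D Θ X)) := by
  induction X generalizing σ with
  | nil =>
    obtain rfl : σ = [] := by simpa using hl
    exact .nil .nil
  | cons p X ih =>
    cases σ with
    | nil => simp at hl
    | cons s σ =>
      rw [List.nodup_cons] at hσ
      exact (congrArg (Can _ _ _ _) (whiskerLeft_id _ _)).mp
        ((ih (by simpa using hl) hσ.2).cons_cons hσ.1)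

theorem Can.leftComm {s t : ℕ} {p q : ℕ × Ty} {σ : List ℕ} {X : CtxL}
    (hl : σ.length = X.length) (hσ : (s :: t :: σ).Nodup) :
    Can (s :: t :: σ) (p :: q :: X) (t :: s :: σ) (q :: p :: X)
      (QLamSem.leftComm (denTy D Θ p.2) (denTy D Θ q.2) (denCtx D Θ X)) := by
  obtain ⟨x, A⟩ := q
  simp only [List.nodup_cons, List.mem_cons, not_or] at hσ
  obtain ⟨⟨hst, hs⟩, ht, hσ⟩ := hσ
  rcases linear_or_bang A with hA | ⟨B, rfl⟩
  · refine (congrArg (Can _ _ _ _) ?_).mpr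
      (.cons (.there s p hst (.lin t (x, A) σ X hA)) (.id (X := p :: X) (by simpa using hl)
        (List.nodup_cons.2 ⟨hs, hσ⟩)))
    exact (swap_lin _ _ _).symm
  · refine (congrArg (Can _ _ _ _) ?_).mpr
      (.cons (.there s p hst (.dup t x B σ X)) (((Can.id hl hσ).weaken ht).cons_cons hs))
    exact (swap_dup _ _ (dupTy_comm B) (dupTy_counit B)).symm

theorem Can.swapMor {σ₁ σ₂ : List ℕ} {s t : ℕ} {Γ₁ Γ₂ : CtxL} {p q : ℕ × Ty}
    (h₁ : σ₁.length = Γ₁.length) (h₂ : σ₂.length = Γ₂.length)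
    (hσ : (σ₁ ++ s :: t :: σ₂).Nodup) :
    Can (σ₁ ++ s :: t :: σ₂) (Γ₁ ++ q :: p :: Γ₂) (σ₁ ++ t :: s :: σ₂) (Γ₁ ++ p :: q :: Γ₂)
      (QLamSem.swapMor D Θ Γ₁ p q Γ₂) := by
  have hid : Can (D := D) (Θ := Θ) (σ₁ ++ s :: t :: σ₂) (Γ₁ ++ q :: p :: Γ₂) _ _ (𝟙 _) :=
    .id (by simp [h₁, h₂]) hσ
  refine (congrArg (Can _ _ _ _) ?_).mpr
    (hid.comp_right h₁ (.leftComm h₂ (List.nodup_append.1 hσ).2.1))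
  exact (Category.id_comp (X := denCtx D Θ (Γ₁ ++ q :: p :: Γ₂)) _).symm

theorem Can.insert {s : ℕ} {p : ℕ × Ty} {σ τ₁ τ₂ : List ℕ} {X Y₁ Y₂ : CtxL}
    {f : denCtx D Θ X ⟶ denCtx D Θ (Y₁ ++ Y₂)} (hf : Can σ X (τ₁ ++ τ₂) (Y₁ ++ Y₂) f)
    (hs : s ∉ τ₁ ++ τ₂) (hl : τ₁.length = Y₁.length) :
    Can (s :: σ) (p :: X) (τ₁ ++ s :: τ₂) (Y₁ ++ p :: Y₂)
      (denTy D Θ p.2 ◁ (f ≫ splitHom D Θ Y₁ Y₂) ≫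
        QLamSem.leftComm (denTy D Θ p.2) (denCtx D Θ Y₁) (denCtx D Θ Y₂) ≫
        joinHom D Θ Y₁ (p :: Y₂)) := by
  induction Y₁ generalizing σ X τ₁ with
  | nil =>
    obtain rfl : τ₁ = [] := by simpa using hl
    refine (congrArg (Can _ _ _ _) ?_).mpr (hf.cons_cons hs)
    exact insert_unit f
  | cons q Y₁ ih =>
    cases τ₁ with
    | nil => simp at hl
    | cons t τ₁ =>
      cases hf with
      | cons hp hf =>
        rw [List.cons_append, List.mem_cons, not_or] at hs
        refine (congrArg (Can _ _ _ _) ?_).mpr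
          (.cons (.there s p hs.1 hp) (ih hf hs.2 (by simpa using hl)))
        exact (insert_cons _ _ _ _).symm

theorem Disc.discCtx {σ : List ℕ} {Δ : CtxL} (hl : σ.length = Δ.length) :
    Disc σ (bangify Δ) (QLamSem.discCtx D Θ Δ) := by
  induction Δ generalizing σ with
  | nil =>
    obtain rfl : σ = [] := by simpa using hl
    exact .nil
  | cons p Δ ih =>
    cases σ with
    | nil => simp at hl
    | cons s σ =>
      refine (congrArg (Disc _ _) ?_).mpr (.cons s p.1 p.2 (ih (by simpa using hl)))
      exact discard_cons (C := D.Obj) _ _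

theorem eqHom_cons (p : ℕ × Ty) {X Y : CtxL} (h : X = Y) :
    eqHom D (congrArg (denCtx D Θ) (congrArg (p :: ·) h)) =
      denTy D Θ p.2 ◁ (show denCtx D Θ X ⟶ denCtx D Θ Y from eqHom D (congrArg (denCtx D Θ) h)) := by
  subst h
  exact (whiskerLeft_id (denTy D Θ p.2) (denCtx D Θ X)).symm

variable (D Θ) in
/-- `splitDup` as a morphism of the category. -/
def splitDupHom (Δ Γ₁ Γ₂ : CtxL) : denCtx D Θ (bangify Δ ++ Γ₁ ++ Γ₂) ⟶
    denCtx D Θ (bangify Δ ++ Γ₁) ⊗ denCtx D Θ (bangify Δ ++ Γ₂) :=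
  splitDup D Θ Δ Γ₁ Γ₂

theorem splitDupHom_nil (Γ₁ Γ₂ : CtxL) :
    splitDupHom D Θ [] Γ₁ Γ₂ = splitHom D Θ Γ₁ Γ₂ := by
  have h := split_dup_nil (splitHom D Θ Γ₁ Γ₂)
  rw [← mid4_eq] at h
  exact (Category.id_comp (X := denCtx D Θ (Γ₁ ++ Γ₂)) _).trans h

theorem splitDupHom_cons (p : ℕ × Ty) (Δ Γ₁ Γ₂ : CtxL) :
    splitDupHom D Θ (p :: Δ) Γ₁ Γ₂ =
      denTy D Θ (.bang p.2) ◁ splitDupHom D Θ Δ Γ₁ Γ₂ ≫ dupTy D Θ p.2 ▷ _ ≫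
        tensorμ _ _ _ _ := by
  have h := split_dup_assoc (dupTy D Θ p.2) (splitHom D Θ (bangify Δ) (Γ₁ ++ Γ₂))
    (QLamSem.dupCtx D Θ Δ) (splitHom D Θ Γ₁ Γ₂) (joinHom D Θ (bangify Δ) Γ₁)
    (joinHom D Θ (bangify Δ) Γ₂)
  rw [← mid4_eq, ← mid4_eq, ← mid4_eq] at h
  have e := eqHom_cons (D := D) (Θ := Θ) (p.1, .bang p.2) (List.append_assoc (bangify Δ) Γ₁ Γ₂)
  refine (congrArg (fun k => D.comp k _) e).trans ?_
  refine (congrArg (D.comp _) h).trans ?_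
  exact (Category.assoc (obj := D.Obj) _ _ _).symm.trans
    (congrArg (fun k => D.comp k _) (whiskerLeft_comp (C := D.Obj) _ _ _).symm)

theorem Can.splitDup {τ₀ τ₁ τ₂ : List ℕ} {Δ Γ₁ Γ₂ : CtxL} (h₀ : τ₀.length = Δ.length)
    (h₁ : τ₁.length = Γ₁.length) (h₂ : τ₂.length = Γ₂.length) (hτ : (τ₀ ++ τ₁ ++ τ₂).Nodup) :
    Can (τ₀ ++ τ₁ ++ τ₂) (bangify Δ ++ Γ₁ ++ Γ₂) ((τ₀ ++ τ₁) ++ (τ₀ ++ τ₂))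
      ((bangify Δ ++ Γ₁) ++ (bangify Δ ++ Γ₂))
      (splitDupHom D Θ Δ Γ₁ Γ₂ ≫ joinHom D Θ (bangify Δ ++ Γ₁) (bangify Δ ++ Γ₂)) := by
  induction Δ generalizing τ₀ with
  | nil =>
    obtain rfl : τ₀ = [] := by simpa using h₀
    refine (congrArg (Can _ _ _ _) ?_).mpr (.id (X := Γ₁ ++ Γ₂) (by simp [h₁, h₂]) hτ)
    rw [splitDupHom_nil]
    exact splitHom_joinHom _ _
  | cons p Δ ih =>
    cases τ₀ with
    | nil => simp at h₀
    | cons s τ₀ =>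
      have hs : s ∉ (τ₀ ++ τ₁) ++ (τ₀ ++ τ₂) := by
        have h := (List.nodup_cons.1 hτ).1
        change s ∉ τ₀ ++ τ₁ ++ τ₂ at h
        simp only [List.mem_append] at h ⊢
        tauto
      have hi := ih (by simpa using h₀) (List.nodup_cons.1 hτ).2
      have hc := hi.insert (p := (p.1, .bang p.2)) hs
        (by simpa [h₁, bangify] using h₀)
      refine (congrArg (Can _ _ _ _) ?_).mpr (.cons (.dup s p.1 p.2 _ _) hc)
      rw [splitDupHom_cons]
      exact split_dup_cons _ _ (joinHom_splitHom _ _) _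

variable (D Θ) in
/-- `extHom` as a morphism of the category. -/
def extendHom (Γ : CtxL) (x : ℕ) (A : Ty) :
    denCtx D Θ Γ ⊗ denTy D Θ A ⟶ denCtx D Θ (Γ ++ [(x, A)]) :=
  extHom D Θ Γ x A

variable (D Θ) in
/-- `ext2Hom` as a morphism of the category. -/
def extendTwoHom (Γ : CtxL) (x : ℕ) (A : Ty) (y : ℕ) (B : Ty) :
    denCtx D Θ Γ ⊗ (denTy D Θ A ⊗ denTy D Θ B) ⟶ denCtx D Θ (Γ ++ [(x, A), (y, B)]) :=
  ext2Hom D Θ Γ x A y B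

theorem Can.append_id {σ τ υ : List ℕ} {X Y Z : CtxL} {f : denCtx D Θ X ⟶ denCtx D Θ Y}
    (hf : Can σ X τ Y f) (hl : υ.length = Z.length) (hσ : (σ ++ υ).Nodup) :
    Can (σ ++ υ) (X ++ Z) (τ ++ υ) (Y ++ Z)
      (𝟙 _ ≫ splitHom D Θ X Z ≫ (f ⊗ₘ 𝟙 _) ≫ joinHom D Θ Y Z) :=
  (Can.id (by simp [hf.length_eq.1, hl]) hσ).comp_append hf
    (.id hl (List.nodup_append.1 hσ).2.1)

theorem Can.extend {σ τ : List ℕ} {s : ℕ} {X Y : CtxL} {f : denCtx D Θ X ⟶ denCtx D Θ Y}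
    (hf : Can σ X τ Y f) (hσ : (σ ++ [s]).Nodup) (x : ℕ) (A : Ty) :
    ∃ f', Can (σ ++ [s]) (X ++ [(x, A)]) (τ ++ [s]) (Y ++ [(x, A)]) f' ∧
      f ▷ _ ≫ extendHom D Θ Y x A = extendHom D Θ X x A ≫ f' :=
  ⟨_, hf.append_id rfl hσ, extend_natural f (ρ_ (denTy D Θ A)).inv
    (joinHom_splitHom X [(x, A)]) (joinHom D Θ Y [(x, A)])⟩

theorem Can.extendTwo {σ τ : List ℕ} {s t : ℕ} {X Y : CtxL} {f : denCtx D Θ X ⟶ denCtx D Θ Y}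
    (hf : Can σ X τ Y f) (hσ : (σ ++ [s, t]).Nodup) (x : ℕ) (A : Ty) (y : ℕ) (B : Ty) :
    ∃ f', Can (σ ++ [s, t]) (X ++ [(x, A), (y, B)]) (τ ++ [s, t]) (Y ++ [(x, A), (y, B)]) f' ∧
      f ▷ _ ≫ extendTwoHom D Θ Y x A y B = extendTwoHom D Θ X x A y B ≫ f' :=
  ⟨_, hf.append_id rfl hσ, extend_natural f (denTy D Θ A ◁ (ρ_ (denTy D Θ B)).inv)
    (joinHom_splitHom X [(x, A), (y, B)]) (joinHom D Θ Y [(x, A), (y, B)])⟩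

end StructuralConstructions

end QLamSem

namespace QLamSem

open CategoryTheory MonoidalCategory

section SymmetryFromComonoids

variable {C : Type*} [Category C] [MonoidalCategory C] [SymmetricCategory C]

theorem braiding_of_comonoids {a b : C} (d : a ⟶ a ⊗ a) (e : a ⟶ 𝟙_ C) (d' : b ⟶ b ⊗ b)
    (e' : b ⟶ 𝟙_ C) (h : d ≫ e ▷ a ≫ (λ_ a).hom = 𝟙 a)
    (h' : d' ≫ b ◁ e' ≫ (ρ_ b).hom = 𝟙 b) :
    ((d ⊗ₘ d') ≫ tensorμ a a b b) ≫
      ((e ▷ b ≫ (λ_ b).hom) ⊗ₘ (a ◁ e' ≫ (ρ_ a).hom)) = (β_ a b).hom := by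
  have hn := tensorμ_natural e (𝟙 a) (𝟙 b) e'
  have h1 : d ≫ e ▷ a = (λ_ a).inv := by
    rw [← Category.assoc] at h
    rw [← cancel_mono (λ_ a).hom, h, Iso.inv_hom_id]
  have h2 : d' ≫ b ◁ e' = (ρ_ b).inv := by
    rw [← Category.assoc] at h'
    rw [← cancel_mono (ρ_ b).hom, h', Iso.inv_hom_id]
  simp only [tensorHom_id, id_tensorHom] at hn
  rw [← tensorHom_comp_tensorHom, Category.assoc, ← reassoc_of% hn,
    tensorHom_comp_tensorHom_assoc, h1, h2]
  simp only [tensorμ, MonoidalCategory.tensorHom_def]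
  simp
  monoidal

end SymmetryFromComonoids

section Promotion

variable {D : LCDData} [Fact (LCDLaws D)] {Θ : ℕ → D.Obj}

/-- Functorial action of `L`. -/
def lMap {X Y : D.Obj} (f : X ⟶ Y) : D.L X ⟶ D.L Y := D.Lmap f

theorem lMap_id (X : D.Obj) : lMap (𝟙 X) = 𝟙 (D.L X) := (laws D).Lmap_id X

theorem lMap_comp {X Y Z : D.Obj} (f : X ⟶ Y) (g : Y ⟶ Z) : lMap (f ≫ g) = lMap f ≫ lMap g :=
  (laws D).Lmap_comp f g

/-- The monoidality isomorphism of `L`. -/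
def lTensor (X Y : D.Obj) : D.L X ⊗ D.L Y ≅ D.L (X ⊗ Y) where
  hom := D.m2 X Y
  inv := D.m2Inv X Y
  hom_inv_id := (laws D).m2_iso₁ X Y
  inv_hom_id := (laws D).m2_iso₂ X Y

theorem lTensor_natural {X X' Y Y' : D.Obj} (f : X ⟶ X') (g : Y ⟶ Y') :
    (lMap f ⊗ₘ lMap g) ≫ (lTensor X' Y').hom = (lTensor X Y).hom ≫ lMap (f ⊗ₘ g) :=
  (laws D).m2_natural f g

/-- Comultiplication of `L`. -/
def lDelta (X : D.Obj) : D.L X ⟶ D.L (D.L X) := D.delta X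

variable (D) in
/-- The structure of an `L`-coalgebra on the unit. -/
def lUnit : 𝟙_ D.Obj ⟶ D.L (𝟙_ D.Obj) := D.m0

/-- The tensor product of two coalgebra structures. -/
def tensorCoalg {X Y : D.Obj} (a : X ⟶ D.L X) (b : Y ⟶ D.L Y) : X ⊗ Y ⟶ D.L (X ⊗ Y) :=
  (a ⊗ₘ b) ≫ (lTensor X Y).hom

/-- `f` commutes with the coalgebra structures `a` and `b`. -/
def CoalgHom {X Y : D.Obj} (a : X ⟶ D.L X) (b : Y ⟶ D.L Y) (f : X ⟶ Y) : Prop :=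
  f ≫ b = a ≫ lMap f

namespace CoalgHom

variable {X Y Z W X' Y' : D.Obj} {a : X ⟶ D.L X} {b : Y ⟶ D.L Y} {c : Z ⟶ D.L Z}
  {a' : X' ⟶ D.L X'} {b' : Y' ⟶ D.L Y'}

theorem id (a : X ⟶ D.L X) : CoalgHom a a (𝟙 X) := by
  rw [CoalgHom, lMap_id, Category.id_comp, Category.comp_id]

theorem comp {f : X ⟶ Y} {g : Y ⟶ Z} (hf : CoalgHom a b f) (hg : CoalgHom b c g) :
    CoalgHom a c (f ≫ g) := by
  rw [CoalgHom] at *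
  rw [Category.assoc, hg, reassoc_of% hf, lMap_comp]

theorem inv {f : X ≅ Y} (hf : CoalgHom a b f.hom) : CoalgHom b a f.inv := by
  rw [CoalgHom] at *
  rw [Iso.inv_comp_eq, reassoc_of% hf, ← lMap_comp, Iso.hom_inv_id, lMap_id, Category.comp_id]

theorem tensor {f : X ⟶ Y} {g : X' ⟶ Y'} (hf : CoalgHom a b f) (hg : CoalgHom a' b' g) :
    CoalgHom (tensorCoalg a a') (tensorCoalg b b') (f ⊗ₘ g) := by
  rw [CoalgHom] at *
  rw [tensorCoalg, tensorCoalg, tensorHom_comp_tensorHom_assoc, hf, hg,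
    ← tensorHom_comp_tensorHom, Category.assoc, lTensor_natural, Category.assoc]

theorem whiskerLeft (a : X ⟶ D.L X) {g : X' ⟶ Y'} (hg : CoalgHom a' b' g) :
    CoalgHom (tensorCoalg a a') (tensorCoalg a b') (X ◁ g) := by
  rw [← id_tensorHom]
  exact (id a).tensor hg

theorem whiskerRight {f : X ⟶ Y} (hf : CoalgHom a b f) (a' : X' ⟶ D.L X') :
    CoalgHom (tensorCoalg a a') (tensorCoalg b a') (f ▷ X') := by
  rw [← tensorHom_id]
  exact hf.tensor (id a')

theorem lTensor_associator (X Y Z : D.Obj) :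
    (lTensor X Y).hom ▷ D.L Z ≫ (lTensor (X ⊗ Y) Z).hom ≫ lMap (α_ X Y Z).hom =
      (α_ _ _ _).hom ≫ D.L X ◁ (lTensor Y Z).hom ≫ (lTensor X (Y ⊗ Z)).hom :=
  (laws D).m2_assoc X Y Z

theorem associator (a : X ⟶ D.L X) (b : Y ⟶ D.L Y) (c : Z ⟶ D.L Z) :
    CoalgHom (tensorCoalg (tensorCoalg a b) c) (tensorCoalg a (tensorCoalg b c))
      (α_ X Y Z).hom := by
  have h := lTensor_associator X Y Z
  have e1 : (tensorCoalg a b ⊗ₘ c) = ((a ⊗ₘ b) ⊗ₘ c) ≫ (lTensor X Y).hom ▷ D.L Z := by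
    rw [← tensorHom_id, tensorHom_comp_tensorHom, Category.comp_id, tensorCoalg]
  have e2 : (a ⊗ₘ tensorCoalg b c) = (a ⊗ₘ (b ⊗ₘ c)) ≫ D.L X ◁ (lTensor Y Z).hom := by
    rw [← id_tensorHom, tensorHom_comp_tensorHom, Category.comp_id, tensorCoalg]
  rw [CoalgHom, tensorCoalg.eq_def a, tensorCoalg.eq_def (tensorCoalg a b), e1, e2]
  simp only [Category.assoc, h, associator_naturality_assoc]

theorem leftUnitor (a : X ⟶ D.L X) : CoalgHom (tensorCoalg (lUnit D) a) a (λ_ X).hom := by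
  have h : lUnit D ▷ D.L X ≫ (lTensor (𝟙_ D.Obj) X).hom ≫ lMap (λ_ X).hom = (λ_ (D.L X)).hom :=
    (laws D).m2_left_unit X
  rw [CoalgHom, tensorCoalg, tensorHom_def', Category.assoc, Category.assoc, h,
    leftUnitor_naturality]

theorem rightUnitor (a : X ⟶ D.L X) : CoalgHom (tensorCoalg a (lUnit D)) a (ρ_ X).hom := by
  have h : D.L X ◁ lUnit D ≫ (lTensor X (𝟙_ D.Obj)).hom ≫ lMap (ρ_ X).hom = (ρ_ (D.L X)).hom :=
    (laws D).m2_right_unit X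
  rw [CoalgHom, tensorCoalg, MonoidalCategory.tensorHom_def, Category.assoc, Category.assoc, h,
    rightUnitor_naturality]

theorem dup (X : D.Obj) :
    CoalgHom (lDelta X) (tensorCoalg (lDelta X) (lDelta X)) (D.dup X) :=
  ((laws D).dup_coalgebra X).symm

theorem disc (X : D.Obj) : CoalgHom (lDelta X) (lUnit D) (D.disc X) :=
  ((laws D).disc_coalgebra X).symm

theorem lTensor (X Y : D.Obj) :
    CoalgHom (tensorCoalg (lDelta X) (lDelta Y)) (lDelta (X ⊗ Y)) (QLamSem.lTensor X Y).hom :=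
  ((laws D).delta_monoidal X Y).trans (Category.assoc (obj := D.Obj) _ _ _).symm

theorem braiding (X Y : D.Obj) :
    CoalgHom (tensorCoalg (lDelta X) (lDelta Y)) (tensorCoalg (lDelta Y) (lDelta X))
      (β_ (D.L X) (D.L Y)).hom := by
  let dX : D.L X ⟶ D.L X ⊗ D.L X := D.dup X
  let dY : D.L Y ⟶ D.L Y ⊗ D.L Y := D.dup Y
  let dXY : D.L (X ⊗ Y) ⟶ D.L (X ⊗ Y) ⊗ D.L (X ⊗ Y) := D.dup (X ⊗ Y)
  let eX : D.L X ⟶ 𝟙_ D.Obj := D.disc X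
  let eY : D.L Y ⟶ 𝟙_ D.Obj := D.disc Y
  have hb := braiding_of_comonoids dX eX dY eY ((laws D).dup_counit_left X)
    ((laws D).dup_counit_right Y)
  have hm : (QLamSem.lTensor X Y).hom ≫ dXY = (dX ⊗ₘ dY) ≫ tensorμ _ _ _ _ ≫
      ((QLamSem.lTensor X Y).hom ⊗ₘ (QLamSem.lTensor X Y).hom) := by
    rw [← mid4_eq]
    exact (laws D).dup_monoidal X Y
  have hm' : (dX ⊗ₘ dY) ≫ tensorμ _ _ _ _ = (QLamSem.lTensor X Y).hom ≫ dXY ≫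
      ((QLamSem.lTensor X Y).inv ⊗ₘ (QLamSem.lTensor X Y).inv) := by
    rw [reassoc_of% hm, tensorHom_comp_tensorHom, Iso.hom_inv_id, id_tensorHom_id,
      Category.comp_id]
  rw [← hb, hm']
  exact ((lTensor X Y).comp ((dup (X ⊗ Y)).comp ((lTensor X Y).inv.tensor (lTensor X Y).inv))).comp
    ((((disc X).whiskerRight (lDelta Y)).comp (leftUnitor _)).tensor
      (((disc Y).whiskerLeft (lDelta X)).comp (rightUnitor _)))

theorem dupHead (X : D.Obj) {W : D.Obj} (w : W ⟶ D.L W) :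
    CoalgHom (tensorCoalg (lDelta X) w) (tensorCoalg (lDelta X) (tensorCoalg (lDelta X) w))
      (QLamSem.dupHead (show D.L X ⟶ D.L X ⊗ D.L X from D.dup X) W) :=
  ((dup X).whiskerRight w).comp (associator _ _ _)

theorem discHead (X : D.Obj) {W : D.Obj} (w : W ⟶ D.L W) :
    CoalgHom (tensorCoalg (lDelta X) w) w
      (QLamSem.discHead (show D.L X ⟶ 𝟙_ D.Obj from D.disc X) W) :=
  ((disc X).whiskerRight w).comp (leftUnitor _)

theorem leftComm (X Y : D.Obj) {W : D.Obj} (w : W ⟶ D.L W) :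
    CoalgHom (tensorCoalg (lDelta X) (tensorCoalg (lDelta Y) w))
      (tensorCoalg (lDelta Y) (tensorCoalg (lDelta X) w))
      (QLamSem.leftComm (D.L X) (D.L Y) W) :=
  (associator _ _ _).inv.comp (((braiding X Y).whiskerRight w).comp (associator _ _ _))

end CoalgHom

/-- The promotion map `a` of a context `X` all of whose types are of the form `!A`. -/
inductive Prom : ∀ (X : CtxL), (denCtx D Θ X ⟶ D.L (denCtx D Θ X)) → Prop
  | nil : Prom [] (lUnit D)
  | cons (x : ℕ) (A : Ty) {X : CtxL} {a : denCtx D Θ X ⟶ D.L (denCtx D Θ X)} :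
      Prom X a → Prom ((x, .bang A) :: X) (tensorCoalg (lDelta (denTy D Θ A)) a)

theorem Prom.unique {X : CtxL} {a a' : denCtx D Θ X ⟶ D.L (denCtx D Θ X)} (h : Prom X a)
    (h' : Prom X a') : a = a' := by
  induction h with
  | nil => cases h'; rfl
  | cons x A _ ih => cases h' with | cons _ _ h' => rw [ih h']

theorem Prom.promCtx (Δ : CtxL) : Prom (bangify Δ) (QLamSem.promCtx D Θ Δ) := by
  induction Δ with
  | nil => exact .nil
  | cons p Δ ih => exact .cons p.1 p.2 ih

theorem Disc.coalgHom {σ : List ℕ} {X : CtxL} {d : denCtx D Θ X ⟶ 𝟙_ D.Obj} (h : Disc σ X d) :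
    ∃ a, Prom X a ∧ CoalgHom a (lUnit D) d := by
  induction h with
  | nil => exact ⟨_, .nil, .id _⟩
  | cons t x A _ ih =>
    obtain ⟨a, ha, h⟩ := ih
    exact ⟨_, .cons x A ha, (CoalgHom.discHead _ a).comp h⟩

theorem Pick.coalgHom {t x : ℕ} {A : Ty} {σ σ' : List ℕ} {X : CtxL}
    {k : denCtx D Θ X ⟶ denTy D Θ (.bang A) ⊗ denCtx D Θ X}
    {a : denCtx D Θ X ⟶ D.L (denCtx D Θ X)}
    (h : Pick t (x, .bang A) σ X σ' X k) (ha : Prom X a) :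
    CoalgHom a (tensorCoalg (lDelta (denTy D Θ A)) a) k := by
  induction X generalizing σ σ' with
  | nil => cases h
  | cons q X ih =>
    cases ha with
    | cons y B ha =>
      cases h with
      | dup => exact .dupHead _ _
      | there s _ _ h => exact ((ih h ha).whiskerLeft _).comp (.leftComm _ _ _)

theorem Can.coalgHom {σ τ : List ℕ} {X Y : CtxL} {f : denCtx D Θ X ⟶ denCtx D Θ Y}
    {b : denCtx D Θ Y ⟶ D.L (denCtx D Θ Y)} (hf : Can σ X τ Y f) (hb : Prom Y b) :
    ∃ a, Prom X a ∧ CoalgHom a b f := by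
  induction hf with
  | nil hd =>
    cases hb
    exact hd.coalgHom
  | cons hp _ ih =>
    cases hb with
    | cons x A hb =>
      obtain ⟨a, ha, h⟩ := ih hb
      obtain ⟨k', rfl, rfl, hk, -, -, -⟩ := hp.dupHead
      cases hk
      exact ⟨a, ha, (hp.coalgHom ha).comp (h.whiskerLeft _)⟩

end Promotion

end QLamSem

namespace QLamSem

section SubtypingUniqueness

theorem Linear.bangN_injective {A A' : Ty} (hA : Linear A) (hA' : Linear A') {n n' : ℕ}
    (h : bangN n A = bangN n' A') : n = n' ∧ A = A' := by
  induction n generalizing n' with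
  | zero =>
    cases n' with
    | zero => exact ⟨rfl, h⟩
    | succ n' => exact absurd h (hA _)
  | succ n ih =>
    cases n' with
    | zero => exact absurd h.symm (hA' _)
    | succ n' =>
      obtain ⟨rfl, rfl⟩ := ih (Ty.bang.inj h)
      exact ⟨rfl, rfl⟩

theorem bangN_injective {n : ℕ} {A A' : Ty} (h : bangN n A = bangN n A') : A = A' := by
  induction n with
  | zero => exact h
  | succ n ih => exact ih (Ty.bang.inj h)

theorem linear_tconst (a : ℕ) : Linear (.tconst a) := fun _ h => by cases h

theorem linear_unit : Linear .unit := fun _ h => by cases h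

theorem linear_arrow (A B : Ty) : Linear (.arrow A B) := fun _ h => by cases h

theorem linear_tensor (A B : Ty) : Linear (.tensor A B) := fun _ h => by cases h

theorem SubD.heq {A B A' B' : Ty} (s : SubD A B) (s' : SubD A' B') (hA : A = A') (hB : B = B') :
    s ≍ s' := by
  induction s generalizing A' B' with
  | tconst n m a h =>
    cases s' with
    | tconst n' m' a' h' =>
      obtain ⟨rfl, e⟩ := (linear_tconst a).bangN_injective (linear_tconst a') hA
      obtain ⟨rfl, -⟩ := (linear_tconst a).bangN_injective (linear_tconst a') hB
      cases e
      rfl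
    | unit n' m' h' => cases ((linear_tconst a).bangN_injective linear_unit hA).2
    | arrow => cases ((linear_tconst a).bangN_injective (linear_arrow _ _) hA).2
    | tensor => cases ((linear_tconst a).bangN_injective (linear_tensor _ _) hA).2
  | unit n m h =>
    cases s' with
    | tconst n' m' a' h' => cases (linear_unit.bangN_injective (linear_tconst a') hA).2
    | unit n' m' h' =>
      obtain ⟨rfl, -⟩ := linear_unit.bangN_injective linear_unit hA
      obtain ⟨rfl, -⟩ := linear_unit.bangN_injective linear_unit hB
      rfl
    | arrow => cases (linear_unit.bangN_injective (linear_arrow _ _) hA).2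
    | tensor => cases (linear_unit.bangN_injective (linear_tensor _ _) hA).2
  | arrow n m A₁ A₂ B₁ B₂ h _ _ ih₁ ih₂ =>
    cases s' with
    | tconst n' m' a' h' =>
      cases ((linear_arrow _ _).bangN_injective (linear_tconst a') hA).2
    | unit n' m' h' => cases ((linear_arrow _ _).bangN_injective linear_unit hA).2
    | arrow _ _ _ _ _ _ _ sA sB =>
      obtain ⟨rfl, e⟩ := (linear_arrow _ _).bangN_injective (linear_arrow _ _) hA
      obtain ⟨rfl, e'⟩ := (linear_arrow _ _).bangN_injective (linear_arrow _ _) hB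
      cases e
      cases e'
      cases ih₁ sA rfl rfl
      cases ih₂ sB rfl rfl
      rfl
    | tensor => cases ((linear_arrow _ _).bangN_injective (linear_tensor _ _) hA).2
  | tensor n m A₁ A₂ B₁ B₂ h _ _ ih₁ ih₂ =>
    cases s' with
    | tconst n' m' a' h' =>
      cases ((linear_tensor _ _).bangN_injective (linear_tconst a') hA).2
    | unit n' m' h' => cases ((linear_tensor _ _).bangN_injective linear_unit hA).2
    | arrow => cases ((linear_tensor _ _).bangN_injective (linear_arrow _ _) hA).2
    | tensor _ _ _ _ _ _ _ sA sB =>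
      obtain ⟨rfl, e⟩ := (linear_tensor _ _).bangN_injective (linear_tensor _ _) hA
      obtain ⟨rfl, e'⟩ := (linear_tensor _ _).bangN_injective (linear_tensor _ _) hB
      cases e
      cases e'
      cases ih₁ sA rfl rfl
      cases ih₂ sB rfl rfl
      rfl

theorem SubD.eq {A B : Ty} (s s' : SubD A B) : s = s' := eq_of_heq (s.heq s' rfl rfl)

end SubtypingUniqueness

section TypingProperties

variable {cty : ℕ → Ty}

/-- A typing derivation which does not end with an exchange. -/
def IsHead : ∀ {Γ : CtxL} {M : Tm} {A : Ty}, TypingD cty Γ M A → Prop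
  | _, _, _, .swap _ => False
  | _, _, _, _ => True

theorem TypingD.exists_head {Γ : CtxL} {M : Tm} {A : Ty} (π : TypingD cty Γ M A) :
    ∃ (Γ₀ : CtxL) (π₀ : TypingD cty Γ₀ M A), IsHead π₀ := by
  induction π with
  | swap _ ih => exact ih
  | var hx s => exact ⟨_, .var hx s, trivial⟩
  | cst s => exact ⟨_, .cst (Δ := []) s, trivial⟩
  | star => exact ⟨_, .star (Δ := []), trivial⟩
  | lam0 hx d _ => exact ⟨_, .lam0 hx d, trivial⟩
  | lamS hx d _ => exact ⟨_, .lamS hx d, trivial⟩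
  | app h d d' _ _ => exact ⟨_, .app h d d', trivial⟩
  | pair h d d' _ _ => exact ⟨_, .pair h d d', trivial⟩
  | letv h hx d d' _ _ => exact ⟨_, .letv h hx d d', trivial⟩
  | letUnit h d d' _ _ => exact ⟨_, .letUnit h d d', trivial⟩
  | letPair h h1 h2 h3 d d' _ _ => exact ⟨_, .letPair h h1 h2 h3 d d', trivial⟩

theorem TypingD.type_unique {Γ Γ' : CtxL} {M : Tm} {A A' : Ty} (π : TypingD cty Γ M A)
    (π' : TypingD cty Γ' M A') : A = A' := by
  induction M generalizing Γ Γ' A A' with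
  | var x B =>
    obtain ⟨_, π, h⟩ := π.exists_head
    obtain ⟨_, π', h'⟩ := π'.exists_head
    cases π with
    | swap => exact h.elim
    | var => cases π' with
      | swap => exact h'.elim
      | var => rfl
  | cst c B =>
    obtain ⟨_, π, h⟩ := π.exists_head
    obtain ⟨_, π', h'⟩ := π'.exists_head
    cases π with
    | swap => exact h.elim
    | cst => cases π' with
      | swap => exact h'.elim
      | cst => rfl
  | star n =>
    obtain ⟨_, π, h⟩ := π.exists_head
    obtain ⟨_, π', h'⟩ := π'.exists_head
    cases π with
    | swap => exact h.elim
    | star => cases π' with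
      | swap => exact h'.elim
      | star => rfl
  | lam n x B M ih =>
    obtain ⟨_, π, h⟩ := π.exists_head
    obtain ⟨_, π', h'⟩ := π'.exists_head
    cases π with
    | swap => exact h.elim
    | lam0 _ d => cases π' with
      | swap => exact h'.elim
      | lam0 _ d' => rw [ih d d']
    | lamS _ d => cases π' with
      | swap => exact h'.elim
      | lamS _ d' => rw [ih d d']
  | app M N ih₁ ih₂ =>
    obtain ⟨_, π, h⟩ := π.exists_head
    obtain ⟨_, π', h'⟩ := π'.exists_head
    cases π with
    | swap => exact h.elim
    | app _ d => cases π' with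
      | swap => exact h'.elim
      | app _ d' => exact (Ty.arrow.inj (ih₁ d d')).2
  | pair n M N ih₁ ih₂ =>
    obtain ⟨_, π, h⟩ := π.exists_head
    obtain ⟨_, π', h'⟩ := π'.exists_head
    cases π with
    | swap => exact h.elim
    | pair _ d e => cases π' with
      | swap => exact h'.elim
      | pair _ d' e' => rw [bangN_injective (ih₁ d d'), bangN_injective (ih₂ e e')]
  | letv x B M N ih₁ ih₂ =>
    obtain ⟨_, π, h⟩ := π.exists_head
    obtain ⟨_, π', h'⟩ := π'.exists_head
    cases π with
    | swap => exact h.elim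
    | letv _ _ _ e => cases π' with
      | swap => exact h'.elim
      | letv _ _ _ e' => exact ih₂ e e'
  | letPair n x B y C M N ih₁ ih₂ =>
    obtain ⟨_, π, h⟩ := π.exists_head
    obtain ⟨_, π', h'⟩ := π'.exists_head
    cases π with
    | swap => exact h.elim
    | letPair _ _ _ _ _ e => cases π' with
      | swap => exact h'.elim
      | letPair _ _ _ _ _ e' => exact ih₂ e e'
  | letUnit M N ih₁ ih₂ =>
    obtain ⟨_, π, h⟩ := π.exists_head
    obtain ⟨_, π', h'⟩ := π'.exists_head
    cases π with
    | swap => exact h.elim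
    | letUnit _ _ e => cases π' with
      | swap => exact h'.elim
      | letUnit _ _ e' => exact ih₂ e e'

/-- The variable `x` occurs free in the term. -/
def Occ (x : ℕ) : Tm → Prop
  | .var y _ => x = y
  | .cst _ _ => False
  | .star _ => False
  | .lam _ y _ M => x ≠ y ∧ Occ x M
  | .app M N => Occ x M ∨ Occ x N
  | .pair _ M N => Occ x M ∨ Occ x N
  | .letv y _ M N => Occ x M ∨ (x ≠ y ∧ Occ x N)
  | .letPair _ y _ z _ M N => Occ x M ∨ (x ≠ y ∧ x ≠ z ∧ Occ x N)
  | .letUnit M N => Occ x M ∨ Occ x N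

theorem not_linear_of_mem_bangify {Δ : CtxL} {x : ℕ} {A : Ty} (h : (x, A) ∈ bangify Δ) :
    ¬ Linear A := by
  obtain ⟨p, -, hp⟩ := List.mem_map.1 h
  cases hp
  exact fun hl => hl _ rfl

theorem names_append (Γ Γ' : CtxL) : names (Γ ++ Γ') = names Γ ++ names Γ' := List.map_append

theorem names_bangify (Δ : CtxL) : names (bangify Δ) = names Δ := by
  simp [names, bangify]

theorem mem_names {Γ : CtxL} {x : ℕ} {A : Ty} (h : (x, A) ∈ Γ) : x ∈ names Γ :=
  List.mem_map.2 ⟨_, h, rfl⟩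

theorem TypingD.occ_of_linear {Γ : CtxL} {M : Tm} {A : Ty} (π : TypingD cty Γ M A) {x : ℕ}
    {B : Ty} (hx : (x, B) ∈ Γ) (hB : Linear B) : Occ x M := by
  have key : ∀ {Δ Γ₁ Γ₂ : CtxL}, (x, B) ∈ bangify Δ ++ Γ₁ ++ Γ₂ →
      (x, B) ∈ bangify Δ ++ Γ₁ ∨ (x, B) ∈ bangify Δ ++ Γ₂ := by
    intro Δ Γ₁ Γ₂ h
    simp only [List.mem_append] at h ⊢
    tauto
  induction π with
  | swap _ ih =>
    refine ih ?_
    simp only [List.mem_append, List.mem_cons] at hx ⊢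
    tauto
  | var _ _ =>
    rcases List.mem_append.1 hx with h | h
    · exact absurd hB (not_linear_of_mem_bangify h)
    · exact congrArg Prod.fst (List.mem_singleton.1 h)
  | cst _ => exact absurd hB (not_linear_of_mem_bangify hx)
  | star => exact absurd hB (not_linear_of_mem_bangify hx)
  | lam0 hy _ ih =>
    exact ⟨fun e => hy (e ▸ mem_names hx), ih (List.mem_append_left _ hx)⟩
  | lamS _ _ _ => exact absurd hB (not_linear_of_mem_bangify hx)
  | app _ _ _ ih₁ ih₂ => exact (key hx).imp ih₁ ih₂
  | pair _ _ _ ih₁ ih₂ => exact (key hx).imp ih₁ ih₂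
  | letUnit _ _ _ ih₁ ih₂ => exact (key hx).imp ih₁ ih₂
  | letv _ hy _ _ ih₁ ih₂ =>
    exact (key hx).imp ih₁ fun h =>
      ⟨fun e => hy (e ▸ mem_names hx), ih₂ (List.mem_append_left _ h)⟩
  | letPair _ _ hy hz _ _ ih₁ ih₂ =>
    exact (key hx).imp ih₁ fun h => ⟨fun e => hy (e ▸ mem_names hx),
      fun e => hz (e ▸ mem_names hx), ih₂ (List.mem_append_left _ h)⟩

theorem TypingD.count_of_occ {Γ : CtxL} {M : Tm} {A : Ty} (π : TypingD cty Γ M A) {x : ℕ}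
    (hx : Occ x M) : (names Γ).count x = 1 := by
  have key : ∀ {Δ Γ₁ Γ₂ : CtxL}, (names (bangify Δ ++ Γ₁ ++ Γ₂)).Nodup →
      (names (bangify Δ ++ Γ₁)).count x = 1 ∨ (names (bangify Δ ++ Γ₂)).count x = 1 →
      (names (bangify Δ ++ Γ₁ ++ Γ₂)).count x = 1 := by
    intro Δ Γ₁ Γ₂ hn h
    refine List.count_eq_one_of_mem hn ?_
    have h' : x ∈ names (bangify Δ ++ Γ₁) ∨ x ∈ names (bangify Δ ++ Γ₂) :=
      h.imp (fun h => List.count_pos_iff.1 (by omega)) (fun h => List.count_pos_iff.1 (by omega))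
    simp only [names_append, List.mem_append] at h' ⊢
    tauto
  have drop : ∀ {Γ Γ' : CtxL}, x ∉ names Γ' → (names (Γ ++ Γ')).count x = 1 →
      (names Γ).count x = 1 := by
    intro Γ Γ' h h'
    rwa [names_append, List.count_append, List.count_eq_zero_of_not_mem h, add_zero] at h'
  induction π with
  | @swap Γ₁ Γ₂ p q _ _ _ ih =>
    rw [← ih hx]
    exact List.Perm.count_eq (((List.Perm.swap p q Γ₂).append_left Γ₁).map _) x
  | var hy _ =>
    cases hx
    rw [names_append, List.count_append, names_bangify, List.count_eq_zero_of_not_mem hy]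
    simp [names]
  | cst _ => exact hx.elim
  | star => exact hx.elim
  | lam0 _ _ ih => exact drop (by simpa [names] using hx.1) (ih hx.2)
  | lamS _ _ ih => exact drop (by simpa [names] using hx.1) (ih hx.2)
  | app h _ _ ih₁ ih₂ => exact key h (hx.imp ih₁ ih₂)
  | pair h _ _ ih₁ ih₂ => exact key h (hx.imp ih₁ ih₂)
  | letUnit h _ _ ih₁ ih₂ => exact key h (hx.imp ih₁ ih₂)
  | letv h _ _ _ ih₁ ih₂ =>
    exact key h (hx.imp ih₁ fun hx => drop (by simpa [names] using hx.1) (ih₂ hx.2))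
  | letPair h _ _ _ _ _ ih₁ ih₂ =>
    exact key h (hx.imp ih₁ fun hx =>
      drop (by simpa [names] using And.intro hx.1 hx.2.1) (ih₂ hx.2.2))

theorem TypingD.mem_names_of_occ {Γ : CtxL} {M : Tm} {A : Ty} (π : TypingD cty Γ M A) {x : ℕ}
    (hx : Occ x M) : x ∈ names Γ :=
  List.count_pos_iff.1 (by rw [π.count_of_occ hx]; exact Nat.one_pos)

end TypingProperties

end QLamSem

namespace QLamSem

open CategoryTheory MonoidalCategory

theorem eq_of_comp_section {C : Type*} [Category C] {W X Y Z V U : C} {f : W ⟶ X} {a : X ⟶ Y}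
    {g : W ⟶ V} {s : V ⟶ U} {t : U ⟶ Y} {j : Y ⟶ Z} {r : Z ⟶ Y} (hr : j ≫ r = 𝟙 Y)
    (h : f ≫ a ≫ j = g ≫ s ≫ t ≫ j) : f ≫ a = g ≫ s ≫ t := by
  have h' := congrArg (· ≫ r) h
  simpa [hr] using h'

section LabelledContexts

variable {D : LCDData} [Fact (LCDLaws D)] {Θ : ℕ → D.Obj}

theorem Pick.mem {t : ℕ} {p : ℕ × Ty} {σ σ' : List ℕ} {X X' : CtxL}
    {k : denCtx D Θ X ⟶ denTy D Θ p.2 ⊗ denCtx D Θ X'} (h : Pick t p σ X σ' X' k) :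
    (t, p) ∈ σ.zip X ∧ (∀ y ∈ σ'.zip X', y ∈ σ.zip X) ∧
      ∀ y ∈ σ.zip X, y ∈ σ'.zip X' ∨ y = (t, p) := by
  induction h with
  | lin p σ X hl => simp; tauto
  | dup x A σ X => exact ⟨List.mem_cons_self, fun _ hy => hy, fun _ hy => .inl hy⟩
  | there s q hs _ ih =>
    obtain ⟨h1, h2, h3⟩ := ih
    simp only [List.zip_cons_cons, List.mem_cons]
    refine ⟨.inr h1, ?_, ?_⟩
    · rintro y (rfl | hy)
      · exact .inl rfl
      · exact .inr (h2 y hy)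
    · rintro y (rfl | hy)
      · exact .inl (.inl rfl)
      · exact (h3 y hy).imp .inr id

theorem Disc.not_linear {σ : List ℕ} {X : CtxL} {d : denCtx D Θ X ⟶ 𝟙_ D.Obj}
    (h : Disc σ X d) : ∀ y ∈ σ.zip X, ¬ Linear y.2.2 := by
  induction h with
  | nil => simp
  | cons t x A _ ih =>
    simp only [List.zip_cons_cons, List.mem_cons]
    rintro y (rfl | hy)
    · exact fun hl => hl A rfl
    · exact ih y hy

theorem Can.mem {σ τ : List ℕ} {X Y : CtxL} {f : denCtx D Θ X ⟶ denCtx D Θ Y}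
    (h : Can σ X τ Y f) :
    (∀ y ∈ τ.zip Y, y ∈ σ.zip X) ∧ ∀ y ∈ σ.zip X, Linear y.2.2 → y ∈ τ.zip Y := by
  induction h with
  | nil hd => exact ⟨by simp, fun y hy hl => absurd hl (hd.not_linear y hy)⟩
  | cons hp _ ih =>
    obtain ⟨h1, h2, h3⟩ := hp.mem
    simp only [List.zip_cons_cons, List.mem_cons]
    refine ⟨?_, fun y hy hl => ?_⟩
    · rintro y (rfl | hy)
      · exact h1
      · exact h2 y (ih.1 y hy)
    · rcases h3 y hy with h | rfl
      · exact .inr (ih.2 y h hl)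
      · exact .inl rfl

theorem Can.labels_subset {σ τ : List ℕ} {X Y : CtxL} {f : denCtx D Θ X ⟶ denCtx D Θ Y}
    (h : Can σ X τ Y f) : τ ⊆ σ := by
  intro t ht
  rw [← List.map_fst_zip h.length_eq.2.le] at ht
  obtain ⟨y, hy, rfl⟩ := List.mem_map.1 ht
  exact (List.of_mem_zip (h.mem.1 y hy)).1

theorem exists_pick {t : ℕ} {p : ℕ × Ty} {G : List (ℕ × ℕ × Ty)} (hG : (G.map Prod.fst).Nodup)
    (h : (t, p) ∈ G) :
    ∃ G' : List (ℕ × ℕ × Ty), ∃ k, Pick (D := D) (Θ := Θ) t p (G.map Prod.fst) (G.map Prod.snd)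
      (G'.map Prod.fst) (G'.map Prod.snd) k ∧ G'.Sublist G ∧
      ∀ y, y ∈ G' ↔ y ∈ G ∧ (Linear p.2 → y ≠ (t, p)) := by
  induction G with
  | nil => simp at h
  | cons z G ih =>
    obtain ⟨s, q⟩ := z
    rw [List.map_cons, List.nodup_cons] at hG
    by_cases hs : s = t
    · subst hs
      have hm : ∀ p', (s, p') ∉ G := fun p' h' => hG.1 (List.mem_map.2 ⟨_, h', rfl⟩)
      obtain rfl : p = q := by
        rcases List.mem_cons.1 h with e | h'
        · exact congrArg Prod.snd e
        · exact absurd h' (hm p)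
      obtain ⟨x, A⟩ := p
      rcases linear_or_bang A with hA | ⟨B, rfl⟩
      · refine ⟨G, _, .lin s (x, A) _ _ hA, List.sublist_cons_self _ _, fun y => ?_⟩
        simp only [List.mem_cons]
        constructor
        · exact fun hy => ⟨.inr hy, fun _ e => hm (x, A) (e ▸ hy)⟩
        · exact fun hy => hy.1.resolve_left (hy.2 hA)
      · refine ⟨(s, x, .bang B) :: G, _, .dup s x B _ _, List.Sublist.refl _, fun y => ?_⟩
        exact ⟨fun hy => ⟨hy, fun hl => absurd rfl (hl B)⟩, And.left⟩
    · have h' : (t, p) ∈ G := (List.mem_cons.1 h).resolve_left fun e => hs (congrArg Prod.fst e).symm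
      obtain ⟨G', k, hk, hsub, hG'⟩ := ih hG.2 h'
      refine ⟨(s, q) :: G', _, .there s q hs hk, hsub.cons_cons _, fun y => ?_⟩
      simp only [List.mem_cons, hG']
      constructor
      · rintro (rfl | hy)
        · exact ⟨.inl rfl, fun _ e => hs (congrArg Prod.fst e)⟩
        · exact ⟨.inr hy.1, hy.2⟩
      · rintro ⟨rfl | hy, h⟩
        · exact .inl rfl
        · exact .inr ⟨hy, h⟩

theorem exists_disc {G : List (ℕ × ℕ × Ty)} (h : ∀ y ∈ G, ¬ Linear y.2.2) :
    ∃ d, Disc (D := D) (Θ := Θ) (G.map Prod.fst) (G.map Prod.snd) d := by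
  induction G with
  | nil => exact ⟨_, .nil⟩
  | cons z G ih =>
    obtain ⟨t, x, A⟩ := z
    obtain ⟨d, hd⟩ := ih fun y hy => h y (List.mem_cons_of_mem _ hy)
    obtain ⟨B, rfl⟩ := (linear_or_bang A).resolve_left (h _ List.mem_cons_self)
    exact ⟨_, .cons t x B hd⟩

theorem exists_can {G H : List (ℕ × ℕ × Ty)} (hG : (G.map Prod.fst).Nodup)
    (hsub : ∀ y ∈ H, y ∈ G) (hlin : ∀ y ∈ G, Linear y.2.2 → y ∈ H)
    (hH : H.Pairwise fun a b => Linear a.2.2 → b ≠ a) :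
    ∃ f, Can (D := D) (Θ := Θ) (G.map Prod.fst) (G.map Prod.snd) (H.map Prod.fst)
      (H.map Prod.snd) f := by
  induction H generalizing G with
  | nil =>
    obtain ⟨d, hd⟩ := exists_disc (D := D) (Θ := Θ) fun y hy hl => List.not_mem_nil (hlin y hy hl)
    exact ⟨d, .nil hd⟩
  | cons z H ih =>
    obtain ⟨t, p⟩ := z
    obtain ⟨G', k, hk, hGG, hG'⟩ := exists_pick (D := D) (Θ := Θ) hG (hsub _ List.mem_cons_self)
    rw [List.pairwise_cons] at hH
    obtain ⟨f, hf⟩ := ih (G := G') (hG.sublist (hGG.map _))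
      (fun y hy => (hG' y).2 ⟨hsub y (List.mem_cons_of_mem _ hy), hH.1 y hy⟩)
      (fun y hy hl => (List.mem_cons.1 (hlin y ((hG' y).1 hy).1 hl)).resolve_left fun e =>
        ((hG' y).1 hy).2 (by rw [e] at hl; exact hl) e)
      hH.2
    exact ⟨_, .cons hk hf⟩

open Classical in
/-- The entries of a labelled context which are of the form `!A` or whose name satisfies `P`. -/
noncomputable def part (P : ℕ → Prop) (σ : List ℕ) (X : CtxL) : List (ℕ × ℕ × Ty) :=
  (σ.zip X).filter fun y => ¬ Linear y.2.2 ∨ P y.2.1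

theorem mem_part {P : ℕ → Prop} {σ : List ℕ} {X : CtxL} {y : ℕ × ℕ × Ty} :
    y ∈ part P σ X ↔ y ∈ σ.zip X ∧ (Linear y.2.2 → P y.2.1) := by
  simp only [part, List.mem_filter, decide_eq_true_eq]
  tauto

theorem part_labels_sublist (P : ℕ → Prop) {σ : List ℕ} {X : CtxL} (hl : σ.length = X.length) :
    ((part P σ X).map Prod.fst).Sublist σ := by
  have h : (part P σ X).Sublist (σ.zip X) := List.filter_sublist
  have h' := h.map Prod.fst
  rwa [List.map_fst_zip hl.le] at h'

theorem map_snd_zip_eq {σ : List ℕ} {X : CtxL} (hl : σ.length = X.length) :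
    (σ.zip X).map Prod.snd = X := List.map_snd_zip hl.ge

theorem part_pairwise (P : ℕ → Prop) {σ : List ℕ} {X : CtxL} (hl : σ.length = X.length)
    (hσ : σ.Nodup) : (part P σ X).Pairwise fun a b => Linear a.2.2 → b ≠ a := by
  have h : (part P σ X).Nodup := .of_map Prod.fst (hσ.sublist (part_labels_sublist P hl))
  exact h.imp fun h _ e => h e.symm

theorem mem_names_of_mem_zip {σ : List ℕ} {X : CtxL} {t x : ℕ} {A : Ty}
    (h : (t, x, A) ∈ σ.zip X) : x ∈ names X := mem_names (List.of_mem_zip h).2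

/-- The canonical map onto a part of a context. -/
theorem exists_can_part {P : ℕ → Prop} {σ τ : List ℕ} {X Y : CtxL} (hl : σ.length = X.length)
    (hσ : σ.Nodup) (hl' : τ.length = Y.length) (hτ : τ.Nodup)
    (hsub : ∀ y ∈ τ.zip Y, y ∈ part P σ X) (hlin : ∀ y ∈ part P σ X, Linear y.2.2 → y ∈ τ.zip Y) :
    ∃ f, Can (D := D) (Θ := Θ) ((part P σ X).map Prod.fst) ((part P σ X).map Prod.snd) τ Y f := by
  have h : (τ.zip Y).Pairwise fun a b => Linear a.2.2 → b ≠ a := by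
    have h : (τ.zip Y).Nodup := .of_map Prod.fst (by rwa [List.map_fst_zip hl'.le])
    exact h.imp fun h _ e => h e.symm
  have := exists_can (D := D) (Θ := Θ) (hσ.sublist (part_labels_sublist P hl)) hsub hlin h
  rwa [List.map_fst_zip hl'.le, map_snd_zip_eq hl'] at this

/-- A structural map followed by the duplication of a context factors through the parts of
the source context determined by the variables needed on either side. -/
theorem Can.factor_splitDup {P Q : ℕ → Prop} {σ τ : List ℕ} {X Δ Γ₁ Γ₂ : CtxL}
    {f : denCtx D Θ X ⟶ denCtx D Θ (bangify Δ ++ Γ₁ ++ Γ₂)}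
    (hf : Can σ X τ (bangify Δ ++ Γ₁ ++ Γ₂) f) (hσ : σ.Nodup) (hτ : τ.Nodup)
    (hn : (names (bangify Δ ++ Γ₁ ++ Γ₂)).Nodup)
    (hP : ∀ {x B}, (x, B) ∈ bangify Δ ++ Γ₁ → Linear B → P x)
    (hP' : ∀ {x}, P x → x ∈ names (bangify Δ ++ Γ₁))
    (hQ : ∀ {x B}, (x, B) ∈ bangify Δ ++ Γ₂ → Linear B → Q x)
    (hQ' : ∀ {x}, Q x → x ∈ names (bangify Δ ++ Γ₂)) :
    ∃ (g : denCtx D Θ X ⟶ denCtx D Θ ((part P σ X).map Prod.snd ++ (part Q σ X).map Prod.snd))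
      (τ₁ τ₂ : List ℕ)
      (f₁ : denCtx D Θ ((part P σ X).map Prod.snd) ⟶ denCtx D Θ (bangify Δ ++ Γ₁))
      (f₂ : denCtx D Θ ((part Q σ X).map Prod.snd) ⟶ denCtx D Θ (bangify Δ ++ Γ₂)),
      Can σ X ((part P σ X).map Prod.fst ++ (part Q σ X).map Prod.fst) _ g ∧
      Can ((part P σ X).map Prod.fst) _ τ₁ _ f₁ ∧ Can ((part Q σ X).map Prod.fst) _ τ₂ _ f₂ ∧
      τ₁.Nodup ∧ τ₂.Nodup ∧
      (∀ y ∈ τ₁.zip (bangify Δ ++ Γ₁), y ∈ τ.zip (bangify Δ ++ Γ₁ ++ Γ₂)) ∧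
      (∀ y ∈ τ₂.zip (bangify Δ ++ Γ₂), y ∈ τ.zip (bangify Δ ++ Γ₁ ++ Γ₂)) ∧
      f ≫ splitDupHom D Θ Δ Γ₁ Γ₂ = g ≫ splitHom D Θ _ _ ≫ (f₁ ⊗ₘ f₂) := by
  obtain ⟨hlσ, hlτ⟩ := hf.length_eq
  obtain ⟨τ₀, τ₁, τ₂, rfl, h₀, h₁, h₂⟩ : ∃ τ₀ τ₁ τ₂, τ = τ₀ ++ τ₁ ++ τ₂ ∧
      τ₀.length = (bangify Δ).length ∧ τ₁.length = Γ₁.length ∧ τ₂.length = Γ₂.length := by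
    simp only [List.length_append] at hlτ
    refine ⟨(τ.take ((bangify Δ).length + Γ₁.length)).take (bangify Δ).length,
      (τ.take ((bangify Δ).length + Γ₁.length)).drop (bangify Δ).length,
      τ.drop ((bangify Δ).length + Γ₁.length), ?_, ?_, ?_, ?_⟩
    · rw [List.take_append_drop, List.take_append_drop]
    all_goals simp only [List.length_take, List.length_drop]; omega
  have h₀₁ : (τ₀ ++ τ₁).length = (bangify Δ ++ Γ₁).length := by simp [h₀, h₁]
  have h₀₂ : (τ₀ ++ τ₂).length = (bangify Δ ++ Γ₂).length := by simp [h₀, h₂]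
  have hz : (τ₀ ++ τ₁ ++ τ₂).zip (bangify Δ ++ Γ₁ ++ Γ₂) =
      τ₀.zip (bangify Δ) ++ τ₁.zip Γ₁ ++ τ₂.zip Γ₂ := by
    rw [List.zip_append h₀₁, List.zip_append h₀]
  have hz₁ : (τ₀ ++ τ₁).zip (bangify Δ ++ Γ₁) = τ₀.zip (bangify Δ) ++ τ₁.zip Γ₁ :=
    List.zip_append h₀
  have hz₂ : (τ₀ ++ τ₂).zip (bangify Δ ++ Γ₂) = τ₀.zip (bangify Δ) ++ τ₂.zip Γ₂ :=
    List.zip_append h₀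
  have hs₁ : ∀ y ∈ (τ₀ ++ τ₁).zip (bangify Δ ++ Γ₁),
      y ∈ (τ₀ ++ τ₁ ++ τ₂).zip (bangify Δ ++ Γ₁ ++ Γ₂) := by
    intro y hy
    rw [hz₁] at hy
    rw [hz]
    exact List.mem_append_left _ hy
  have hs₂ : ∀ y ∈ (τ₀ ++ τ₂).zip (bangify Δ ++ Γ₂),
      y ∈ (τ₀ ++ τ₁ ++ τ₂).zip (bangify Δ ++ Γ₁ ++ Γ₂) := by
    intro y hy
    rw [hz₂] at hy
    rw [hz]
    simp only [List.mem_append] at hy ⊢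
    tauto
  have hsplit : ∀ y ∈ σ.zip X, Linear y.2.2 →
      y ∈ (τ₀ ++ τ₁).zip (bangify Δ ++ Γ₁) ∨ y ∈ (τ₀ ++ τ₂).zip (bangify Δ ++ Γ₂) := by
    intro y hy hl
    have h := hf.mem.2 y hy hl
    rw [hz] at h
    rw [hz₁, hz₂]
    simp only [List.mem_append] at h ⊢
    tauto
  have hn' := hn
  rw [names_append, names_append, List.nodup_append] at hn'
  have hn₁₂ : ∀ {x}, x ∈ names (bangify Δ ++ Γ₁) → x ∈ names Γ₂ → False := fun h h' =>
    hn'.2.2 _ (by rwa [← names_append]) _ h' rfl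
  have hn₂₁ : ∀ {x}, x ∈ names (bangify Δ ++ Γ₂) → x ∈ names Γ₁ → False := by
    intro x h h'
    rw [names_append, List.mem_append] at h
    rcases h with h | h
    · exact (List.nodup_append.1 hn'.1).2.2 _ h _ h' rfl
    · exact hn'.2.2 _ (List.mem_append_right _ h') _ h rfl
  have hlin₁ : ∀ y ∈ part P σ X, Linear y.2.2 → y ∈ (τ₀ ++ τ₁).zip (bangify Δ ++ Γ₁) := by
    intro y hy hl
    refine (hsplit y (mem_part.1 hy).1 hl).resolve_right fun h => ?_
    rw [hz₂, List.mem_append] at h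
    rcases h with h | h
    · exact not_linear_of_mem_bangify (x := y.2.1) (List.of_mem_zip h).2 hl
    · exact hn₁₂ (hP' ((mem_part.1 hy).2 hl)) (mem_names_of_mem_zip h)
  have hlin₂ : ∀ y ∈ part Q σ X, Linear y.2.2 → y ∈ (τ₀ ++ τ₂).zip (bangify Δ ++ Γ₂) := by
    intro y hy hl
    refine (hsplit y (mem_part.1 hy).1 hl).resolve_left fun h => ?_
    rw [hz₁, List.mem_append] at h
    rcases h with h | h
    · exact not_linear_of_mem_bangify (x := y.2.1) (List.of_mem_zip h).2 hl
    · exact hn₂₁ (hQ' ((mem_part.1 hy).2 hl)) (mem_names_of_mem_zip h)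
  have hin₁ : ∀ y ∈ (τ₀ ++ τ₁).zip (bangify Δ ++ Γ₁), y ∈ part P σ X := fun y hy =>
    mem_part.2 ⟨hf.mem.1 y (hs₁ y hy), hP (x := y.2.1) (List.of_mem_zip hy).2⟩
  have hin₂ : ∀ y ∈ (τ₀ ++ τ₂).zip (bangify Δ ++ Γ₂), y ∈ part Q σ X := fun y hy =>
    mem_part.2 ⟨hf.mem.1 y (hs₂ y hy), hQ (x := y.2.1) (List.of_mem_zip hy).2⟩
  have hτ' := List.nodup_append.1 hτ
  have hτ₁ : (τ₀ ++ τ₁).Nodup := hτ'.1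
  have hτ₂ : (τ₀ ++ τ₂).Nodup := hτ.sublist ((List.sublist_append_left τ₀ τ₁).append_right τ₂)
  obtain ⟨f₁, hf₁⟩ := exists_can_part (D := D) (Θ := Θ) hlσ hσ h₀₁ hτ₁ hin₁ hlin₁
  obtain ⟨f₂, hf₂⟩ := exists_can_part (D := D) (Θ := Θ) hlσ hσ h₀₂ hτ₂ hin₂ hlin₂
  have hg : ∃ g, Can (D := D) (Θ := Θ) σ X
      ((part P σ X).map Prod.fst ++ (part Q σ X).map Prod.fst)
      ((part P σ X).map Prod.snd ++ (part Q σ X).map Prod.snd) g := by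
    have h := exists_can (D := D) (Θ := Θ) (G := σ.zip X) (H := part P σ X ++ part Q σ X)
      (by rwa [List.map_fst_zip hlσ.le])
      (fun y hy => (List.mem_append.1 hy).elim (fun h => (mem_part.1 h).1)
        fun h => (mem_part.1 h).1)
      (fun y hy hl => List.mem_append.2 ((hsplit y hy hl).imp (hin₁ y) (hin₂ y)))
      (List.pairwise_append.2 ⟨part_pairwise P hlσ hσ, part_pairwise Q hlσ hσ, by
        intro a ha b hb hl e
        subst e
        have h := hlin₂ _ hb hl
        rw [hz₂, List.mem_append] at h
        rcases h with h | h
        · exact not_linear_of_mem_bangify (x := b.2.1) (List.of_mem_zip h).2 hl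
        · exact hn₁₂ (hP' ((mem_part.1 ha).2 hl)) (mem_names_of_mem_zip h)⟩)
    rwa [List.map_fst_zip hlσ.le, map_snd_zip_eq hlσ, List.map_append, List.map_append] at h
  obtain ⟨g, hg⟩ := hg
  refine ⟨g, τ₀ ++ τ₁, τ₀ ++ τ₂, f₁, f₂, hg, hf₁, hf₂, hτ₁, hτ₂, hs₁, hs₂, ?_⟩
  have h := hf.comp (.splitDup (by simpa [bangify] using h₀) h₁ h₂ hτ)
  have e := h.unique (hg.comp_append hf₁ hf₂)
  exact eq_of_comp_section (joinHom_splitHom _ _) e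

end LabelledContexts

end QLamSem

namespace QLamSem

open CategoryTheory MonoidalCategory

theorem comp_split_tensor {C : Type*} [Category C] [MonoidalCategory C]
    {X Y Y₁ Y₂ X₁ X₂ Z₁ Z₂ : C} {f : X ⟶ Y} {s : Y ⟶ Y₁ ⊗ Y₂} {h : X ⟶ X₁ ⊗ X₂} {f₁ : X₁ ⟶ Y₁}
    {f₂ : X₂ ⟶ Y₂} (e : f ≫ s = h ≫ (f₁ ⊗ₘ f₂)) (c₁ : Y₁ ⟶ Z₁) (c₂ : Y₂ ⟶ Z₂) {W : C}
    (k : Z₁ ⊗ Z₂ ⟶ W) :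
    f ≫ s ≫ (c₁ ⊗ₘ c₂) ≫ k = h ≫ (f₁ ≫ c₁ ⊗ₘ f₂ ≫ c₂) ≫ k := by
  rw [reassoc_of% e, tensorHom_comp_tensorHom_assoc]

section SemanticNaturality

variable {D : LCDData} [Fact (LCDLaws D)]

/-- Abstraction in the Kleisli category. -/
def curry {X A B : D.Obj} (g : X ⊗ A ⟶ D.T B) : X ⟶ D.lolli A B := D.PhiInv g

theorem comp_curry {X Y A B : D.Obj} (f : X ⟶ Y) (g : Y ⊗ A ⟶ D.T B) :
    f ≫ curry g = curry (f ▷ A ≫ g) := by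
  have h := (laws D).Phi_natural_left f (curry g)
  have h' : D.Phi (curry g) = g := (laws D).Phi_iso₂ g
  rw [h'] at h
  exact ((laws D).Phi_iso₁ (f ≫ curry g)).symm.trans (congrArg D.PhiInv h)

/-- The functor part of the monad. -/
def tMap {X Y : D.Obj} (f : X ⟶ Y) : D.T X ⟶ D.T Y := D.Tmap f

/-- The strength of the monad. -/
def strength (X Y : D.Obj) : X ⊗ D.T Y ⟶ D.T (X ⊗ Y) := D.str X Y

/-- Sequencing of a computation with a continuation depending on a context. -/
def letBind {X Y A B : D.Obj} (c : X ⟶ D.T A) (e : Y ⊗ A ⟶ D.T B) : X ⊗ Y ⟶ D.T B :=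
  (c ⊗ₘ 𝟙 Y) ≫ (β_ (D.T A) Y).hom ≫ strength Y A ≫ tMap e ≫ D.mu B

/-- Substitution of a value in a map depending on a context. -/
def letValue {X Y A B : D.Obj} (c : X ⟶ A) (e : Y ⊗ A ⟶ B) : X ⊗ Y ⟶ B :=
  (c ⊗ₘ 𝟙 Y) ≫ (β_ A Y).hom ≫ e

theorem letBind_assoc {X Y A B Z : D.Obj} (c : X ⟶ D.T A) (k : Y ⊗ A ⟶ Z) (e : Z ⟶ D.T B) :
    (c ⊗ₘ 𝟙 Y) ≫ (β_ (D.T A) Y).hom ≫ strength Y A ≫ tMap k ≫ tMap e ≫ D.mu B =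
      letBind c (k ≫ e) := by
  have h : tMap (k ≫ e) = tMap k ≫ tMap e := (laws D).Tmap_comp k e
  rw [letBind, h, Category.assoc]

theorem tensor_letBind {X X' Y Y' A B : D.Obj} (f : X' ⟶ X) (g : Y' ⟶ Y) (c : X ⟶ D.T A)
    (e : Y ⊗ A ⟶ D.T B) :
    (f ⊗ₘ g) ≫ letBind c e = letBind (f ≫ c) (g ▷ A ≫ e) := by
  have h : (g ▷ D.T A) ≫ strength Y A = strength Y' A ≫ tMap (g ▷ A) := by
    have h := (laws D).str_natural g (D.id A)
    rw [(laws D).Tmap_id] at h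
    exact h
  rw [← letBind_assoc, letBind, tensorHom_comp_tensorHom_assoc, Category.comp_id]
  have h' : (f ≫ c ⊗ₘ g) ≫ (β_ (D.T A) Y).hom =
      (f ≫ c ⊗ₘ 𝟙 Y') ≫ (β_ (D.T A) Y').hom ≫ g ▷ D.T A := by
    rw [← BraidedCategory.braiding_naturality_right, tensorHom_id, MonoidalCategory.tensorHom_def,
      Category.assoc]
  rw [reassoc_of% h', reassoc_of% h]

theorem tensor_letValue {X X' Y Y' A B : D.Obj} (f : X' ⟶ X) (g : Y' ⟶ Y) (c : X ⟶ A)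
    (e : Y ⊗ A ⟶ B) :
    (f ⊗ₘ g) ≫ letValue c e = letValue (f ≫ c) (g ▷ A ≫ e) := by
  rw [letValue, letValue, tensorHom_comp_tensorHom_assoc, Category.comp_id]
  have h' : (f ≫ c ⊗ₘ g) ≫ (β_ A Y).hom = (f ≫ c ⊗ₘ 𝟙 Y') ≫ (β_ A Y').hom ≫ g ▷ A := by
    rw [← BraidedCategory.braiding_naturality_right, tensorHom_id, MonoidalCategory.tensorHom_def,
      Category.assoc]
  rw [reassoc_of% h']

theorem comp_split_letBind {X Y Y₁ Y₂ X₁ X₂ A B Z Z' : D.Obj} {f : X ⟶ Y} {s : Y ⟶ Y₁ ⊗ Y₂}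
    {h : X ⟶ X₁ ⊗ X₂} {f₁ : X₁ ⟶ Y₁} {f₂ : X₂ ⟶ Y₂} (e : f ≫ s = h ≫ (f₁ ⊗ₘ f₂))
    {k : Y₂ ⊗ A ⟶ Z} {k' : X₂ ⊗ A ⟶ Z'} {f₃ : Z' ⟶ Z} (e' : f₂ ▷ A ≫ k = k' ≫ f₃)
    (c₁ : Y₁ ⟶ D.T A) (c₂ : Z ⟶ D.T B) :
    f ≫ s ≫ (c₁ ⊗ₘ 𝟙 Y₂) ≫ (β_ (D.T A) Y₂).hom ≫ strength Y₂ A ≫ tMap k ≫ tMap c₂ ≫ D.mu B =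
      h ≫ letBind (f₁ ≫ c₁) (k' ≫ f₃ ≫ c₂) := by
  rw [letBind_assoc, reassoc_of% e, tensor_letBind, reassoc_of% e']

theorem comp_split_letValue {X Y Y₁ Y₂ X₁ X₂ A B Z Z' : D.Obj} {f : X ⟶ Y} {s : Y ⟶ Y₁ ⊗ Y₂}
    {h : X ⟶ X₁ ⊗ X₂} {f₁ : X₁ ⟶ Y₁} {f₂ : X₂ ⟶ Y₂} (e : f ≫ s = h ≫ (f₁ ⊗ₘ f₂))
    {k : Y₂ ⊗ A ⟶ Z} {k' : X₂ ⊗ A ⟶ Z'} {f₃ : Z' ⟶ Z} (e' : f₂ ▷ A ≫ k = k' ≫ f₃)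
    (c₁ : Y₁ ⟶ A) (c₂ : Z ⟶ B) :
    f ≫ s ≫ (c₁ ⊗ₘ 𝟙 Y₂) ≫ (β_ A Y₂).hom ≫ k ≫ c₂ =
      h ≫ letValue (f₁ ≫ c₁) (k' ≫ f₃ ≫ c₂) := by
  have h' : (c₁ ⊗ₘ 𝟙 Y₂) ≫ (β_ A Y₂).hom ≫ k ≫ c₂ = letValue c₁ (k ≫ c₂) := rfl
  rw [h', reassoc_of% e, tensor_letValue, reassoc_of% e']

end SemanticNaturality

section Agreement

/-- Two labelled contexts agree on the label and type of the variables satisfying `R`. -/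
def Agree (R : ℕ → Prop) (τ : List ℕ) (Γ : CtxL) (τ' : List ℕ) (Γ' : CtxL) : Prop :=
  ∀ ⦃x t t' : ℕ⦄ ⦃A A' : Ty⦄, R x → (t, x, A) ∈ τ.zip Γ → (t', x, A') ∈ τ'.zip Γ' →
    t = t' ∧ A = A'

theorem Agree.mono {R R' : ℕ → Prop} {τ υ τ' υ' : List ℕ} {Γ Δ Γ' Δ' : CtxL}
    (h : Agree R τ Γ τ' Γ') (hR : ∀ x, R' x → R x) (h₁ : ∀ y ∈ υ.zip Δ, y ∈ τ.zip Γ)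
    (h₂ : ∀ y ∈ υ'.zip Δ', y ∈ τ'.zip Γ') : Agree R' υ Δ υ' Δ' :=
  fun _ _ _ _ _ hx hy hy' => h (hR _ hx) (h₁ _ hy) (h₂ _ hy')

theorem Agree.extend {R R' : ℕ → Prop} {τ τ' : List ℕ} {Γ Γ' : CtxL} (h : Agree R τ Γ τ' Γ')
    {x : ℕ} (hR : ∀ y, R' y → y ≠ x → R y) (hl : τ.length = Γ.length)
    (hl' : τ'.length = Γ'.length) (hx : x ∉ names Γ) (hx' : x ∉ names Γ') (s : ℕ) (A : Ty) :
    Agree R' (τ ++ [s]) (Γ ++ [(x, A)]) (τ' ++ [s]) (Γ' ++ [(x, A)]) := by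
  intro y t t' B B' hy h₁ h₂
  rw [List.zip_append hl, List.mem_append] at h₁
  rw [List.zip_append hl', List.mem_append] at h₂
  simp only [List.zip_cons_cons, List.zip_nil_right, List.mem_singleton] at h₁ h₂
  rcases h₁ with h₁ | h₁ <;> rcases h₂ with h₂ | h₂
  · by_cases e : y = x
    · exact absurd (e ▸ mem_names_of_mem_zip h₁) hx
    · exact h (hR y hy e) h₁ h₂
  · cases h₂
    exact absurd (mem_names_of_mem_zip h₁) hx
  · cases h₁
    exact absurd (mem_names_of_mem_zip h₂) hx'
  · cases h₁
    cases h₂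
    exact ⟨rfl, rfl⟩

theorem Agree.extendTwo {R R' : ℕ → Prop} {τ τ' : List ℕ} {Γ Γ' : CtxL} (h : Agree R τ Γ τ' Γ')
    {x y : ℕ} (hR : ∀ z, R' z → z ≠ x → z ≠ y → R z) (hl : τ.length = Γ.length)
    (hl' : τ'.length = Γ'.length) (hxy : x ≠ y) (hx : x ∉ names Γ) (hx' : x ∉ names Γ')
    (hy : y ∉ names Γ) (hy' : y ∉ names Γ') (s t : ℕ) (A B : Ty) :
    Agree R' (τ ++ [s, t]) (Γ ++ [(x, A), (y, B)]) (τ' ++ [s, t]) (Γ' ++ [(x, A), (y, B)]) := by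
  have h₁ := h.extend (R' := fun z => R' z ∧ z ≠ y) (x := x) (fun z hz e => hR z hz.1 e hz.2)
    hl hl' hx hx' s A
  have h₂ := h₁.extend (R' := R') (x := y) (fun z hz e => ⟨hz, e⟩) (by simp [hl]) (by simp [hl'])
    (by simpa [names, hxy.symm] using hy) (by simpa [names, hxy.symm] using hy') t B
  simpa using h₂

/-- The predicate `P` holds of the variables of linear type of the context, and only of variables
of the context. -/
def Covers (P : ℕ → Prop) (Γ : CtxL) : Prop :=
  (∀ {x B}, (x, B) ∈ Γ → Linear B → P x) ∧ ∀ {x}, P x → x ∈ names Γ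

variable {cty : ℕ → Ty}

theorem TypingD.covers {Γ : CtxL} {M : Tm} {A : Ty} (π : TypingD cty Γ M A) :
    Covers (Occ · M) Γ :=
  ⟨fun hx hB => π.occ_of_linear hx hB, fun hx => π.mem_names_of_occ hx⟩

theorem TypingD.covers_bind {Γ : CtxL} {x : ℕ} {A B : Ty} {M : Tm}
    (π : TypingD cty (Γ ++ [(x, A)]) M B) (hx : x ∉ names Γ) :
    Covers (fun y => y ≠ x ∧ Occ y M) Γ := by
  refine ⟨fun hy hB => ⟨fun e => hx (e ▸ mem_names hy),
    π.occ_of_linear (List.mem_append_left _ hy) hB⟩, fun hy => ?_⟩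
  have h := π.mem_names_of_occ hy.2
  simpa [names_append, names, hy.1] using h

theorem TypingD.covers_bind_two {Γ : CtxL} {x y : ℕ} {A B C : Ty} {M : Tm}
    (π : TypingD cty (Γ ++ [(x, A), (y, B)]) M C) (hx : x ∉ names Γ) (hy : y ∉ names Γ) :
    Covers (fun z => z ≠ x ∧ z ≠ y ∧ Occ z M) Γ := by
  refine ⟨fun hz hB => ⟨fun e => hx (e ▸ mem_names hz), fun e => hy (e ▸ mem_names hz),
    π.occ_of_linear (List.mem_append_left _ hz) hB⟩, fun hz => ?_⟩
  have h := π.mem_names_of_occ hz.2.2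
  simpa [names_append, names, hz.1, hz.2.1] using h

theorem nodup_append_singleton {τ : List ℕ} (hτ : τ.Nodup) {s : ℕ} (hs : s ∉ τ) :
    (τ ++ [s]).Nodup :=
  List.nodup_append.2 ⟨hτ, List.nodup_singleton s, fun _ ha _ hb e =>
    hs (List.mem_singleton.1 hb ▸ e ▸ ha)⟩

theorem exists_fresh (σ : List ℕ) : ∃ s, s ∉ σ := by
  obtain ⟨s, hs⟩ := Infinite.exists_notMem_finset σ.toFinset
  exact ⟨s, fun h => hs (List.mem_toFinset.2 h)⟩

variable {D : LCDData} [Fact (LCDLaws D)] {Θ : ℕ → D.Obj}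

theorem exists_common_split {P Q : ℕ → Prop} {σ τ τ' : List ℕ} {X Δ Γ₁ Γ₂ Δ' Γ₁' Γ₂' : CtxL}
    {f : denCtx D Θ X ⟶ denCtx D Θ (bangify Δ ++ Γ₁ ++ Γ₂)}
    {f' : denCtx D Θ X ⟶ denCtx D Θ (bangify Δ' ++ Γ₁' ++ Γ₂')}
    (hσ : σ.Nodup) (hτ : τ.Nodup) (hτ' : τ'.Nodup)
    (hf : Can σ X τ (bangify Δ ++ Γ₁ ++ Γ₂) f) (hf' : Can σ X τ' (bangify Δ' ++ Γ₁' ++ Γ₂') f')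
    (hn : (names (bangify Δ ++ Γ₁ ++ Γ₂)).Nodup) (hn' : (names (bangify Δ' ++ Γ₁' ++ Γ₂')).Nodup)
    (hP : Covers P (bangify Δ ++ Γ₁)) (hP' : Covers P (bangify Δ' ++ Γ₁'))
    (hQ : Covers Q (bangify Δ ++ Γ₂)) (hQ' : Covers Q (bangify Δ' ++ Γ₂'))
    {R : ℕ → Prop} (hR : Agree R τ (bangify Δ ++ Γ₁ ++ Γ₂) τ' (bangify Δ' ++ Γ₁' ++ Γ₂')) :
    ∃ (X₁ X₂ : CtxL) (σ₁ σ₂ τ₁ τ₂ τ₁' τ₂' : List ℕ)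
      (h : denCtx D Θ X ⟶ denCtx D Θ X₁ ⊗ denCtx D Θ X₂)
      (f₁ : denCtx D Θ X₁ ⟶ denCtx D Θ (bangify Δ ++ Γ₁))
      (f₂ : denCtx D Θ X₂ ⟶ denCtx D Θ (bangify Δ ++ Γ₂))
      (f₁' : denCtx D Θ X₁ ⟶ denCtx D Θ (bangify Δ' ++ Γ₁'))
      (f₂' : denCtx D Θ X₂ ⟶ denCtx D Θ (bangify Δ' ++ Γ₂')),
      (σ₁.Nodup ∧ τ₁.Nodup ∧ τ₁'.Nodup ∧ Can σ₁ X₁ τ₁ _ f₁ ∧ Can σ₁ X₁ τ₁' _ f₁' ∧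
        Agree R τ₁ (bangify Δ ++ Γ₁) τ₁' (bangify Δ' ++ Γ₁')) ∧
      (σ₂.Nodup ∧ τ₂.Nodup ∧ τ₂'.Nodup ∧ Can σ₂ X₂ τ₂ _ f₂ ∧ Can σ₂ X₂ τ₂' _ f₂' ∧
        Agree R τ₂ (bangify Δ ++ Γ₂) τ₂' (bangify Δ' ++ Γ₂')) ∧
      f ≫ splitDupHom D Θ Δ Γ₁ Γ₂ = h ≫ (f₁ ⊗ₘ f₂) ∧
      f' ≫ splitDupHom D Θ Δ' Γ₁' Γ₂' = h ≫ (f₁' ⊗ₘ f₂') := by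
  obtain ⟨g, τ₁, τ₂, f₁, f₂, hg, hf₁, hf₂, hτ₁, hτ₂, hs₁, hs₂, e⟩ :=
    hf.factor_splitDup hσ hτ hn hP.1 hP.2 hQ.1 hQ.2
  obtain ⟨g', τ₁', τ₂', f₁', f₂', hg', hf₁', hf₂', hτ₁', hτ₂', hs₁', hs₂', e'⟩ :=
    hf'.factor_splitDup hσ hτ' hn' hP'.1 hP'.2 hQ'.1 hQ'.2
  obtain rfl := hg.unique hg'
  have hl := hf.length_eq.1
  exact ⟨_, _, _, _, τ₁, τ₂, τ₁', τ₂', g ≫ splitHom D Θ _ _, f₁, f₂, f₁', f₂',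
    ⟨hσ.sublist (part_labels_sublist P hl), hτ₁, hτ₁', hf₁, hf₁', hR.mono (fun _ h => h) hs₁ hs₁'⟩,
    ⟨hσ.sublist (part_labels_sublist Q hl), hτ₂, hτ₂', hf₂, hf₂', hR.mono (fun _ h => h) hs₂ hs₂'⟩,
    e.trans (Category.assoc _ _ _).symm, e'.trans (Category.assoc _ _ _).symm⟩

end Agreement

end QLamSem

namespace QLamSem

open CategoryTheory MonoidalCategory

theorem comp_discard_tensor {C : Type*} [Category C] [MonoidalCategory C] {X Y Y₁ Y₂ Z W : C}
    (f : X ⟶ Y) (s : Y ⟶ Y₁ ⊗ Y₂) (d : Y₁ ⟶ 𝟙_ C) (r : Y₂ ⟶ Z) (k : Z ⟶ W) :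
    f ≫ s ≫ (d ⊗ₘ r) ≫ (λ_ Z).hom ≫ k = (f ≫ s ≫ d ▷ Y₂ ≫ (λ_ Y₂).hom) ≫ r ≫ k := by
  simp [MonoidalCategory.tensorHom_def]

theorem whisker_comp_natural {C : Type*} [Category C] [MonoidalCategory C] {X Y Z V W A : C}
    {f : X ⟶ Y} {k : Y ⊗ Z ⟶ W} {j : X ⊗ Z ⟶ V} {g : V ⟶ W} (hk : f ▷ Z ≫ k = j ≫ g)
    (m : A ⟶ Z) : f ▷ A ≫ (Y ◁ m ≫ k) = (X ◁ m ≫ j) ≫ g := by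
  rw [Category.assoc, ← hk, whisker_exchange_assoc]

theorem comp_split_value_assoc {C : Type*} [Category C] {X Y Z U V W S R : C} (f : X ⟶ Y)
    (s : Y ⟶ Z) (t : Z ⟶ U) (b : U ⟶ V) (m : V ⟶ W) (k : W ⟶ S) (c : S ⟶ R) :
    f ≫ s ≫ t ≫ b ≫ m ≫ k ≫ c = f ≫ s ≫ t ≫ b ≫ (m ≫ k) ≫ c := by
  simp

theorem notMem_names_right {Δ Γ₁ Γ₂ : CtxL} {x : ℕ} (hx : x ∉ names (bangify Δ ++ Γ₁ ++ Γ₂)) :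
    x ∉ names (bangify Δ ++ Γ₂) := by
  simp only [names_append, List.mem_append] at hx ⊢
  tauto

section Coherence

variable {D : LCDData} [Fact (LCDLaws D)] {cty : ℕ → Ty} (I : Interp D cty)

theorem CoalgHom.comp_promote {X Y Y' Z W : D.Obj} {a : X ⟶ D.L X} {b : Y ⟶ D.L Y}
    {b' : Y' ⟶ D.L Y'} {f : X ⟶ Y} {f' : X ⟶ Y'} (hf : CoalgHom a b f) (hf' : CoalgHom a b' f')
    {c : Y ⟶ Z} {c' : Y' ⟶ Z} (e : f ≫ c = f' ≫ c') (k : D.L Z ⟶ W) :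
    f ≫ b ≫ lMap c ≫ k = f' ≫ b' ≫ lMap c' ≫ k := by
  rw [CoalgHom] at hf hf'
  rw [reassoc_of% hf, reassoc_of% hf', ← Category.assoc (lMap f), ← Category.assoc (lMap f'),
    ← lMap_comp, ← lMap_comp, e]

/-- `denC` as a morphism of the category. -/
def compHom {Γ : CtxL} {M : Tm} {A : Ty} (π : TypingD cty Γ M A) :
    denCtx D I.obj Γ ⟶ D.T (denTy D I.obj A) :=
  denC I π

/-- `denV` as a morphism of the category. -/
def valHom {Γ : CtxL} {M : Tm} {A : Ty} (π : TypingD cty Γ M A) (h : isValue M = true) :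
    denCtx D I.obj Γ ⟶ denTy D I.obj A :=
  denV I π h

/-- Two derivations for the same term have the same denotation up to structural maps. -/
def Coherent {Γ Γ' : CtxL} {M : Tm} {A A' : Ty} (π : TypingD cty Γ M A)
    (π' : TypingD cty Γ' M A') : Prop :=
  ∀ ⦃σ τ τ' : List ℕ⦄ ⦃X : CtxL⦄ ⦃f : denCtx D I.obj X ⟶ denCtx D I.obj Γ⦄
    ⦃f' : denCtx D I.obj X ⟶ denCtx D I.obj Γ'⦄,
    σ.Nodup → τ.Nodup → τ'.Nodup → Can σ X τ Γ f → Can σ X τ' Γ' f' →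
    Agree (Occ · M) τ Γ τ' Γ' →
    f ≫ compHom I π ≍ f' ≫ compHom I π' ∧
      ∀ h : isValue M = true, f ≫ valHom I π h ≍ f' ≫ valHom I π' h

variable {I}

theorem coherent_var {Δ Δ' : CtxL} {x : ℕ} {A A' B : Ty} (hx : x ∉ names Δ) (s : SubD A B)
    (hx' : x ∉ names Δ') (s' : SubD A' B) :
    Coherent I (TypingD.var hx s) (TypingD.var hx' s') := by
  intro σ τ τ' X f f' hσ hτ hτ' hf hf' hag
  have split : ∀ {Δ : CtxL} {A : Ty} {τ : List ℕ} {f : denCtx D I.obj X ⟶ _},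
      Can σ X τ (bangify Δ ++ [(x, A)]) f → ∃ t, (t, x, A) ∈ τ.zip (bangify Δ ++ [(x, A)]) ∧
      Can σ X [t] [(x, A)] (f ≫ splitHom D I.obj (bangify Δ) [(x, A)] ≫
        discCtx D I.obj Δ ▷ denCtx D I.obj [(x, A)] ≫ (λ_ _).hom) := by
    intro Δ A τ f hf
    have hl := hf.length_eq.2
    obtain ⟨t, τ₁, rfl⟩ : ∃ t τ₁, τ = τ₁ ++ [t] := by
      have hne : τ ≠ [] := by
        rintro rfl
        simp at hl
      exact ⟨τ.getLast hne, τ.dropLast, (List.dropLast_append_getLast hne).symm⟩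
    have hl₁ : τ₁.length = (bangify Δ).length := by simpa using hl
    refine ⟨t, ?_, hf.disc_left (.discCtx (by simpa [bangify] using hl₁))⟩
    rw [List.zip_append hl₁]
    exact List.mem_append_right _ List.mem_cons_self
  have key : ∀ {Δ : CtxL} {A : Ty} {f : denCtx D I.obj X ⟶ denCtx D I.obj (bangify Δ ++ [(x, A)])}
      {W : D.Obj} (k : denTy D I.obj A ⟶ W),
      f ≫ splitHom D I.obj (bangify Δ) [(x, A)] ≫
        ((show denCtx D I.obj (bangify Δ) ⟶ 𝟙_ D.Obj from discCtx D I.obj Δ) ⊗ₘ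
          (ρ_ (denTy D I.obj A)).hom) ≫ (λ_ _).hom ≫ k =
      (f ≫ splitHom D I.obj (bangify Δ) [(x, A)] ≫
        discCtx D I.obj Δ ▷ denCtx D I.obj [(x, A)] ≫ (λ_ _).hom) ≫
          (ρ_ (denTy D I.obj A)).hom ≫ k := fun k => comp_discard_tensor _ _ _ _ k
  obtain ⟨t, ht, hc⟩ := split hf
  obtain ⟨t', ht', hc'⟩ := split hf'
  obtain ⟨rfl, rfl⟩ := hag rfl ht ht'
  obtain rfl := s.eq s'
  have e := hc.unique hc'
  constructor
  · refine heq_of_eq ((key _).trans (Eq.trans ?_ (key _).symm))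
    exact congrArg (· ≫ _) e
  · intro h
    refine heq_of_eq ((key _).trans (Eq.trans ?_ (key _).symm))
    exact congrArg (· ≫ _) e

theorem comp_disc_eq {Δ Δ' X : CtxL} {σ τ τ' : List ℕ}
    {f : denCtx D I.obj X ⟶ denCtx D I.obj (bangify Δ)}
    {f' : denCtx D I.obj X ⟶ denCtx D I.obj (bangify Δ')} (hf : Can σ X τ (bangify Δ) f)
    (hf' : Can σ X τ' (bangify Δ') f') {W : D.Obj} (k : 𝟙_ D.Obj ⟶ W) :
    f ≫ (show denCtx D I.obj (bangify Δ) ⟶ 𝟙_ D.Obj from discCtx D I.obj Δ) ≫ k =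
      f' ≫ (show denCtx D I.obj (bangify Δ') ⟶ 𝟙_ D.Obj from discCtx D I.obj Δ') ≫ k := by
  have h := hf.comp_disc (.discCtx (by simpa [bangify] using hf.length_eq.2))
  have h' := hf'.comp_disc (.discCtx (by simpa [bangify] using hf'.length_eq.2))
  exact (Category.assoc _ _ _).symm.trans
    ((congrArg (· ≫ k) (h.unique h')).trans (Category.assoc _ _ _))

theorem coherent_cst {Δ Δ' : CtxL} {c : ℕ} {B : Ty} (s s' : SubD (.bang (cty c)) B) :
    Coherent I (TypingD.cst (Δ := Δ) s) (TypingD.cst (Δ := Δ') s') := by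
  intro σ τ τ' X f f' _ _ _ hf hf' _
  obtain rfl := s.eq s'
  exact ⟨heq_of_eq (comp_disc_eq hf hf' _), fun _ => heq_of_eq (comp_disc_eq hf hf' _)⟩

theorem coherent_star {Δ Δ' : CtxL} {n : ℕ} :
    Coherent I (TypingD.star (Δ := Δ) (n := n)) (TypingD.star (Δ := Δ')) := by
  intro σ τ τ' X f f' _ _ _ hf hf' _
  exact ⟨heq_of_eq (comp_disc_eq hf hf' _), fun _ => heq_of_eq (comp_disc_eq hf hf' _)⟩

theorem Coherent.curry_eq {Δ Δ' : CtxL} {x : ℕ} {A B : Ty} {M : Tm} (hx : x ∉ names Δ)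
    {d : TypingD cty (Δ ++ [(x, A)]) M B} (hx' : x ∉ names Δ')
    {d' : TypingD cty (Δ' ++ [(x, A)]) M B} (h : Coherent I d d')
    {σ τ τ' : List ℕ} {X : CtxL} {f : denCtx D I.obj X ⟶ denCtx D I.obj Δ}
    {f' : denCtx D I.obj X ⟶ denCtx D I.obj Δ'} (hσ : σ.Nodup) (hτ : τ.Nodup) (hτ' : τ'.Nodup)
    (hf : Can σ X τ Δ f) (hf' : Can σ X τ' Δ' f')
    (hag : Agree (fun y => y ≠ x ∧ Occ y M) τ Δ τ' Δ') :
    f ≫ curry (extendHom D I.obj Δ x A ≫ compHom I d) =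
      f' ≫ curry (extendHom D I.obj Δ' x A ≫ compHom I d') := by
  obtain ⟨s, hs⟩ := exists_fresh σ
  have hσ' := nodup_append_singleton hσ hs
  obtain ⟨g, hg, e⟩ := hf.extend hσ' x A
  obtain ⟨g', hg', e'⟩ := hf'.extend hσ' x A
  have h := (h hσ' (nodup_append_singleton hτ fun h => hs (hf.labels_subset h))
    (nodup_append_singleton hτ' fun h => hs (hf'.labels_subset h)) hg hg'
    (hag.extend (fun y hy e => ⟨e, hy⟩) hf.length_eq.2 hf'.length_eq.2 hx hx' s A)).1
  rw [comp_curry, comp_curry, reassoc_of% e, reassoc_of% e', eq_of_heq h]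

theorem Coherent.lam0 {Δ Δ' : CtxL} {x : ℕ} {A B : Ty} {M : Tm} (hx : x ∉ names Δ)
    {d : TypingD cty (Δ ++ [(x, A)]) M B} (hx' : x ∉ names Δ')
    {d' : TypingD cty (Δ' ++ [(x, A)]) M B} (h : Coherent I d d') :
    Coherent I (TypingD.lam0 hx d) (TypingD.lam0 hx' d') := by
  intro σ τ τ' X f f' hσ hτ hτ' hf hf' hag
  have e := h.curry_eq hx hx' hσ hτ hτ' hf hf' hag
  exact ⟨heq_of_eq ((Category.assoc _ _ _).symm.trans
    ((congrArg (· ≫ D.eta _) e).trans (Category.assoc _ _ _))), fun _ => heq_of_eq e⟩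

theorem Coherent.lamS {Δ Δ' : CtxL} {n x : ℕ} {A B : Ty} {M : Tm} (hx : x ∉ names Δ)
    {d : TypingD cty (bangify Δ ++ [(x, A)]) M B} (hx' : x ∉ names Δ')
    {d' : TypingD cty (bangify Δ' ++ [(x, A)]) M B} (h : Coherent I d d') :
    Coherent I (TypingD.lamS (n := n) hx d) (TypingD.lamS (n := n) hx' d') := by
  intro σ τ τ' X f f' hσ hτ hτ' hf hf' hag
  have e := h.curry_eq (by rwa [names_bangify]) (by rwa [names_bangify]) hσ hτ hτ' hf hf' hag
  obtain ⟨a, ha, hc⟩ := hf.coalgHom (.promCtx Δ)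
  obtain ⟨a', ha', hc'⟩ := hf'.coalgHom (.promCtx Δ')
  obtain rfl := ha.unique ha'
  exact ⟨heq_of_eq (CoalgHom.comp_promote hc hc' e _),
    fun _ => heq_of_eq (CoalgHom.comp_promote hc hc' e _)⟩

theorem comp_split_eq {X Y Y' Y₁ Y₂ Y₁' Y₂' X₁ X₂ Z₁ Z₂ W : D.Obj} {f : X ⟶ Y} {f' : X ⟶ Y'}
    {s : Y ⟶ Y₁ ⊗ Y₂} {s' : Y' ⟶ Y₁' ⊗ Y₂'} {h : X ⟶ X₁ ⊗ X₂} {f₁ : X₁ ⟶ Y₁} {f₂ : X₂ ⟶ Y₂}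
    {f₁' : X₁ ⟶ Y₁'} {f₂' : X₂ ⟶ Y₂'} (e : f ≫ s = h ≫ (f₁ ⊗ₘ f₂))
    (e' : f' ≫ s' = h ≫ (f₁' ⊗ₘ f₂')) {c₁ : Y₁ ⟶ Z₁} {c₁' : Y₁' ⟶ Z₁} (h₁ : f₁ ≫ c₁ ≍ f₁' ≫ c₁')
    {c₂ : Y₂ ⟶ Z₂} {c₂' : Y₂' ⟶ Z₂} (h₂ : f₂ ≫ c₂ ≍ f₂' ≫ c₂') (k : Z₁ ⊗ Z₂ ⟶ W) :
    f ≫ s ≫ (c₁ ⊗ₘ c₂) ≫ k = f' ≫ s' ≫ (c₁' ⊗ₘ c₂') ≫ k := by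
  rw [comp_split_tensor e, comp_split_tensor e', eq_of_heq h₁, eq_of_heq h₂]

theorem Coherent.app {Δ Γ₁ Γ₂ Δ' Γ₁' Γ₂' : CtxL} {M N : Tm} {A B : Ty}
    (hn : (names (bangify Δ ++ Γ₁ ++ Γ₂)).Nodup) (hn' : (names (bangify Δ' ++ Γ₁' ++ Γ₂')).Nodup)
    {d₁ : TypingD cty (bangify Δ ++ Γ₁) M (.arrow A B)}
    {d₁' : TypingD cty (bangify Δ' ++ Γ₁') M (.arrow A B)} (h₁ : Coherent I d₁ d₁')
    {d₂ : TypingD cty (bangify Δ ++ Γ₂) N A}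
    {d₂' : TypingD cty (bangify Δ' ++ Γ₂') N A} (h₂ : Coherent I d₂ d₂') :
    Coherent I (TypingD.app hn d₁ d₂) (TypingD.app hn' d₁' d₂') := by
  intro σ τ τ' X f f' hσ hτ hτ' hf hf' hag
  obtain ⟨X₁, X₂, σ₁, σ₂, τ₁, τ₂, τ₁', τ₂', h, f₁, f₂, f₁', f₂', ⟨a₁, a₂, a₃, a₄, a₅, a₆⟩,
    ⟨b₁, b₂, b₃, b₄, b₅, b₆⟩, e, e'⟩ := exists_common_split hσ hτ hτ' hf hf' hn hn'
      d₁.covers d₁'.covers d₂.covers d₂'.covers hag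
  have ha := h₁ a₁ a₂ a₃ a₄ a₅ (a₆.mono (fun _ => .inl) (fun _ => id) fun _ => id)
  have hb := h₂ b₁ b₂ b₃ b₄ b₅ (b₆.mono (fun _ => .inr) (fun _ => id) fun _ => id)
  exact ⟨heq_of_eq (comp_split_eq e e' ha.1 hb.1 _), fun h => nomatch h⟩

theorem Coherent.pair {Δ Γ₁ Γ₂ Δ' Γ₁' Γ₂' : CtxL} {n : ℕ} {M N : Tm} {A B : Ty}
    (hn : (names (bangify Δ ++ Γ₁ ++ Γ₂)).Nodup) (hn' : (names (bangify Δ' ++ Γ₁' ++ Γ₂')).Nodup)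
    {d₁ : TypingD cty (bangify Δ ++ Γ₁) M (bangN n A)}
    {d₁' : TypingD cty (bangify Δ' ++ Γ₁') M (bangN n A)} (h₁ : Coherent I d₁ d₁')
    {d₂ : TypingD cty (bangify Δ ++ Γ₂) N (bangN n B)}
    {d₂' : TypingD cty (bangify Δ' ++ Γ₂') N (bangN n B)} (h₂ : Coherent I d₂ d₂') :
    Coherent I (TypingD.pair hn d₁ d₂) (TypingD.pair hn' d₁' d₂') := by
  intro σ τ τ' X f f' hσ hτ hτ' hf hf' hag
  obtain ⟨X₁, X₂, σ₁, σ₂, τ₁, τ₂, τ₁', τ₂', h, f₁, f₂, f₁', f₂', ⟨a₁, a₂, a₃, a₄, a₅, a₆⟩,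
    ⟨b₁, b₂, b₃, b₄, b₅, b₆⟩, e, e'⟩ := exists_common_split hσ hτ hτ' hf hf' hn hn'
      d₁.covers d₁'.covers d₂.covers d₂'.covers hag
  have ha := h₁ a₁ a₂ a₃ a₄ a₅ (a₆.mono (fun _ => .inl) (fun _ => id) fun _ => id)
  have hb := h₂ b₁ b₂ b₃ b₄ b₅ (b₆.mono (fun _ => .inr) (fun _ => id) fun _ => id)
  refine ⟨heq_of_eq (comp_split_eq e e' ha.1 hb.1 _), fun h => ?_⟩
  rw [isValue, Bool.and_eq_true] at h
  exact heq_of_eq (comp_split_eq e e' (ha.2 h.1) (hb.2 h.2) _)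

theorem comp_split_letBind_eq {X Y Y' Y₁ Y₂ Y₁' Y₂' X₁ X₂ A B V Z Z' : D.Obj} {f : X ⟶ Y}
    {f' : X ⟶ Y'} {s : Y ⟶ Y₁ ⊗ Y₂} {s' : Y' ⟶ Y₁' ⊗ Y₂'} {h : X ⟶ X₁ ⊗ X₂} {f₁ : X₁ ⟶ Y₁}
    {f₂ : X₂ ⟶ Y₂} {f₁' : X₁ ⟶ Y₁'} {f₂' : X₂ ⟶ Y₂'} (e : f ≫ s = h ≫ (f₁ ⊗ₘ f₂))
    (e' : f' ≫ s' = h ≫ (f₁' ⊗ₘ f₂')) {j : X₂ ⊗ A ⟶ V} {k : Y₂ ⊗ A ⟶ Z} {k' : Y₂' ⊗ A ⟶ Z'}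
    {g : V ⟶ Z} {g' : V ⟶ Z'} (hk : f₂ ▷ A ≫ k = j ≫ g) (hk' : f₂' ▷ A ≫ k' = j ≫ g')
    {c₁ : Y₁ ⟶ D.T A} {c₁' : Y₁' ⟶ D.T A} (h₁ : f₁ ≫ c₁ ≍ f₁' ≫ c₁')
    {c₂ : Z ⟶ D.T B} {c₂' : Z' ⟶ D.T B} (h₂ : g ≫ c₂ ≍ g' ≫ c₂') :
    f ≫ s ≫ (c₁ ⊗ₘ 𝟙 Y₂) ≫ (β_ (D.T A) Y₂).hom ≫ strength Y₂ A ≫ tMap k ≫ tMap c₂ ≫ D.mu B =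
      f' ≫ s' ≫ (c₁' ⊗ₘ 𝟙 Y₂') ≫ (β_ (D.T A) Y₂').hom ≫ strength Y₂' A ≫ tMap k' ≫ tMap c₂' ≫
        D.mu B := by
  rw [comp_split_letBind e hk, comp_split_letBind e' hk', eq_of_heq h₁, eq_of_heq h₂]

theorem comp_split_letValue_eq {X Y Y' Y₁ Y₂ Y₁' Y₂' X₁ X₂ A B V Z Z' : D.Obj} {f : X ⟶ Y}
    {f' : X ⟶ Y'} {s : Y ⟶ Y₁ ⊗ Y₂} {s' : Y' ⟶ Y₁' ⊗ Y₂'} {h : X ⟶ X₁ ⊗ X₂} {f₁ : X₁ ⟶ Y₁}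
    {f₂ : X₂ ⟶ Y₂} {f₁' : X₁ ⟶ Y₁'} {f₂' : X₂ ⟶ Y₂'} (e : f ≫ s = h ≫ (f₁ ⊗ₘ f₂))
    (e' : f' ≫ s' = h ≫ (f₁' ⊗ₘ f₂')) {j : X₂ ⊗ A ⟶ V} {k : Y₂ ⊗ A ⟶ Z} {k' : Y₂' ⊗ A ⟶ Z'}
    {g : V ⟶ Z} {g' : V ⟶ Z'} (hk : f₂ ▷ A ≫ k = j ≫ g) (hk' : f₂' ▷ A ≫ k' = j ≫ g')
    {c₁ : Y₁ ⟶ A} {c₁' : Y₁' ⟶ A} (h₁ : f₁ ≫ c₁ ≍ f₁' ≫ c₁')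
    {c₂ : Z ⟶ B} {c₂' : Z' ⟶ B} (h₂ : g ≫ c₂ ≍ g' ≫ c₂') :
    f ≫ s ≫ (c₁ ⊗ₘ 𝟙 Y₂) ≫ (β_ A Y₂).hom ≫ k ≫ c₂ =
      f' ≫ s' ≫ (c₁' ⊗ₘ 𝟙 Y₂') ≫ (β_ A Y₂').hom ≫ k' ≫ c₂' := by
  rw [comp_split_letValue e hk, comp_split_letValue e' hk', eq_of_heq h₁, eq_of_heq h₂]

theorem Coherent.letv {Δ Γ₁ Γ₂ Δ' Γ₁' Γ₂' : CtxL} {x : ℕ} {M N : Tm} {A B : Ty}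
    (hn : (names (bangify Δ ++ Γ₁ ++ Γ₂)).Nodup) (hn' : (names (bangify Δ' ++ Γ₁' ++ Γ₂')).Nodup)
    (hx : x ∉ names (bangify Δ ++ Γ₁ ++ Γ₂)) (hx' : x ∉ names (bangify Δ' ++ Γ₁' ++ Γ₂'))
    {d₁ : TypingD cty (bangify Δ ++ Γ₁) M A}
    {d₁' : TypingD cty (bangify Δ' ++ Γ₁') M A} (h₁ : Coherent I d₁ d₁')
    {d₂ : TypingD cty ((bangify Δ ++ Γ₂) ++ [(x, A)]) N B}
    {d₂' : TypingD cty ((bangify Δ' ++ Γ₂') ++ [(x, A)]) N B} (h₂ : Coherent I d₂ d₂') :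
    Coherent I (TypingD.letv hn hx d₁ d₂) (TypingD.letv hn' hx' d₁' d₂') := by
  intro σ τ τ' X f f' hσ hτ hτ' hf hf' hag
  have hx₂ := notMem_names_right hx
  have hx₂' := notMem_names_right hx'
  obtain ⟨X₁, X₂, σ₁, σ₂, τ₁, τ₂, τ₁', τ₂', h, f₁, f₂, f₁', f₂', ⟨a₁, a₂, a₃, a₄, a₅, a₆⟩,
    ⟨b₁, b₂, b₃, b₄, b₅, b₆⟩, e, e'⟩ := exists_common_split hσ hτ hτ' hf hf' hn hn'
      d₁.covers d₁'.covers (d₂.covers_bind hx₂) (d₂'.covers_bind hx₂') hag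
  have ha := h₁ a₁ a₂ a₃ a₄ a₅ (a₆.mono (fun _ => .inl) (fun _ => id) fun _ => id)
  obtain ⟨s, hs⟩ := exists_fresh σ₂
  have hσ₂ := nodup_append_singleton b₁ hs
  obtain ⟨g, hg, hk⟩ := b₄.extend hσ₂ x A
  obtain ⟨g', hg', hk'⟩ := b₅.extend hσ₂ x A
  have hb := h₂ hσ₂ (nodup_append_singleton b₂ fun h => hs (b₄.labels_subset h))
    (nodup_append_singleton b₃ fun h => hs (b₅.labels_subset h)) hg hg'
    (b₆.extend (fun y hy e => .inr ⟨e, hy⟩) b₄.length_eq.2 b₅.length_eq.2 hx₂ hx₂' s A)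
  refine ⟨heq_of_eq (comp_split_letBind_eq e e' hk hk' ha.1 hb.1), fun h => ?_⟩
  rw [isValue, Bool.and_eq_true] at h
  exact heq_of_eq (comp_split_letValue_eq e e' hk hk' (ha.2 h.1) (hb.2 h.2))

theorem Coherent.letUnit {Δ Γ₁ Γ₂ Δ' Γ₁' Γ₂' : CtxL} {M N : Tm} {B : Ty}
    (hn : (names (bangify Δ ++ Γ₁ ++ Γ₂)).Nodup) (hn' : (names (bangify Δ' ++ Γ₁' ++ Γ₂')).Nodup)
    {d₁ : TypingD cty (bangify Δ ++ Γ₁) M .unit}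
    {d₁' : TypingD cty (bangify Δ' ++ Γ₁') M .unit} (h₁ : Coherent I d₁ d₁')
    {d₂ : TypingD cty (bangify Δ ++ Γ₂) N B}
    {d₂' : TypingD cty (bangify Δ' ++ Γ₂') N B} (h₂ : Coherent I d₂ d₂') :
    Coherent I (TypingD.letUnit hn d₁ d₂) (TypingD.letUnit hn' d₁' d₂') := by
  intro σ τ τ' X f f' hσ hτ hτ' hf hf' hag
  obtain ⟨X₁, X₂, σ₁, σ₂, τ₁, τ₂, τ₁', τ₂', h, f₁, f₂, f₁', f₂', ⟨a₁, a₂, a₃, a₄, a₅, a₆⟩,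
    ⟨b₁, b₂, b₃, b₄, b₅, b₆⟩, e, e'⟩ := exists_common_split hσ hτ hτ' hf hf' hn hn'
      d₁.covers d₁'.covers d₂.covers d₂'.covers hag
  have ha := h₁ a₁ a₂ a₃ a₄ a₅ (a₆.mono (fun _ => .inl) (fun _ => id) fun _ => id)
  have hb := h₂ b₁ b₂ b₃ b₄ b₅ (b₆.mono (fun _ => .inr) (fun _ => id) fun _ => id)
  have hk := rightUnitor_naturality f₂
  have hk' := rightUnitor_naturality f₂'
  refine ⟨heq_of_eq (comp_split_letBind_eq e e' hk hk' ha.1 hb.1), fun h => ?_⟩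
  rw [isValue, Bool.and_eq_true] at h
  exact heq_of_eq (comp_split_letValue_eq e e' hk hk' (ha.2 h.1) (hb.2 h.2))

theorem Coherent.letPair {Δ Γ₁ Γ₂ Δ' Γ₁' Γ₂' : CtxL} {n x y : ℕ} {M N : Tm} {A A' B : Ty}
    (hn : (names (bangify Δ ++ Γ₁ ++ Γ₂)).Nodup) (hn' : (names (bangify Δ' ++ Γ₁' ++ Γ₂')).Nodup)
    (hxy hxy' : x ≠ y)
    (hx : x ∉ names (bangify Δ ++ Γ₁ ++ Γ₂)) (hx' : x ∉ names (bangify Δ' ++ Γ₁' ++ Γ₂'))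
    (hy : y ∉ names (bangify Δ ++ Γ₁ ++ Γ₂)) (hy' : y ∉ names (bangify Δ' ++ Γ₁' ++ Γ₂'))
    {d₁ : TypingD cty (bangify Δ ++ Γ₁) M (bangN n (.tensor A A'))}
    {d₁' : TypingD cty (bangify Δ' ++ Γ₁') M (bangN n (.tensor A A'))} (h₁ : Coherent I d₁ d₁')
    {d₂ : TypingD cty ((bangify Δ ++ Γ₂) ++ [(x, bangN n A), (y, bangN n A')]) N B}
    {d₂' : TypingD cty ((bangify Δ' ++ Γ₂') ++ [(x, bangN n A), (y, bangN n A')]) N B}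
    (h₂ : Coherent I d₂ d₂') :
    Coherent I (TypingD.letPair hn hxy hx hy d₁ d₂) (TypingD.letPair hn' hxy' hx' hy' d₁' d₂') := by
  intro σ τ τ' X f f' hσ hτ hτ' hf hf' hag
  have hx₂ := notMem_names_right hx
  have hx₂' := notMem_names_right hx'
  have hy₂ := notMem_names_right hy
  have hy₂' := notMem_names_right hy'
  obtain ⟨X₁, X₂, σ₁, σ₂, τ₁, τ₂, τ₁', τ₂', h, f₁, f₂, f₁', f₂', ⟨a₁, a₂, a₃, a₄, a₅, a₆⟩,
    ⟨b₁, b₂, b₃, b₄, b₅, b₆⟩, e, e'⟩ := exists_common_split hσ hτ hτ' hf hf' hn hn'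
      d₁.covers d₁'.covers (d₂.covers_bind_two hx₂ hy₂) (d₂'.covers_bind_two hx₂' hy₂') hag
  have ha := h₁ a₁ a₂ a₃ a₄ a₅ (a₆.mono (fun _ => .inl) (fun _ => id) fun _ => id)
  obtain ⟨s, hs⟩ := exists_fresh σ₂
  obtain ⟨t, ht⟩ := exists_fresh (σ₂ ++ [s])
  have hl : ∀ {υ : List ℕ}, υ.Nodup → υ ⊆ σ₂ → (υ ++ [s, t]).Nodup := by
    intro υ hυ hsub
    have h := nodup_append_singleton (nodup_append_singleton hυ fun h => hs (hsub h))
      (s := t) fun h => ht (List.append_subset.2 ⟨fun _ h => List.mem_append_left _ (hsub h),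
        List.subset_append_right _ _⟩ h)
    simpa using h
  have hσ₂ := hl b₁ (List.Subset.refl _)
  obtain ⟨g, hg, hk⟩ := b₄.extendTwo hσ₂ x (bangN n A) y (bangN n A')
  obtain ⟨g', hg', hk'⟩ := b₅.extendTwo hσ₂ x (bangN n A) y (bangN n A')
  have hb := h₂ hσ₂ (hl b₂ b₄.labels_subset) (hl b₃ b₅.labels_subset) hg hg'
    (b₆.extendTwo (fun z hz e e' => .inr ⟨e, e', hz⟩) b₄.length_eq.2 b₅.length_eq.2 hxy hx₂ hx₂'
      hy₂ hy₂' s t _ _)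
  have hm := whisker_comp_natural hk (m2nDInv D I.obj n A A')
  have hm' := whisker_comp_natural hk' (m2nDInv D I.obj n A A')
  refine ⟨heq_of_eq (comp_split_letBind_eq e e' hm hm' ha.1 hb.1), fun h => ?_⟩
  rw [isValue, Bool.and_eq_true] at h
  refine heq_of_eq (Eq.trans ?_ ((comp_split_letValue_eq e e' hm hm' (ha.2 h.1) (hb.2 h.2)).trans ?_))
  · exact comp_split_value_assoc _ _ _ _ _ _ _
  · exact (comp_split_value_assoc _ _ _ _ _ _ _).symm

theorem Coherent.symm {Γ Γ' : CtxL} {M : Tm} {A A' : Ty} {π : TypingD cty Γ M A}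
    {π' : TypingD cty Γ' M A'} (h : Coherent I π π') : Coherent I π' π := by
  intro σ τ τ' X f f' hσ hτ hτ' hf hf' hag
  have h := h hσ hτ' hτ hf' hf fun x t t' B B' hx ht ht' =>
    (hag hx ht' ht).imp Eq.symm Eq.symm
  exact ⟨h.1.symm, fun hv => (h.2 hv).symm⟩

theorem Coherent.swap {Γ₁ Γ₂ Γ' : CtxL} {p q : ℕ × Ty} {M : Tm} {A A' : Ty}
    {π : TypingD cty (Γ₁ ++ p :: q :: Γ₂) M A} {π' : TypingD cty Γ' M A'}
    (h : Coherent I π π') : Coherent I (TypingD.swap π) π' := by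
  intro σ τ τ' X f f' hσ hτ hτ' hf hf' hag
  obtain ⟨τ₁, s, t, τ₂, rfl, h₁, h₂⟩ : ∃ τ₁ s t τ₂, τ = τ₁ ++ s :: t :: τ₂ ∧
      τ₁.length = Γ₁.length ∧ τ₂.length = Γ₂.length := by
    have hl := hf.length_eq.2
    have hl' : (τ.drop Γ₁.length).length = Γ₂.length + 2 := by
      rw [List.length_drop, hl]
      simp
    match hd : τ.drop Γ₁.length, hl' with
    | s :: t :: τ₂, hl' =>
      refine ⟨τ.take Γ₁.length, s, t, τ₂, by rw [← hd, List.take_append_drop], ?_, by simpa using hl'⟩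
      rw [List.length_take, hl]
      simp
  have hτ₀ : (τ₁ ++ t :: s :: τ₂).Nodup :=
    ((List.Perm.swap t s τ₂).append_left τ₁).nodup_iff.1 hτ
  have h := h hσ hτ₀ hτ' (hf.comp (.swapMor h₁ h₂ hτ)) hf'
    (hag.mono (fun _ => id) (fun y hy => by
      rw [List.zip_append h₁] at hy ⊢
      simp only [List.zip_cons_cons, List.mem_append, List.mem_cons] at hy ⊢
      tauto) fun _ => id)
  exact ⟨(heq_of_eq (Category.assoc _ _ _).symm).trans h.1,
    fun hv => (heq_of_eq (Category.assoc _ _ _).symm).trans (h.2 hv)⟩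

theorem TypingD.head_induction {M : Tm} {P : ∀ {Γ : CtxL} {A : Ty}, TypingD cty Γ M A → Prop}
    (swap : ∀ {Γ₁ Γ₂ : CtxL} {p q : ℕ × Ty} {A : Ty} (π : TypingD cty (Γ₁ ++ p :: q :: Γ₂) M A),
      P π → P (.swap π))
    (head : ∀ {Γ : CtxL} {A : Ty} (π : TypingD cty Γ M A), IsHead π → P π)
    {Γ : CtxL} {A : Ty} (π : TypingD cty Γ M A) : P π := by
  induction π with
  | swap _ ih => exact swap _ (ih swap head)
  | _ => exact head _ trivial

theorem coherent_of_head {M : Tm} (h : ∀ {Γ Γ' : CtxL} {A A' : Ty} (π : TypingD cty Γ M A)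
      (π' : TypingD cty Γ' M A'), IsHead π → IsHead π' → Coherent I π π')
    {Γ Γ' : CtxL} {A A' : Ty} (π : TypingD cty Γ M A) (π' : TypingD cty Γ' M A') :
    Coherent I π π' := by
  refine π.head_induction (P := fun π => Coherent I π π') (fun _ h => h.swap) fun π hπ => ?_
  exact (π'.head_induction (P := fun π' => Coherent I π' π) (fun _ h => h.swap)
    fun π' hπ' => (h π π' hπ hπ').symm).symm

theorem coherent {Γ Γ' : CtxL} {M : Tm} {A A' : Ty} (π : TypingD cty Γ M A)
    (π' : TypingD cty Γ' M A') : Coherent I π π' := by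
  induction M generalizing Γ Γ' A A' with
  | var x B =>
    refine coherent_of_head (fun π π' h h' => ?_) π π'
    cases π with
    | swap => exact h.elim
    | var hx s => cases π' with
      | swap => exact h'.elim
      | var hx' s' => exact coherent_var hx s hx' s'
  | cst c B =>
    refine coherent_of_head (fun π π' h h' => ?_) π π'
    cases π with
    | swap => exact h.elim
    | cst s => cases π' with
      | swap => exact h'.elim
      | cst s' => exact coherent_cst s s'
  | star n =>
    refine coherent_of_head (fun π π' h h' => ?_) π π'
    cases π with
    | swap => exact h.elim
    | star => cases π' with
      | swap => exact h'.elim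
      | star => exact coherent_star
  | lam n x B M ih =>
    refine coherent_of_head (fun π π' h h' => ?_) π π'
    cases π with
    | swap => exact h.elim
    | lam0 hx d => cases π' with
      | swap => exact h'.elim
      | lam0 hx' d' =>
        obtain rfl := d.type_unique d'
        exact (ih d d').lam0 hx hx'
    | lamS hx d => cases π' with
      | swap => exact h'.elim
      | lamS hx' d' =>
        obtain rfl := d.type_unique d'
        exact (ih d d').lamS hx hx'
  | app M N ih₁ ih₂ =>
    refine coherent_of_head (fun π π' h h' => ?_) π π'
    cases π with
    | swap => exact h.elim
    | app hn d e => cases π' with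
      | swap => exact h'.elim
      | app hn' d' e' =>
        obtain ⟨rfl, rfl⟩ := Ty.arrow.inj (d.type_unique d')
        exact .app hn hn' (ih₁ d d') (ih₂ e e')
  | pair n M N ih₁ ih₂ =>
    refine coherent_of_head (fun π π' h h' => ?_) π π'
    cases π with
    | swap => exact h.elim
    | pair hn d e => cases π' with
      | swap => exact h'.elim
      | pair hn' d' e' =>
        obtain rfl := bangN_injective (d.type_unique d')
        obtain rfl := bangN_injective (e.type_unique e')
        exact .pair hn hn' (ih₁ d d') (ih₂ e e')
  | letv x B M N ih₁ ih₂ =>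
    refine coherent_of_head (fun π π' h h' => ?_) π π'
    cases π with
    | swap => exact h.elim
    | letv hn hx d e => cases π' with
      | swap => exact h'.elim
      | letv hn' hx' d' e' =>
        obtain rfl := e.type_unique e'
        exact .letv hn hn' hx hx' (ih₁ d d') (ih₂ e e')
  | letPair n x B y C M N ih₁ ih₂ =>
    refine coherent_of_head (fun π π' h h' => ?_) π π'
    cases π with
    | swap => exact h.elim
    | letPair hn hxy hx hy d e => cases π' with
      | swap => exact h'.elim
      | letPair hn' hxy' hx' hy' d' e' =>
        obtain rfl := e.type_unique e'
        exact .letPair hn hn' hxy hxy' hx hx' hy hy' (ih₁ d d') (ih₂ e e')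
  | letUnit M N ih₁ ih₂ =>
    refine coherent_of_head (fun π π' h h' => ?_) π π'
    cases π with
    | swap => exact h.elim
    | letUnit hn d e => cases π' with
      | swap => exact h'.elim
      | letUnit hn' d' e' =>
        obtain rfl := e.type_unique e'
        exact .letUnit hn hn' (ih₁ d d') (ih₂ e e')

theorem eq_of_mem_zip_of_count {x : ℕ} {τ : List ℕ} {Γ : CtxL} (h : (names Γ).count x = 1)
    {t t' : ℕ} {A A' : Ty} (ht : (t, x, A) ∈ τ.zip Γ) (ht' : (t', x, A') ∈ τ.zip Γ) :
    t = t' ∧ A = A' := by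
  induction Γ generalizing τ with
  | nil => simp at ht
  | cons p Γ ih =>
    cases τ with
    | nil => simp at ht
    | cons u τ =>
      have hcount : x = p.1 → x ∉ names Γ := by
        rintro rfl
        have h' : (names Γ).count p.1 + 1 = 1 := by simpa [names] using h
        exact List.count_eq_zero.1 (by omega)
      rw [List.zip_cons_cons, List.mem_cons] at ht ht'
      rcases ht with ht | ht <;> rcases ht' with ht' | ht'
      · cases ht
        cases ht'
        exact ⟨rfl, rfl⟩
      · cases ht
        exact absurd (mem_names_of_mem_zip ht') (hcount rfl)
      · cases ht'
        exact absurd (mem_names_of_mem_zip ht) (hcount rfl)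
      · refine ih ?_ ht ht'
        have hx : p.1 ≠ x := fun e => hcount e.symm (mem_names_of_mem_zip ht)
        simpa [names, List.count_cons, hx] using h

end Coherence

end QLamSem

namespace QLamSem

/-- **Statement 13.** Given an interpretation `Θ` of the language in a linear category
for duplication `C` and a valid typing judgment `Γ ⊢ M : A` with two typing
derivations `π` and `π'`, the computational interpretations coincide
(`⟦π⟧^c = ⟦π'⟧^c`), and if `M` is a value, also the value interpretations coincide
(`⟦π⟧^v = ⟦π'⟧^v`).  Hence the denotation of a valid typing judgment is well
defined, independently of the choice of typing derivation. -/
theorem denotation_independent_of_derivation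
    (D : LCDData) (hD : LCDLaws D) (cty : ℕ → Ty) (I : Interp D cty)
    {Γ : CtxL} {M : Tm} {A : Ty} (π π' : TypingD cty Γ M A) :
    denC I π = denC I π' ∧
    ∀ h : isValue M = true, denV I π h = denV I π' h := by
  have : Fact (LCDLaws D) := ⟨hD⟩
  have hn : (List.range Γ.length).Nodup := List.nodup_range
  have hc := Can.id (D := D) (Θ := I.obj) (X := Γ) (List.length_range) hn
  have h := coherent (I := I) π π' hn hn hn hc hc
    fun x t t' B B' hx ht ht' => eq_of_mem_zip_of_count (π.count_of_occ hx) ht ht'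
  have id_comp := fun {B : D.Obj} (f : D.Hom (denCtx D I.obj Γ) B) => hD.id_comp f
  exact ⟨(id_comp _).symm.trans ((eq_of_heq h.1).trans (id_comp _)),
    fun hv => (id_comp _).symm.trans ((eq_of_heq (h.2 hv)).trans (id_comp _))⟩

end QLamSem
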